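/- Let a ∈ S^m_{ρ,δ}(n,2) with 0 ≤ δ ≤ ρ ≤ 1, δ < 1, and let p, q, r ∈ [1,∞] satisfy 1/r = 1/q + 1/p. If m < n(ρ−1)·max{1/2, 2/p − 1/2, 2/q − 1/2, 3/2 − 2/r}, then there is a constant C such that ‖T_a(f,g)‖_{L^r(ℝⁿ)} ≤ C‖f‖_{L^q(ℝⁿ)}‖g‖_{L^p(ℝⁿ)} for all Schwartz functions f, g on ℝⁿ. -/

import Mathlib

open MeasureTheory Metric Complex
open scoped ENNReal NNReal RealInnerProductSpace BigOperators

noncomputable section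

abbrev Rn (n : ℕ) : Type := EuclideanSpace ℝ (Fin n)

/-- The bilinear Hörmander class `S^m_{ρ,δ}(n,2)`: `a(x,ξ,η)` is smooth and for all
orders of differentiation `kx` in `x`, `kξ` in `ξ` and `kη` in `η` one has the bound
`C(kx,kξ,kη) (1+|ξ|²+|η|²)^{(m-ρ(kξ+kη)+δ kx)/2}`. -/
def BilinSmRhoDelta (n : ℕ) (m ρ δ : ℝ) (a : Rn n → Rn n → Rn n → ℂ) : Prop :=
  ContDiff ℝ (⊤ : ℕ∞) (fun p : Rn n × Rn n × Rn n => a p.1 p.2.1 p.2.2) ∧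
  ∀ kx kξ kη : ℕ, ∃ C : ℝ, ∀ (x ξ η : Rn n),
    ‖iteratedFDeriv ℝ kx
        (fun x' => iteratedFDeriv ℝ kξ
          (fun ξ' => iteratedFDeriv ℝ kη (fun η' => a x' ξ' η') η) ξ) x‖ ≤
      C * (1 + ‖ξ‖ ^ 2 + ‖η‖ ^ 2) ^ ((m - ρ * (kξ + kη) + δ * kx) / 2)

/-- The Fourier transform `f̂(ξ) = ∫ f(y) e^{-i ξ·y} dy`. -/
def fourierT {n : ℕ} (f : Rn n → ℂ) (ξ : Rn n) : ℂ :=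
  ∫ y : Rn n, f y * Complex.exp (-Complex.I * (⟪ξ, y⟫ : ℂ))

/-- The bilinear pseudodifferential operator
`T_a(f,g)(x) = ∬ a(x,ξ,η) f̂(ξ) ĝ(η) e^{ix·(ξ+η)} dξ dη`. -/
def Tbilin {n : ℕ} (a : Rn n → Rn n → Rn n → ℂ) (f g : Rn n → ℂ) (x : Rn n) : ℂ :=
  ∫ ξ : Rn n, ∫ η : Rn n,
    a x ξ η * fourierT f ξ * fourierT g η * Complex.exp (Complex.I * ((⟪x, ξ + η⟫ : ℝ) : ℂ))

/-! ### Iterated directional derivatives -/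

section DirDeriv

variable {E G H : Type*} [NormedAddCommGroup E] [NormedSpace ℝ E]
  [NormedAddCommGroup G] [NormedSpace ℝ G] [NormedAddCommGroup H] [NormedSpace ℝ H]

/-- Smoothness of all finite orders. -/
abbrev Smooth (f : E → G) : Prop := ContDiff ℝ (⊤ : ℕ∞) f

/-- The derivative of `f` in the direction `v`, as a function of the base point. -/
def dirDeriv (v : E) (f : E → G) : E → G := fun p => fderiv ℝ f p v

/-- The iterated derivative of `f` along the directions in a list. -/
def dirDerivs (l : List E) (f : E → G) : E → G := l.foldr dirDeriv f

@[simp] lemma dirDerivs_nil (f : E → G) : dirDerivs [] f = f := rfl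

@[simp] lemma dirDerivs_cons (v : E) (l : List E) (f : E → G) :
    dirDerivs (v :: l) f = dirDeriv v (dirDerivs l f) := rfl

lemma Smooth.differentiable' {f : E → G} (hf : Smooth f) : Differentiable ℝ f :=
  ContDiff.differentiable hf (by simp)

lemma Smooth.fderiv_smooth {f : E → G} (hf : Smooth f) : Smooth (fderiv ℝ f) :=
  ContDiff.fderiv_right hf (by simp)

lemma Smooth.dirDeriv {f : E → G} (hf : Smooth f) (v : E) : Smooth (dirDeriv v f) :=
  hf.fderiv_smooth.clm_apply contDiff_const

lemma Smooth.dirDerivs {f : E → G} (hf : Smooth f) (l : List E) : Smooth (dirDerivs l f) := by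
  induction l with
  | nil => exact hf
  | cons v l ih => exact Smooth.dirDeriv ih v

lemma dirDeriv_clm_comp (L : G →L[ℝ] H) {f : E → G} (hf : Smooth f) (v : E) :
    dirDeriv v (fun p => L (f p)) = fun p => L (dirDeriv v f p) := by
  funext p
  have : HasFDerivAt (fun p => L (f p)) (L.comp (fderiv ℝ f p)) p :=
    L.hasFDerivAt.comp p (hf.differentiable' p).hasFDerivAt
  simp [dirDeriv, this.fderiv]

lemma dirDerivs_clm_comp (L : G →L[ℝ] H) {f : E → G} (hf : Smooth f) (l : List E) :
    dirDerivs l (fun p => L (f p)) = fun p => L (dirDerivs l f p) := by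
  induction l with
  | nil => rfl
  | cons v l ih => rw [dirDerivs_cons, ih, dirDeriv_clm_comp L (hf.dirDerivs l)]; rfl

lemma dirDeriv_comm {f : E → G} (hf : Smooth f) (v w : E) :
    dirDeriv v (dirDeriv w f) = dirDeriv w (dirDeriv v f) := by
  funext p
  have key : ∀ a b : E, dirDeriv a (dirDeriv b f) p = fderiv ℝ (fderiv ℝ f) p a b := by
    intro a b
    have h := dirDeriv_clm_comp (ContinuousLinearMap.apply ℝ G b) hf.fderiv_smooth a
    exact congrFun h p
  have hs : IsSymmSndFDerivAt ℝ f p := by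
    refine ContDiffAt.isSymmSndFDerivAt (n := (⊤ : ℕ∞)) hf.contDiffAt ?_
    rw [minSmoothness_of_isRCLikeNormedField]
    exact WithTop.coe_le_coe.2 le_top
  rw [key, key, hs]

lemma dirDeriv_dirDerivs_comm {f : E → G} (hf : Smooth f) (v : E) (l : List E) :
    dirDeriv v (dirDerivs l f) = dirDerivs l (dirDeriv v f) := by
  induction l with
  | nil => rfl
  | cons w l ih => rw [dirDerivs_cons, dirDerivs_cons, dirDeriv_comm (hf.dirDerivs l), ih]

lemma iteratedFDeriv_apply_eq_dirDerivs {f : E → G} (hf : Smooth f) (k : ℕ) (w : Fin k → E)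
    (p : E) : iteratedFDeriv ℝ k f p w = dirDerivs (List.ofFn w) f p := by
  induction k generalizing p with
  | zero => simp
  | succ k ih =>
    rw [iteratedFDeriv_succ_apply_left, List.ofFn_succ, dirDerivs_cons]
    have hs : Smooth (iteratedFDeriv ℝ k f) := ContDiff.iteratedFDeriv_right hf (by exact_mod_cast le_top)
    have h := dirDeriv_clm_comp (ContinuousMultilinearMap.apply ℝ (fun _ : Fin k => E) G
      (Fin.tail w)) hs (w 0)
    have h2 : (fun p => iteratedFDeriv ℝ k f p (Fin.tail w)) =
        dirDerivs (List.ofFn (Fin.tail w)) f := funext fun p => ih _ p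
    have h3 := congrFun h p
    simp only [ContinuousMultilinearMap.apply_apply, h2] at h3
    exact h3.symm

lemma dirDeriv_comp_affine (L : E →L[ℝ] H) (c : H) {f : H → G} (hf : Smooth f) (v : E) :
    dirDeriv v (fun p => f (c + L p)) = fun p => dirDeriv (L v) f (c + L p) := by
  funext p
  have h1 : HasFDerivAt (fun p => c + L p) L p := L.hasFDerivAt.const_add c
  have : HasFDerivAt (fun p => f (c + L p)) ((fderiv ℝ f (c + L p)).comp L) p :=
    (hf.differentiable' _).hasFDerivAt.comp p h1
  simp [dirDeriv, this.fderiv]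

lemma dirDerivs_comp_affine (L : E →L[ℝ] H) (c : H) {f : H → G} (hf : Smooth f) (l : List E) :
    dirDerivs l (fun p => f (c + L p)) = fun p => dirDerivs (l.map L) f (c + L p) := by
  induction l with
  | nil => rfl
  | cons v l ih =>
    rw [dirDerivs_cons, ih, dirDeriv_comp_affine L c (hf.dirDerivs _), List.map_cons,
      dirDerivs_cons]

lemma dirDeriv_smul_dir (t : ℝ) (v : E) (f : E → G) :
    dirDeriv (t • v) f = fun p => t • dirDeriv v f p := by
  funext p; simp [dirDeriv]

lemma dirDeriv_add (v : E) {f g : E → G} (hf : Smooth f) (hg : Smooth g) :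
    dirDeriv v (fun p => f p + g p) = fun p => dirDeriv v f p + dirDeriv v g p := by
  funext p
  simp [dirDeriv, fderiv_fun_add (hf.differentiable' p) (hg.differentiable' p)]

lemma dirDeriv_mul (v : E) {f g : E → ℂ} (hf : Smooth f) (hg : Smooth g) :
    dirDeriv v (fun p => f p * g p) = fun p => dirDeriv v f p * g p + f p * dirDeriv v g p := by
  funext p
  simp only [dirDeriv]
  rw [fderiv_fun_mul (hf.differentiable' p) (hg.differentiable' p)]
  simp
  ring

lemma dirDeriv_eq_zero_of_eqOn {f : E → G} {s : Set E} (hs : IsOpen s) (h : ∀ p ∈ s, f p = 0)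
    (v : E) : ∀ p ∈ s, dirDeriv v f p = 0 := by
  intro p hp
  have : f =ᶠ[nhds p] fun _ => (0 : G) := by
    filter_upwards [hs.mem_nhds hp] with q hq using h q hq
  simp [dirDeriv, this.fderiv_eq]

/-- A family of functions is uniformly bounded on the sets `Ω i`, together with its directional
derivatives of order at most `k` along vectors of `V`. -/
def BddDerivs {ι : Type*} (V : Set E) (Ω : ι → Set E) : ℕ → (ι → E → ℂ) → Prop
  | 0, B => ∃ C : ℝ, ∀ i, ∀ p ∈ Ω i, ‖B i p‖ ≤ C
  | k + 1, B => BddDerivs V Ω k B ∧ ∀ v ∈ V, BddDerivs V Ω k (fun i => dirDeriv v (B i))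

namespace BddDerivs

variable {ι κ : Type*} {V : Set E} {Ω : ι → Set E} {B B' : ι → E → ℂ} {k : ℕ}

lemma bound (h : BddDerivs V Ω k B) : ∃ C : ℝ, 0 ≤ C ∧ ∀ i, ∀ p ∈ Ω i, ‖B i p‖ ≤ C := by
  induction k with
  | zero =>
    obtain ⟨C, hC⟩ := h
    exact ⟨max C 0, le_max_right _ _, fun i p hp => (hC i p hp).trans (le_max_left _ _)⟩
  | succ k ih => exact ih h.1

lemma mono_set {Ω' : ι → Set E} (h : BddDerivs V Ω k B) (hΩ : ∀ i, Ω' i ⊆ Ω i) :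
    BddDerivs V Ω' k B := by
  induction k generalizing B with
  | zero => exact h.imp fun C hC i p hp => hC i p (hΩ i hp)
  | succ k ih => exact ⟨ih h.1, fun v hv => ih (h.2 v hv)⟩

lemma reindex (h : BddDerivs V Ω k B) (φ : κ → ι) :
    BddDerivs V (fun i => Ω (φ i)) k (fun i => B (φ i)) := by
  induction k generalizing B with
  | zero => exact h.imp fun C hC i p hp => hC (φ i) p hp
  | succ k ih => exact ⟨ih h.1, fun v hv => ih (h.2 v hv)⟩

lemma zero : BddDerivs V Ω k (fun (_ : ι) (_ : E) => (0 : ℂ)) := by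
  induction k with
  | zero => exact ⟨0, by simp⟩
  | succ k ih =>
    refine ⟨ih, fun v _ => ?_⟩
    have : dirDeriv v (fun _ : E => (0 : ℂ)) = fun _ => 0 := by funext p; simp [dirDeriv]
    simpa only [this] using ih

lemma const (c : ℂ) : BddDerivs V Ω k (fun (_ : ι) (_ : E) => c) := by
  induction k with
  | zero => exact ⟨‖c‖, by simp⟩
  | succ k ih =>
    refine ⟨ih, fun v _ => ?_⟩
    have : dirDeriv v (fun _ : E => c) = fun _ => 0 := by funext p; simp [dirDeriv]
    simpa only [this] using zero

lemma add (hB : ∀ i, Smooth (B i)) (hB' : ∀ i, Smooth (B' i)) (h : BddDerivs V Ω k B)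
    (h' : BddDerivs V Ω k B') : BddDerivs V Ω k (fun i p => B i p + B' i p) := by
  induction k generalizing B B' with
  | zero =>
    obtain ⟨C, hC⟩ := h
    obtain ⟨C', hC'⟩ := h'
    exact ⟨C + C', fun i p hp => (norm_add_le _ _).trans (add_le_add (hC i p hp) (hC' i p hp))⟩
  | succ k ih =>
    refine ⟨ih hB hB' h.1 h'.1, fun v hv => ?_⟩
    have := ih (fun i => (hB i).dirDeriv v) (fun i => (hB' i).dirDeriv v) (h.2 v hv) (h'.2 v hv)
    simpa only [dirDeriv_add v (hB _) (hB' _)] using this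

lemma mul (hB : ∀ i, Smooth (B i)) (hB' : ∀ i, Smooth (B' i)) (h : BddDerivs V Ω k B)
    (h' : BddDerivs V Ω k B') : BddDerivs V Ω k (fun i p => B i p * B' i p) := by
  induction k generalizing B B' with
  | zero =>
    obtain ⟨C, hC0, hC⟩ := h.bound
    obtain ⟨C', hC0', hC'⟩ := h'.bound
    refine ⟨C * C', fun i p hp => ?_⟩
    rw [norm_mul]
    exact mul_le_mul (hC i p hp) (hC' i p hp) (norm_nonneg _) hC0
  | succ k ih =>
    refine ⟨ih hB hB' h.1 h'.1, fun v hv => ?_⟩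
    have h1 := ih (fun i => (hB i).dirDeriv v) hB' (h.2 v hv) h'.1
    have h2 := ih hB (fun i => (hB' i).dirDeriv v) h.1 (h'.2 v hv)
    have := add (fun i => ((hB i).dirDeriv v).mul (hB' i))
      (fun i => (hB i).mul ((hB' i).dirDeriv v)) h1 h2
    simpa only [dirDeriv_mul v (hB _) (hB' _)] using this

lemma star (hB : ∀ i, Smooth (B i)) (h : BddDerivs V Ω k B) :
    BddDerivs V Ω k (fun i p => (starRingEnd ℂ) (B i p)) := by
  induction k generalizing B with
  | zero => simpa [BddDerivs] using h
  | succ k ih =>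
    refine ⟨ih hB h.1, fun v hv => ?_⟩
    have := ih (fun i => (hB i).dirDeriv v) (h.2 v hv)
    have h2 : ∀ i, dirDeriv v (fun p => (starRingEnd ℂ) (B i p)) =
        fun p => (starRingEnd ℂ) (dirDeriv v (B i) p) := fun i =>
      dirDeriv_clm_comp (Complex.conjCLE : ℂ →L[ℝ] ℂ) (hB i) v
    simpa only [h2] using this

/-- Pulling back along maps which are affine with a common linear part. -/
lemma comp_affine {F : Type*} [NormedAddCommGroup F] [NormedSpace ℝ F] {W : Set F}
    (L : F →L[ℝ] E) (hL : ∀ w ∈ W, L w ∈ V) (hB : ∀ i, Smooth (B i)) (h : BddDerivs V Ω k B)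
    (c : κ → E) (φ : κ → ι) :
    BddDerivs W (fun j => {p | c j + L p ∈ Ω (φ j)}) k (fun j p => B (φ j) (c j + L p)) := by
  induction k generalizing B with
  | zero => exact h.imp fun C hC j p hp => hC _ _ hp
  | succ k ih =>
    refine ⟨ih hB h.1, fun w hw => ?_⟩
    have := ih (fun i => (hB i).dirDeriv (L w)) (h.2 _ (hL w hw))
    simpa only [dirDeriv_comp_affine L _ (hB _)] using this

lemma of_vanish (hΩ : ∀ i, IsClosed (Ω i)) (h0 : ∀ i, ∀ p ∉ Ω i, B i p = 0)
    (h : BddDerivs V Ω k B) : BddDerivs V (fun _ => Set.univ) k B := by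
  induction k generalizing B with
  | zero =>
    obtain ⟨C, hC0, hC⟩ := h.bound
    refine ⟨C, fun i p _ => ?_⟩
    by_cases hp : p ∈ Ω i
    · exact hC i p hp
    · simpa [h0 i p hp] using hC0
  | succ k ih =>
    refine ⟨ih h0 h.1, fun v hv => ih (fun i p hp => ?_) (h.2 v hv)⟩
    exact dirDeriv_eq_zero_of_eqOn (hΩ i).isOpen_compl (fun p hp => h0 i p hp) v p hp

/-- A single smooth function vanishing outside a compact set has bounded derivatives. -/
lemma of_compact {f : E → ℂ} (hf : Smooth f) {K : Set E} (hK : IsCompact K)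
    (h0 : ∀ p ∉ K, f p = 0) (k : ℕ) :
    BddDerivs V (fun _ : ι => Set.univ) k (fun _ => f) := by
  induction k generalizing f with
  | zero =>
    obtain ⟨C, hC⟩ := hK.exists_bound_of_continuousOn hf.continuous.continuousOn
    refine ⟨max C 0, fun _ p _ => ?_⟩
    by_cases hp : p ∈ K
    · exact (hC p hp).trans (le_max_left _ _)
    · simp [h0 p hp]
  | succ k ih =>
    exact ⟨ih hf h0, fun v _ => ih (hf.dirDeriv v)
      (dirDeriv_eq_zero_of_eqOn hK.isClosed.isOpen_compl h0 v)⟩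

lemma linear (L : E →L[ℝ] ℂ) (hΩ : ∃ C : ℝ, ∀ i, ∀ p ∈ Ω i, ‖L p‖ ≤ C) :
    BddDerivs V Ω k (fun (_ : ι) p => L p) := by
  induction k with
  | zero => exact hΩ
  | succ k ih =>
    refine ⟨ih, fun v _ => ?_⟩
    have : dirDeriv v (fun p => L p) = fun _ => L v := by
      funext p; simp [dirDeriv]
    simpa only [this] using const (L v)

end BddDerivs

end DirDeriv

/-! ### Mixed derivatives of bilinear symbols -/

section Symbol

variable {n : ℕ}

/-- The inclusion of `x`-directions. -/
def inX (n : ℕ) : Rn n →L[ℝ] Rn n × Rn n × Rn n := ContinuousLinearMap.inl ℝ _ _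

/-- The inclusion of `ξ`-directions. -/
def inXi (n : ℕ) : Rn n →L[ℝ] Rn n × Rn n × Rn n :=
  (ContinuousLinearMap.inr ℝ _ _).comp (ContinuousLinearMap.inl ℝ _ _)

/-- The inclusion of `η`-directions. -/
def inEta (n : ℕ) : Rn n →L[ℝ] Rn n × Rn n × Rn n :=
  (ContinuousLinearMap.inr ℝ _ _).comp (ContinuousLinearMap.inr ℝ _ _)

@[simp] lemma inX_apply (v : Rn n) : inX n v = (v, 0, 0) := rfl
@[simp] lemma inXi_apply (v : Rn n) : inXi n v = (0, v, 0) := rfl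
@[simp] lemma inEta_apply (v : Rn n) : inEta n v = (0, 0, v) := rfl

lemma smooth_iteratedFDeriv_param {X Y G : Type*} [NormedAddCommGroup X] [NormedSpace ℝ X]
    [NormedAddCommGroup Y] [NormedSpace ℝ Y] [NormedAddCommGroup G] [NormedSpace ℝ G]
    {g : X × Y → G} (hg : Smooth g) (k : ℕ) :
    Smooth (fun q : X × Y => iteratedFDeriv ℝ k (fun y => g (q.1, y)) q.2) := by
  induction k with
  | zero =>
    have : (fun q : X × Y => iteratedFDeriv ℝ 0 (fun y => g (q.1, y)) q.2) =
        fun q => (continuousMultilinearCurryFin0 ℝ Y G).symm (g q) := by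
      funext q; simp [iteratedFDeriv_zero_eq_comp]
    rw [this]
    exact (continuousMultilinearCurryFin0 ℝ Y G).symm.contDiff.comp hg
  | succ k ih =>
    have : (fun q : X × Y => iteratedFDeriv ℝ (k + 1) (fun y => g (q.1, y)) q.2) =
        fun q => (continuousMultilinearCurryLeftEquiv ℝ (fun _ : Fin (k + 1) => Y) G).symm
          (fderiv ℝ (fun y => iteratedFDeriv ℝ k (fun y => g (q.1, y)) y) q.2) := by
      funext q; rw [iteratedFDeriv_succ_eq_comp_left]; rfl
    rw [this]
    have hs : Smooth (fun q : X × Y => fderiv ℝ (fun y => iteratedFDeriv ℝ k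
        (fun y => g (q.1, y)) y) q.2) := by
      refine ContDiff.fderiv (m := (⊤ : ℕ∞)) (f := fun (q : X × Y) y => iteratedFDeriv ℝ k
        (fun y => g (q.1, y)) y) ?_ contDiff_snd (by simp)
      exact ih.comp ((contDiff_fst.comp contDiff_fst).prodMk contDiff_snd)
    exact hs.continuousLinearMap_comp
      ((continuousMultilinearCurryLeftEquiv ℝ (fun _ : Fin (k + 1) => Y) G).symm :
        _ →L[ℝ] ContinuousMultilinearMap ℝ (fun _ : Fin (k + 1) => Y) G)

lemma norm_dirDerivs_sorted_le {A : Rn n × Rn n × Rn n → ℂ} (hA : Smooth A)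
    {kx kξ kη : ℕ} (wx : Fin kx → Rn n) (wξ : Fin kξ → Rn n) (wη : Fin kη → Rn n)
    (x ξ η : Rn n) :
    ‖dirDerivs ((List.ofFn wx).map (inX n)) (dirDerivs ((List.ofFn wξ).map (inXi n))
        (dirDerivs ((List.ofFn wη).map (inEta n)) A)) (x, ξ, η)‖ ≤
      ‖iteratedFDeriv ℝ kx (fun x' => iteratedFDeriv ℝ kξ
          (fun ξ' => iteratedFDeriv ℝ kη (fun η' => A (x', ξ', η')) η) ξ) x‖ *
        ((∏ i, ‖wx i‖) * (∏ i, ‖wξ i‖) * ∏ i, ‖wη i‖) := by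
  set N₁ : Rn n × Rn n → ContinuousMultilinearMap ℝ (fun _ : Fin kη => Rn n) ℂ :=
    fun q => iteratedFDeriv ℝ kη (fun η' => A (q.1, q.2, η')) η with hN₁
  have sN₁ : Smooth N₁ := by
    have h := smooth_iteratedFDeriv_param (X := Rn n × Rn n) (Y := Rn n)
      (g := fun q => A (q.1.1, q.1.2, q.2)) (hA.comp ((contDiff_fst.comp contDiff_fst).prodMk
        ((contDiff_snd.comp contDiff_fst).prodMk contDiff_snd))) kη
    exact h.comp (contDiff_id.prodMk contDiff_const)
  set N₂ : Rn n → ContinuousMultilinearMap ℝ (fun _ : Fin kξ => Rn n)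
      (ContinuousMultilinearMap ℝ (fun _ : Fin kη => Rn n) ℂ) :=
    fun x' => iteratedFDeriv ℝ kξ (fun ξ' => N₁ (x', ξ')) ξ with hN₂
  have sN₂ : Smooth N₂ :=
    (smooth_iteratedFDeriv_param sN₁ kξ).comp (contDiff_id.prodMk contDiff_const)
  have sA₁ : ∀ x' ξ', Smooth fun η' => A (x', ξ', η') := fun x' ξ' =>
    hA.comp (contDiff_const.prodMk (contDiff_const.prodMk contDiff_id))
  have sN₁' : ∀ x', Smooth fun ξ' => N₁ (x', ξ') := fun x' =>
    sN₁.comp (contDiff_const.prodMk contDiff_id)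
  have e₁ : ∀ x' ξ', N₁ (x', ξ') wη =
      dirDerivs ((List.ofFn wη).map (inEta n)) A (x', ξ', η) := by
    intro x' ξ'
    rw [hN₁]
    simp only
    rw [iteratedFDeriv_apply_eq_dirDerivs (sA₁ x' ξ')]
    have := congrFun (dirDerivs_comp_affine (inEta n) (x', ξ', 0) hA (List.ofFn wη)) η
    simpa using this
  set A₁ := dirDerivs ((List.ofFn wη).map (inEta n)) A with hA₁
  have sA₁' : Smooth A₁ := hA.dirDerivs _
  have e₂ : ∀ x', N₂ x' wξ wη = dirDerivs ((List.ofFn wξ).map (inXi n)) A₁ (x', ξ, η) := by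
    intro x'
    rw [hN₂]
    simp only
    rw [iteratedFDeriv_apply_eq_dirDerivs (sN₁' x')]
    have h1 := congrFun (dirDerivs_clm_comp (ContinuousMultilinearMap.apply ℝ
      (fun _ : Fin kη => Rn n) ℂ wη) (sN₁' x') (List.ofFn wξ)) ξ
    simp only [ContinuousMultilinearMap.apply_apply, e₁] at h1
    rw [← h1]
    have := congrFun (dirDerivs_comp_affine (inXi n) (x', 0, η) sA₁' (List.ofFn wξ)) ξ
    simpa using this
  set A₂ := dirDerivs ((List.ofFn wξ).map (inXi n)) A₁ with hA₂
  have sA₂ : Smooth A₂ := sA₁'.dirDerivs _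
  have e₃ : iteratedFDeriv ℝ kx N₂ x wx wξ wη =
      dirDerivs ((List.ofFn wx).map (inX n)) A₂ (x, ξ, η) := by
    rw [iteratedFDeriv_apply_eq_dirDerivs sN₂]
    have h1 := congrFun (dirDerivs_clm_comp ((ContinuousMultilinearMap.apply ℝ
      (fun _ : Fin kη => Rn n) ℂ wη).comp (ContinuousMultilinearMap.apply ℝ
      (fun _ : Fin kξ => Rn n) _ wξ)) sN₂ (List.ofFn wx)) x
    simp only [ContinuousLinearMap.comp_apply, ContinuousMultilinearMap.apply_apply, e₂] at h1
    rw [← h1]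
    have := congrFun (dirDerivs_comp_affine (inX n) (0, ξ, η) sA₂ (List.ofFn wx)) x
    simpa using this
  rw [← e₃]
  calc ‖iteratedFDeriv ℝ kx N₂ x wx wξ wη‖
      ≤ ‖iteratedFDeriv ℝ kx N₂ x wx wξ‖ * ∏ i, ‖wη i‖ :=
        ContinuousMultilinearMap.le_opNorm _ _
    _ ≤ (‖iteratedFDeriv ℝ kx N₂ x wx‖ * ∏ i, ‖wξ i‖) * ∏ i, ‖wη i‖ := by
        gcongr; exact ContinuousMultilinearMap.le_opNorm _ _
    _ ≤ ((‖iteratedFDeriv ℝ kx N₂ x‖ * ∏ i, ‖wx i‖) * ∏ i, ‖wξ i‖) * ∏ i, ‖wη i‖ := by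
        gcongr; exact ContinuousMultilinearMap.le_opNorm _ _
    _ = _ := by ring

/-- The mixed derivative along `lx` in `x`, along `lξ` in `ξ` and along `lη` in `η`. -/
def mixedDeriv (lx lξ lη : List (Rn n)) (A : Rn n × Rn n × Rn n → ℂ) :
    Rn n × Rn n × Rn n → ℂ :=
  dirDerivs (lx.map (inX n)) (dirDerivs (lξ.map (inXi n)) (dirDerivs (lη.map (inEta n)) A))

lemma Smooth.mixedDeriv {A : Rn n × Rn n × Rn n → ℂ} (hA : Smooth A) (lx lξ lη : List (Rn n)) :
    Smooth (mixedDeriv lx lξ lη A) :=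
  Smooth.dirDerivs (Smooth.dirDerivs (Smooth.dirDerivs hA _) _) _

lemma dirDeriv_inX_mixedDeriv (v : Rn n) (lx lξ lη : List (Rn n))
    (A : Rn n × Rn n × Rn n → ℂ) :
    dirDeriv (inX n v) (mixedDeriv lx lξ lη A) = mixedDeriv (v :: lx) lξ lη A := rfl

lemma dirDeriv_inXi_mixedDeriv (v : Rn n) (lx lξ lη : List (Rn n))
    {A : Rn n × Rn n × Rn n → ℂ} (hA : Smooth A) :
    dirDeriv (inXi n v) (mixedDeriv lx lξ lη A) = mixedDeriv lx (v :: lξ) lη A := by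
  unfold mixedDeriv
  rw [dirDeriv_dirDerivs_comm (Smooth.dirDerivs (Smooth.dirDerivs hA _) _)]
  rfl

lemma dirDeriv_inEta_mixedDeriv (v : Rn n) (lx lξ lη : List (Rn n))
    {A : Rn n × Rn n × Rn n → ℂ} (hA : Smooth A) :
    dirDeriv (inEta n v) (mixedDeriv lx lξ lη A) = mixedDeriv lx lξ (v :: lη) A := by
  unfold mixedDeriv
  rw [dirDeriv_dirDerivs_comm (Smooth.dirDerivs (Smooth.dirDerivs hA _) _),
    dirDeriv_dirDerivs_comm (Smooth.dirDerivs hA _)]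
  rfl

lemma BilinSmRhoDelta.mixedDeriv_bound {m ρ δ : ℝ} {a : Rn n → Rn n → Rn n → ℂ}
    (ha : BilinSmRhoDelta n m ρ δ a) (lx lξ lη : List (Rn n)) :
    ∃ C : ℝ, 0 ≤ C ∧ ∀ x ξ η : Rn n,
      ‖mixedDeriv lx lξ lη (fun p : Rn n × Rn n × Rn n => a p.1 p.2.1 p.2.2) (x, ξ, η)‖ ≤
        C * (1 + ‖ξ‖ ^ 2 + ‖η‖ ^ 2) ^
          ((m - ρ * (lξ.length + lη.length) + δ * lx.length) / 2) := by
  obtain ⟨C, hC⟩ := ha.2 lx.length lξ.length lη.length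
  set P : ℝ := (∏ i, ‖lx.get i‖) * (∏ i, ‖lξ.get i‖) * ∏ i, ‖lη.get i‖ with hP
  have hP0 : 0 ≤ P := by positivity
  refine ⟨max C 0 * P, by positivity, fun x ξ η => ?_⟩
  have h := norm_dirDerivs_sorted_le ha.1 lx.get lξ.get lη.get x ξ η
  simp only [List.ofFn_get] at h
  refine h.trans ?_
  have h2 := hC x ξ η
  calc _ ≤ (C * (1 + ‖ξ‖ ^ 2 + ‖η‖ ^ 2) ^
          ((m - ρ * (lξ.length + lη.length) + δ * lx.length) / 2)) * P := by
        gcongr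
    _ ≤ (max C 0 * (1 + ‖ξ‖ ^ 2 + ‖η‖ ^ 2) ^
          ((m - ρ * (lξ.length + lη.length) + δ * lx.length) / 2)) * P := by
        gcongr; exact le_max_left _ _
    _ = _ := by ring

end Symbol

/-! ### Dyadic decomposition of the symbol -/

section Dyadic

variable {n : ℕ}

/-- The vectors pointing purely in the `x`-, the `ξ`- or the `η`-direction. -/
def pureDirs (n : ℕ) : Set (Rn n × Rn n × Rn n) :=
  Set.range (inX n) ∪ Set.range (inXi n) ∪ Set.range (inEta n)

/-- The dilation `(x, ξ, η) ↦ (A⁻¹ x, A ξ, A η)`. -/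
def dilate (n : ℕ) (A : ℝ) : Rn n × Rn n × Rn n →L[ℝ] Rn n × Rn n × Rn n :=
  (A⁻¹ • ContinuousLinearMap.fst ℝ (Rn n) (Rn n × Rn n)).prod
    (A • ContinuousLinearMap.snd ℝ (Rn n) (Rn n × Rn n))

@[simp] lemma dilate_apply (A : ℝ) (p : Rn n × Rn n × Rn n) :
    dilate n A p = (A⁻¹ • p.1, A • p.2) := rfl

lemma dilate_inX (A : ℝ) (v : Rn n) : dilate n A (inX n v) = A⁻¹ • inX n v := by simp
lemma dilate_inXi (A : ℝ) (v : Rn n) : dilate n A (inXi n v) = A • inXi n v := by simp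
lemma dilate_inEta (A : ℝ) (v : Rn n) : dilate n A (inEta n v) = A • inEta n v := by simp

lemma BddDerivs.const_mul {E ι : Type*} [NormedAddCommGroup E] [NormedSpace ℝ E] {V : Set E}
    {Ω : ι → Set E} {B : ι → E → ℂ} {k : ℕ} (hB : ∀ i, Smooth (B i)) (h : BddDerivs V Ω k B)
    (t : ι → ℂ) (ht : ∃ C : ℝ, ∀ i, ‖t i‖ ≤ C) : BddDerivs V Ω k (fun i p => t i * B i p) := by
  refine BddDerivs.mul (fun i => contDiff_const) hB ?_ h
  clear h
  obtain ⟨C, hC⟩ := ht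
  cases k with
  | zero => exact ⟨C, fun i p _ => hC i⟩
  | succ k =>
    have h0 : ∀ k, BddDerivs V Ω k (fun i (_ : E) => t i) := by
      intro k
      induction k with
      | zero => exact ⟨C, fun i p _ => hC i⟩
      | succ k ih =>
        refine ⟨ih, fun v _ => ?_⟩
        have : ∀ i, dirDeriv v (fun _ : E => t i) = fun _ => 0 := by
          intro i; funext p; simp [dirDeriv]
        simpa only [this] using BddDerivs.zero
    exact h0 _

lemma BddDerivs.dilations {E : Type*} [NormedAddCommGroup E] [NormedSpace ℝ E] {V : Set E}
    {f : E → ℂ} (hf : Smooth f) {K : Set E} (hK : IsCompact K) (h0 : ∀ p ∉ K, f p = 0) (k : ℕ)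
    {ι : Type*} (s : ι → ℝ) (hs : ∃ C : ℝ, ∀ i, ‖s i‖ ≤ C) :
    BddDerivs V (fun _ : ι => Set.univ) k (fun i p => f (s i • p)) := by
  induction k generalizing f with
  | zero =>
    obtain ⟨C, hC⟩ := BddDerivs.of_compact (V := V) (ι := Unit) hf hK h0 0
    exact ⟨C, fun i p _ => hC () _ (Set.mem_univ _)⟩
  | succ k ih =>
    refine ⟨ih hf h0, fun v _ => ?_⟩
    have h1 := ih (hf.dirDeriv v) (dirDeriv_eq_zero_of_eqOn hK.isClosed.isOpen_compl h0 v)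
    have h2 : ∀ i, dirDeriv v (fun p => f (s i • p)) =
        fun p => (s i : ℂ) * dirDeriv v f (s i • p) := by
      intro i
      have := dirDeriv_comp_affine (s i • ContinuousLinearMap.id ℝ E) 0 hf v
      simp only [smul_apply, ContinuousLinearMap.id_apply, zero_add] at this
      rw [this, dirDeriv_smul_dir]
      funext p; simp
    simp only [h2]
    refine BddDerivs.const_mul (fun i => (hf.dirDeriv v).comp (contDiff_const_smul _)) h1 _ ?_
    simpa using hs

/-- A smooth cutoff on `ℝⁿ × ℝⁿ` at radius `t ^ (-1/2)`. -/
def cutoff (t : ℝ) (z : Rn n × Rn n) : ℝ :=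
  Real.smoothTransition (2 - t * (‖z.1‖ ^ 2 + ‖z.2‖ ^ 2))

/-- The pieces of a dyadic partition of unity. -/
def annular : ℕ → Rn n × Rn n → ℝ
  | 0 => cutoff 1
  | j + 1 => fun z => cutoff ((4 ^ (j + 1))⁻¹) z - cutoff ((4 ^ j)⁻¹) z

lemma sum_annular (J : ℕ) (z : Rn n × Rn n) :
    ∑ j ∈ Finset.range (J + 1), annular j z = cutoff ((4 ^ J)⁻¹) z := by
  induction J with
  | zero => simp [annular]
  | succ J ih => rw [Finset.sum_range_succ, ih]; simp [annular]

lemma cutoff_of_le {t : ℝ} {z : Rn n × Rn n} (h : t * (‖z.1‖ ^ 2 + ‖z.2‖ ^ 2) ≤ 1) :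
    cutoff t z = 1 := Real.smoothTransition.one_of_one_le (by linarith)

lemma cutoff_of_ge {t : ℝ} {z : Rn n × Rn n} (h : 2 ≤ t * (‖z.1‖ ^ 2 + ‖z.2‖ ^ 2)) :
    cutoff t z = 0 := Real.smoothTransition.zero_of_nonpos (by linarith)

lemma abs_cutoff_le (t : ℝ) (z : Rn n × Rn n) : |cutoff t z| ≤ 1 := by
  have h1 := Real.smoothTransition.nonneg (2 - t * (‖z.1‖ ^ 2 + ‖z.2‖ ^ 2))
  have h2 := Real.smoothTransition.le_one (2 - t * (‖z.1‖ ^ 2 + ‖z.2‖ ^ 2))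
  rw [abs_le]
  unfold cutoff
  constructor <;> linarith

lemma smooth_cutoff (t : ℝ) : Smooth (fun z : Rn n × Rn n => (cutoff t z : ℂ)) := by
  have h : ContDiff ℝ (⊤ : ℕ∞) (fun z : Rn n × Rn n => cutoff t z) := by
    refine Real.smoothTransition.contDiff.comp (contDiff_const.sub (contDiff_const.mul ?_))
    exact (contDiff_fst.norm_sq ℝ).add (contDiff_snd.norm_sq ℝ)
  exact Complex.ofRealCLM.contDiff.comp h

lemma smooth_annular (j : ℕ) : Smooth (fun z : Rn n × Rn n => (annular j z : ℂ)) := by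
  cases j with
  | zero => exact smooth_cutoff _
  | succ j =>
    have := (smooth_cutoff (n := n) ((4 ^ (j + 1))⁻¹)).sub (smooth_cutoff ((4 ^ j)⁻¹))
    simpa [annular] using this

lemma cutoff_smul (t A : ℝ) (z : Rn n × Rn n) : cutoff t (A • z) = cutoff (A ^ 2 * t) z := by
  simp only [cutoff, Prod.smul_fst, Prod.smul_snd, norm_smul, mul_pow, Real.norm_eq_abs, sq_abs]
  ring_nf

lemma annular_support {j : ℕ} {z : Rn n × Rn n} (h : annular j z ≠ 0) :
    4 ^ j / 4 ≤ 1 + (‖z.1‖ ^ 2 + ‖z.2‖ ^ 2) ∧ ‖z.1‖ ^ 2 + ‖z.2‖ ^ 2 ≤ 2 * 4 ^ j := by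
  set q := ‖z.1‖ ^ 2 + ‖z.2‖ ^ 2 with hq
  have hq0 : 0 ≤ q := by positivity
  cases j with
  | zero =>
    constructor
    · norm_num; linarith
    · by_contra! hc
      exact h (cutoff_of_ge (by rw [← hq]; norm_num at hc ⊢; linarith))
  | succ j =>
    have h4 : (0 : ℝ) < 4 ^ j := by positivity
    constructor
    · by_contra! hc
      have h1 : q < 4 ^ j := by rw [pow_succ] at hc; linarith
      refine h ?_
      simp only [annular]
      rw [cutoff_of_le, cutoff_of_le, sub_self]
      · rw [← hq, inv_mul_le_iff₀ h4]; linarith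
      · rw [← hq, inv_mul_le_iff₀ (by positivity), pow_succ]; linarith
    · by_contra! hc
      have h1 : 2 * 4 ^ j * 4 < q := by rw [pow_succ] at hc; linarith
      refine h ?_
      simp only [annular]
      rw [cutoff_of_ge, cutoff_of_ge, sub_self]
      · rw [← hq, le_inv_mul_iff₀ h4]; linarith
      · rw [← hq, le_inv_mul_iff₀ (by positivity), pow_succ]; linarith

lemma bddDerivs_cutoff (t : ℕ → ℝ) (ht : ∀ j, 0 ≤ t j ∧ t j ≤ 4) (k : ℕ) :
    BddDerivs (pureDirs n) (fun _ : ℕ => Set.univ) k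
      (fun j p => (cutoff (t j) p.2 : ℂ)) := by
  have h1 := BddDerivs.dilations (V := (Set.univ : Set (Rn n × Rn n))) (smooth_cutoff (n := n) 1)
    (isCompact_closedBall 0 2) (fun z hz => ?_) k (fun j => √(t j)) ⟨2, fun j => ?_⟩
  · have h2 := h1.comp_affine (W := pureDirs n)
      (ContinuousLinearMap.snd ℝ (Rn n) (Rn n × Rn n)) (fun _ _ => Set.mem_univ _)
      (fun i => (smooth_cutoff 1).comp (contDiff_const_smul _)) (fun _ => 0) id
    have h3 := h2.mono_set (Ω' := fun _ => Set.univ) (fun i p _ => Set.mem_univ _)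
    simpa [cutoff_smul, Real.sq_sqrt (ht _).1] using h3
  · rw [cutoff_of_ge]
    · simp
    · simp only [mem_closedBall, dist_zero_right, Prod.norm_def, max_le_iff, not_and_or,
        not_le] at hz
      rcases hz with hz | hz <;> nlinarith [sq_nonneg ‖z.1‖, sq_nonneg ‖z.2‖]
  · rw [Real.norm_eq_abs, abs_of_nonneg (Real.sqrt_nonneg _)]
    exact (Real.sqrt_le_left (by norm_num)).2 (by linarith [(ht j).2])

/-- The dyadic frequency `2 ^ j`. -/
abbrev freq (j : ℕ) : ℝ := 2 ^ j

lemma one_le_freq (j : ℕ) : 1 ≤ freq j := one_le_pow₀ (by norm_num)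

lemma freq_pos (j : ℕ) : 0 < freq j := by positivity

lemma four_pow_eq (j : ℕ) : (4 : ℝ) ^ j = freq j ^ 2 := by
  rw [← pow_mul, mul_comm, pow_mul]; norm_num

/-- The normalized rescaled dyadic piece of a symbol. -/
def rescaledPiece (m ρ : ℝ) (a : Rn n → Rn n → Rn n → ℂ) (j : ℕ) (p : Rn n × Rn n × Rn n) : ℂ :=
  ((freq j ^ (-m) : ℝ) : ℂ) * (a ((freq j ^ ρ)⁻¹ • p.1) (freq j ^ ρ • p.2.1) (freq j ^ ρ • p.2.2) *
    (annular j (freq j ^ ρ • p.2) : ℂ))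

/-- The region containing the support of a rescaled dyadic piece. -/
def pieceRegion (n : ℕ) (ρ : ℝ) (j : ℕ) : Set (Rn n × Rn n × Rn n) :=
  {p | freq j ^ 2 / 4 ≤ 1 + ‖freq j ^ ρ • p.2.1‖ ^ 2 + ‖freq j ^ ρ • p.2.2‖ ^ 2 ∧
    1 + ‖freq j ^ ρ • p.2.1‖ ^ 2 + ‖freq j ^ ρ • p.2.2‖ ^ 2 ≤ 4 * freq j ^ 2}

lemma isClosed_pieceRegion (ρ : ℝ) (j : ℕ) : IsClosed (pieceRegion n ρ j) := by
  refine IsClosed.and ?_ ?_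
  · exact isClosed_le (by fun_prop) (by fun_prop)
  · exact isClosed_le (by fun_prop) (by fun_prop)

lemma rescaledPiece_eq_zero {m ρ : ℝ} {a : Rn n → Rn n → Rn n → ℂ} {j : ℕ}
    {p : Rn n × Rn n × Rn n} (hp : p ∉ pieceRegion n ρ j) : rescaledPiece m ρ a j p = 0 := by
  by_contra h
  have h1 : annular j (freq j ^ ρ • p.2) ≠ 0 := by
    intro h0; exact h (by simp [rescaledPiece, h0])
  obtain ⟨h2, h3⟩ := annular_support h1
  rw [four_pow_eq] at h2 h3
  refine hp ⟨?_, ?_⟩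
  · simpa [add_assoc] using h2
  · simp only [Prod.smul_fst, Prod.smul_snd] at h3
    nlinarith [one_le_freq j]

lemma rpow_le_four_rpow_abs {u : ℝ} (h1 : 1 / 4 ≤ u) (h2 : u ≤ 4) (c : ℝ) :
    u ^ c ≤ 4 ^ |c| := by
  rcases le_total 0 c with hc | hc
  · rw [abs_of_nonneg hc]; exact Real.rpow_le_rpow (by linarith) h2 hc
  · rw [abs_of_nonpos hc, Real.rpow_neg (by norm_num), ← Real.inv_rpow (by norm_num)]
    exact Real.rpow_le_rpow_of_nonpos (by norm_num) (by norm_num at h1 ⊢; linarith) hc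

lemma rescaled_weight_le {m ρ δ : ℝ} (hδρ : δ ≤ ρ) {R s : ℝ} (hR : 1 ≤ R)
    (h1 : R ^ 2 / 4 ≤ s) (h2 : s ≤ 4 * R ^ 2) (k l : ℕ) :
    R ^ (-m) * ((R ^ ρ) ^ l * ((R ^ ρ)⁻¹) ^ k) * s ^ ((m - ρ * l + δ * k) / 2) ≤
      4 ^ |(m - ρ * l + δ * k) / 2| := by
  have hR0 : 0 < R := by linarith
  set e := m - ρ * l + δ * k with he
  have hs : s ^ (e / 2) = R ^ e * (s / R ^ 2) ^ (e / 2) := by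
    have hR2 : (R ^ 2) ^ (e / 2) = R ^ e := by
      rw [← Real.rpow_natCast, ← Real.rpow_mul hR0.le]; congr 1; push_cast; ring
    rw [← hR2, ← Real.mul_rpow (by positivity)
      (div_nonneg (le_trans (by positivity) h1) (by positivity))]
    congr 1; field_simp
  have hu := rpow_le_four_rpow_abs (u := s / R ^ 2) (by rw [le_div_iff₀ (by positivity)]; linarith)
    (by rw [div_le_iff₀ (by positivity)]; linarith) (e / 2)
  have hpow : R ^ (-m) * ((R ^ ρ) ^ l * ((R ^ ρ)⁻¹) ^ k) * R ^ e = R ^ ((δ - ρ) * k) := by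
    rw [← Real.rpow_neg hR0.le, ← Real.rpow_mul_natCast hR0.le, ← Real.rpow_mul_natCast hR0.le,
      ← Real.rpow_add hR0, ← Real.rpow_add hR0, ← Real.rpow_add hR0]
    congr 1; rw [he]; ring
  rw [hs, ← mul_assoc, hpow]
  have h3 : R ^ ((δ - ρ) * k) ≤ 1 :=
    Real.rpow_le_one_of_one_le_of_nonpos hR
      (mul_nonpos_of_nonpos_of_nonneg (by linarith) (Nat.cast_nonneg k))
  calc _ ≤ 1 * (4 : ℝ) ^ |e / 2| := by
        refine mul_le_mul h3 hu (Real.rpow_nonneg ?_ _) zero_le_one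
        exact div_nonneg (le_trans (by positivity) h1) (by positivity)
    _ = _ := one_mul _

lemma bddDerivs_rescaled_mixedDeriv {m ρ δ : ℝ} (hδρ : δ ≤ ρ) {a : Rn n → Rn n → Rn n → ℂ}
    (ha : BilinSmRhoDelta n m ρ δ a) (k : ℕ) (lx lξ lη : List (Rn n)) :
    BddDerivs (pureDirs n) (pieceRegion n ρ) k (fun j p =>
      ((freq j ^ (-m) * ((freq j ^ ρ) ^ (lξ.length + lη.length) *
        ((freq j ^ ρ)⁻¹) ^ lx.length) : ℝ) : ℂ) *
      mixedDeriv lx lξ lη (fun p => a p.1 p.2.1 p.2.2) (dilate n (freq j ^ ρ) p)) := by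
  set A : Rn n × Rn n × Rn n → ℂ := fun p => a p.1 p.2.1 p.2.2 with hA
  have sA : Smooth A := ha.1
  induction k generalizing lx lξ lη with
  | zero =>
    obtain ⟨C, hC0, hC⟩ := ha.mixedDeriv_bound lx lξ lη
    refine ⟨4 ^ |(m - ρ * (lξ.length + lη.length) + δ * lx.length) / 2| * C,
      fun j p hp => ?_⟩
    rw [norm_mul, Complex.norm_real, Real.norm_eq_abs, abs_of_nonneg (by positivity)]
    have h1 := hC ((freq j ^ ρ)⁻¹ • p.1) (freq j ^ ρ • p.2.1) (freq j ^ ρ • p.2.2)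
    have h2 := rescaled_weight_le (m := m) hδρ (one_le_freq j) hp.1 hp.2 lx.length
      (lξ.length + lη.length)
    push_cast at h2
    refine (mul_le_mul_of_nonneg_left h1 (by positivity)).trans ?_
    rw [mul_left_comm, mul_comm C]
    exact mul_le_mul_of_nonneg_right h2 hC0
  | succ k ih =>
    refine ⟨ih lx lξ lη, ?_⟩
    have key : ∀ (v : Rn n × Rn n × Rn n) (c : ℕ → ℝ) (j : ℕ), dirDeriv v (fun p => (c j : ℂ) *
        mixedDeriv lx lξ lη A (dilate n (freq j ^ ρ) p)) = fun p => (c j : ℂ) *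
        dirDeriv (dilate n (freq j ^ ρ) v) (mixedDeriv lx lξ lη A)
          (dilate n (freq j ^ ρ) p) := by
      intro v c j
      have h1 := dirDeriv_comp_affine (dilate n (freq j ^ ρ)) 0 (sA.mixedDeriv lx lξ lη) v
      simp only [zero_add] at h1
      have h2 : Smooth fun p => mixedDeriv lx lξ lη A (dilate n (freq j ^ ρ) p) :=
        (sA.mixedDeriv lx lξ lη).comp (dilate n (freq j ^ ρ)).contDiff
      rw [dirDeriv_mul v contDiff_const h2, h1]
      funext p; simp [dirDeriv]
    rintro v ((⟨v, rfl⟩ | ⟨v, rfl⟩) | ⟨v, rfl⟩)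
    · have := ih (v :: lx) lξ lη
      convert this using 3 with j
      rw [key _ (fun j => freq j ^ (-m) * ((freq j ^ ρ) ^ (lξ.length + lη.length) *
        ((freq j ^ ρ)⁻¹) ^ lx.length)) j, dilate_inX, dirDeriv_smul_dir, dirDeriv_inX_mixedDeriv]
      simp only [Complex.real_smul, List.length_cons, pow_succ]
      push_cast; ring
    · have := ih lx (v :: lξ) lη
      convert this using 3 with j
      rw [key _ (fun j => freq j ^ (-m) * ((freq j ^ ρ) ^ (lξ.length + lη.length) *
        ((freq j ^ ρ)⁻¹) ^ lx.length)) j, dilate_inXi, dirDeriv_smul_dir,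
        dirDeriv_inXi_mixedDeriv _ _ _ _ sA]
      simp only [Complex.real_smul, List.length_cons, pow_succ, pow_add]
      push_cast; ring
    · have := ih lx lξ (v :: lη)
      convert this using 3 with j
      rw [key _ (fun j => freq j ^ (-m) * ((freq j ^ ρ) ^ (lξ.length + lη.length) *
        ((freq j ^ ρ)⁻¹) ^ lx.length)) j, dilate_inEta, dirDeriv_smul_dir,
        dirDeriv_inEta_mixedDeriv _ _ _ _ sA]
      simp only [Complex.real_smul, List.length_cons, pow_succ, pow_add]
      push_cast; ring

lemma smooth_rescaledPiece {m ρ : ℝ} {a : Rn n → Rn n → Rn n → ℂ}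
    (ha : Smooth (fun p : Rn n × Rn n × Rn n => a p.1 p.2.1 p.2.2)) (j : ℕ) :
    Smooth (rescaledPiece m ρ a j) := by
  refine ContDiff.mul contDiff_const (ContDiff.mul ?_ ?_)
  · exact ha.comp (dilate n (freq j ^ ρ)).contDiff
  · exact (smooth_annular j).comp (contDiff_snd.const_smul _)

theorem bddDerivs_rescaledPiece {m ρ δ : ℝ} (hδρ : δ ≤ ρ) (hρ1 : ρ ≤ 1)
    {a : Rn n → Rn n → Rn n → ℂ} (ha : BilinSmRhoDelta n m ρ δ a) (k : ℕ) :
    BddDerivs (pureDirs n) (fun _ : ℕ => Set.univ) k (rescaledPiece m ρ a) := by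
  refine BddDerivs.of_vanish (isClosed_pieceRegion ρ) (fun j p hp => rescaledPiece_eq_zero hp) ?_
  have h1 := bddDerivs_rescaled_mixedDeriv hδρ ha k [] [] []
  have hle : ∀ j : ℕ, (freq j ^ ρ) ^ 2 * (4 ^ j)⁻¹ ≤ 1 := by
    intro j
    rw [four_pow_eq, ← div_eq_mul_inv, div_le_one (by positivity)]
    have : freq j ^ ρ ≤ freq j ^ (1 : ℝ) := Real.rpow_le_rpow_of_exponent_le (one_le_freq j) hρ1
    rw [Real.rpow_one] at this
    exact pow_le_pow_left₀ (by positivity) this 2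
  have c1 := bddDerivs_cutoff (n := n) (fun j => (freq j ^ ρ) ^ 2 * (4 ^ j)⁻¹)
    (fun j => ⟨by positivity, (hle j).trans (by norm_num)⟩) k
  have c2 := bddDerivs_cutoff (n := n)
    (fun j => if j = 0 then 4 else 4 * ((freq j ^ ρ) ^ 2 * (4 ^ j)⁻¹))
    (fun j => by
      split_ifs
      · norm_num
      · exact ⟨by positivity, by linarith [hle j]⟩) k
  have hann : BddDerivs (pureDirs n) (fun _ : ℕ => Set.univ) k
      (fun j p => (annular j (freq j ^ ρ • p.2) : ℂ)) := by
    have sm : ∀ t : ℝ, Smooth (fun p : Rn n × Rn n × Rn n => (cutoff t p.2 : ℂ)) := fun t =>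
      (smooth_cutoff t).comp contDiff_snd
    have c3 := c2.const_mul (fun j => sm _) (fun j => if j = 0 then 0 else -1)
      ⟨1, fun j => by split_ifs <;> simp⟩
    have c4 := BddDerivs.add (fun j => sm _) (fun j => contDiff_const.mul (sm _)) c1 c3
    convert c4 using 3 with j p
    cases j with
    | zero => simp [annular]
    | succ j =>
      simp only [annular, cutoff_smul]
      rw [if_neg (by simp), if_neg (by simp)]
      have : 4 * ((freq (j + 1) ^ ρ) ^ 2 * ((4 : ℝ) ^ (j + 1))⁻¹) =
          (freq (j + 1) ^ ρ) ^ 2 * (4 ^ j)⁻¹ := by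
        rw [pow_succ 4 j]; field_simp
      rw [this]
      push_cast; ring
  have h2 := BddDerivs.mul (fun j => ?_) (fun j => ?_) h1
    (hann.mono_set (Ω' := pieceRegion n ρ) fun _ _ _ => Set.mem_univ _)
  · convert h2 using 3 with j p
    simp [rescaledPiece, mixedDeriv, mul_assoc]
  · exact contDiff_const.mul ((Smooth.mixedDeriv ha.1 _ _ _).comp (dilate n _).contDiff)
  · exact (smooth_annular j).comp (contDiff_snd.const_smul _)

end Dyadic

/-! ### Oscillatory integrals -/

section Oscillatory

variable {n : ℕ}

/-- The oscillating factor `e^{it}`. -/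
def osc (t : ℝ) : ℂ := Complex.exp (Complex.I * (t : ℂ))

@[simp] lemma norm_osc (t : ℝ) : ‖osc t‖ = 1 := by
  rw [osc, mul_comm]; exact Complex.norm_exp_ofReal_mul_I t

lemma osc_add (s t : ℝ) : osc (s + t) = osc s * osc t := by
  simp [osc, mul_add, Complex.exp_add]

@[simp] lemma conj_osc (t : ℝ) : (starRingEnd ℂ) (osc t) = osc (-t) := by
  simp [osc, ← Complex.exp_conj]

lemma smooth_osc : ContDiff ℝ (⊤ : ℕ∞) osc := by
  unfold osc
  exact (contDiff_const.mul Complex.ofRealCLM.contDiff).cexp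

@[fun_prop] lemma continuous_osc : Continuous osc := smooth_osc.continuous

lemma smooth_osc_inner (ζ : Rn n) : Smooth (fun x : Rn n => osc ⟪x, ζ⟫) :=
  smooth_osc.comp (contDiff_id.inner ℝ contDiff_const)

lemma dirDeriv_osc_inner (ζ v x : Rn n) :
    dirDeriv v (fun x : Rn n => osc ⟪x, ζ⟫) x = Complex.I * (⟪v, ζ⟫ : ℝ) * osc ⟪x, ζ⟫ := by
  have h1 : HasFDerivAt (fun x : Rn n => ((⟪x, ζ⟫ : ℝ) : ℂ))
      (Complex.ofRealCLM.comp ((innerSL ℝ).flip ζ)) x :=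
    Complex.ofRealCLM.hasFDerivAt.comp x ((innerSL ℝ).flip ζ).hasFDerivAt
  have h2 := (h1.const_mul Complex.I).cexp
  unfold dirDeriv osc
  rw [h2.fderiv]
  have h3 : innerSL ℝ ζ v = ⟪v, ζ⟫ := by
    rw [innerSL_apply_apply, real_inner_comm]
  simp [h3]
  ring

lemma integral_dirDeriv_mul_osc {u : Rn n → ℂ} (hu : Smooth u) (hc : HasCompactSupport u)
    (v ζ : Rn n) :
    ∫ x, dirDeriv v u x * osc ⟪x, ζ⟫ =
      -(Complex.I * (⟪v, ζ⟫ : ℝ)) * ∫ x, u x * osc ⟪x, ζ⟫ := by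
  have c0 := (smooth_osc_inner ζ).continuous
  have c1 := (hu.dirDeriv v).continuous
  have hc' : HasCompactSupport (dirDeriv v u) := hc.fderiv_apply ℝ v
  have i1 : Integrable (fun x => dirDeriv v u x * osc ⟪x, ζ⟫) :=
    (c1.mul c0).integrable_of_hasCompactSupport hc'.mul_right
  have i2 : Integrable (fun x => u x * osc ⟪x, ζ⟫) :=
    (hu.continuous.mul c0).integrable_of_hasCompactSupport hc.mul_right
  have i3 : Integrable (fun x => u x * dirDeriv v (fun x : Rn n => osc ⟪x, ζ⟫) x) :=
    (hu.continuous.mul ((smooth_osc_inner ζ).dirDeriv v).continuous).integrable_of_hasCompactSupport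
      hc.mul_right
  have h := integral_mul_fderiv_eq_neg_fderiv_mul_of_integrable (v := v) (μ := volume)
    i1 i3 i2 (fun x _ => hu.differentiable' x) (fun x _ => (smooth_osc_inner ζ).differentiable' x)
  have h' : ∫ x, u x * dirDeriv v (fun x : Rn n => osc ⟪x, ζ⟫) x =
    - ∫ x, dirDeriv v u x * osc ⟪x, ζ⟫ := h
  rw [eq_comm, neg_mul, neg_eq_iff_eq_neg, ← h', ← integral_const_mul]
  congr 1
  funext x
  rw [dirDeriv_osc_inner]; ring

/-- The product of the factors `1 + i ⟨y, v⟩` over a list of vectors. -/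
def listWeight (l : List (Rn n)) (y : Rn n) : ℂ :=
  (l.map fun v => 1 + Complex.I * (⟪v, y⟫ : ℝ)).prod

lemma listWeight_cons (v : Rn n) (l : List (Rn n)) (y : Rn n) :
    listWeight (v :: l) y = (1 + Complex.I * (⟪v, y⟫ : ℝ)) * listWeight l y := by
  simp [listWeight]

lemma normSq_one_add_I_mul (t : ℝ) : ‖1 + Complex.I * (t : ℂ)‖ ^ 2 = 1 + t ^ 2 := by
  rw [← Complex.normSq_eq_norm_sq, Complex.normSq_apply]; simp; ring

lemma one_add_I_mul_ne_zero (t : ℝ) : 1 + Complex.I * (t : ℂ) ≠ 0 := by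
  intro h
  have := normSq_one_add_I_mul t
  rw [h] at this
  simp at this
  nlinarith

lemma listWeight_ne_zero (l : List (Rn n)) (y : Rn n) : listWeight l y ≠ 0 := by
  induction l with
  | nil => simp [listWeight]
  | cons v l ih => rw [listWeight_cons]; exact mul_ne_zero (one_add_I_mul_ne_zero _) ih

lemma continuous_listWeight (l : List (Rn n)) : Continuous (listWeight l) := by
  induction l with
  | nil => exact (continuous_const (y := (1 : ℂ))).congr fun y => by simp [listWeight]
  | cons v l ih =>
    have : listWeight (v :: l) = fun y => (1 + Complex.I * (⟪v, y⟫ : ℝ)) * listWeight l y :=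
      funext (listWeight_cons v l)
    rw [this]; fun_prop

lemma listWeight_append (l l' : List (Rn n)) (y : Rn n) :
    listWeight (l ++ l') y = listWeight l y * listWeight l' y := by
  simp [listWeight]

/-- Every coordinate direction, repeated often enough for the weight to be integrable. -/
def decayDirs (n : ℕ) : List (Rn n) :=
  (List.replicate (2 * (n + 1)) (List.ofFn fun j : Fin n => EuclideanSpace.single j (1 : ℝ))).flatten

lemma one_add_sum_le_prod (s : Finset (Fin n)) (t : Fin n → ℝ) (ht : ∀ j, 0 ≤ t j) :
    1 + ∑ j ∈ s, t j ≤ ∏ j ∈ s, (1 + t j) := by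
  induction s using Finset.induction_on with
  | empty => simp
  | insert a s ha ih =>
    rw [Finset.sum_insert ha, Finset.prod_insert ha]
    have h1 : 0 ≤ ∑ j ∈ s, t j := Finset.sum_nonneg fun j _ => ht j
    nlinarith [mul_le_mul_of_nonneg_left ih (show 0 ≤ 1 + t a by linarith [ht a]),
      mul_nonneg (ht a) h1]

/-- An integrable weight on `ℝⁿ` bounded by one. -/
def decay (y : Rn n) : ℝ := ((1 + ‖y‖ ^ 2) ^ (n + 1))⁻¹

lemma decay_pos (y : Rn n) : 0 < decay y := by unfold decay; positivity

lemma decay_le_one (y : Rn n) : decay y ≤ 1 :=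
  inv_le_one_of_one_le₀ (one_le_pow₀ (by nlinarith [sq_nonneg ‖y‖]))

@[fun_prop] lemma continuous_decay : Continuous (decay : Rn n → ℝ) := by
  unfold decay
  exact Continuous.inv₀ (by fun_prop) (fun y => by positivity)

lemma decay_neg (y : Rn n) : decay (-y) = decay y := by simp [decay]

lemma integrable_decay : Integrable (decay : Rn n → ℝ) := by
  have h := integrable_rpow_neg_one_add_norm_sq (E := Rn n) (μ := volume) (r := 2 * (n + 1))
    (by simp; linarith [(Nat.cast_nonneg n : (0 : ℝ) ≤ n)])
  refine h.congr (Filter.Eventually.of_forall fun y => ?_)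
  simp only [decay]
  rw [show -(2 * ((n : ℝ) + 1)) / 2 = -((n + 1 : ℕ) : ℝ) by push_cast; ring,
    Real.rpow_neg (by positivity), Real.rpow_natCast]

lemma norm_listWeight_decayDirs_ge (y : Rn n) : (1 + ‖y‖ ^ 2) ^ (n + 1) ≤
    ‖listWeight (decayDirs n) y‖ := by
  set l : List (Rn n) := List.ofFn fun j : Fin n => EuclideanSpace.single j (1 : ℝ) with hl
  have h1 : ∀ k : ℕ, listWeight (List.replicate k l).flatten y = listWeight l y ^ k := by
    intro k
    induction k with
    | zero => simp [listWeight]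
    | succ k ih => rw [List.replicate_succ, List.flatten_cons, listWeight_append, ih]; ring
  have h2 : ‖listWeight l y‖ ^ 2 = ∏ j, (1 + y j ^ 2) := by
    simp only [listWeight, hl, List.map_ofFn, List.prod_ofFn, norm_prod, ← Finset.prod_pow,
      Function.comp_apply, normSq_one_add_I_mul]
    simp [PiLp.inner_apply]
  have h3 : 1 + ‖y‖ ^ 2 ≤ ‖listWeight l y‖ ^ 2 := by
    rw [h2, EuclideanSpace.norm_sq_eq]
    simpa using one_add_sum_le_prod Finset.univ (fun j => y j ^ 2) (fun j => sq_nonneg _)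
  rw [decayDirs, h1, norm_pow, pow_mul]
  exact pow_le_pow_left₀ (by positivity) h3 _

lemma norm_inv_listWeight_le (y : Rn n) : ‖(listWeight (decayDirs n) y)⁻¹‖ ≤ decay y := by
  rw [norm_inv]
  exact inv_anti₀ (by positivity) (norm_listWeight_decayDirs_ge y)

/-- Iterating `u ↦ u - ∂_v u`. -/
def oneSubDerivs (l : List (Rn n)) (u : Rn n → ℂ) : Rn n → ℂ :=
  l.foldr (fun v w x => w x - dirDeriv v w x) u

lemma oneSubDerivs_cons (v : Rn n) (l : List (Rn n)) (u : Rn n → ℂ) :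
    oneSubDerivs (v :: l) u = fun x => oneSubDerivs l u x - dirDeriv v (oneSubDerivs l u) x := rfl

lemma smooth_oneSubDerivs {u : Rn n → ℂ} (hu : Smooth u) (l : List (Rn n)) :
    Smooth (oneSubDerivs l u) := by
  induction l with
  | nil => exact hu
  | cons v l ih => exact ContDiff.sub ih (ih.dirDeriv v)

lemma oneSubDerivs_eq_zero {u : Rn n → ℂ} {s : Set (Rn n)} (hs : IsOpen s)
    (h : ∀ x ∈ s, u x = 0) (l : List (Rn n)) : ∀ x ∈ s, oneSubDerivs l u x = 0 := by
  induction l with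
  | nil => exact h
  | cons v l ih =>
    intro x hx
    rw [oneSubDerivs_cons]
    simp [ih x hx, dirDeriv_eq_zero_of_eqOn hs ih v x hx]

lemma hasCompactSupport_of_closedBall {E : Type*} [NormedAddCommGroup E] [ProperSpace E]
    {u : E → ℂ} {R : ℝ} (h : ∀ x ∉ closedBall (0 : E) R, u x = 0) : HasCompactSupport u :=
  HasCompactSupport.intro (isCompact_closedBall 0 R) h

lemma integral_oneSubDerivs_mul_osc {u : Rn n → ℂ} (hu : Smooth u) {R : ℝ}
    (h0 : ∀ x ∉ closedBall (0 : Rn n) R, u x = 0) (l : List (Rn n)) (ζ : Rn n) :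
    ∫ x, oneSubDerivs l u x * osc ⟪x, ζ⟫ = listWeight l ζ * ∫ x, u x * osc ⟪x, ζ⟫ := by
  induction l with
  | nil => simp [oneSubDerivs, listWeight]
  | cons v l ih =>
    have hs := smooth_oneSubDerivs hu l
    have hc : HasCompactSupport (oneSubDerivs l u) := hasCompactSupport_of_closedBall
      (oneSubDerivs_eq_zero isClosed_closedBall.isOpen_compl h0 l)
    have c0 := (smooth_osc_inner ζ).continuous
    have hc' : HasCompactSupport (dirDeriv v (oneSubDerivs l u)) := hc.fderiv_apply ℝ v
    rw [oneSubDerivs_cons]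
    simp only [sub_mul]
    rw [integral_sub, integral_dirDeriv_mul_osc hs hc, ih, listWeight_cons]
    · ring
    · exact (hs.continuous.mul c0).integrable_of_hasCompactSupport hc.mul_right
    · exact ((hs.dirDeriv v).continuous.mul c0).integrable_of_hasCompactSupport hc'.mul_right

lemma BddDerivs.oneSubDerivs {ι : Type*} {Ω : ι → Set (Rn n)} {u : ι → Rn n → ℂ}
    (hu : ∀ i, Smooth (u i)) (h : ∀ k, BddDerivs Set.univ Ω k u) (l : List (Rn n)) (k : ℕ) :
    BddDerivs Set.univ Ω k (fun i => oneSubDerivs l (u i)) := by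
  induction l generalizing k with
  | nil => exact h k
  | cons v l ih =>
    have h1 := (ih (k + 1)).2 v (Set.mem_univ _)
    have hs := fun i => smooth_oneSubDerivs (hu i) l
    have h2 := h1.const_mul (fun i => (hs i).dirDeriv v) (fun _ => -1) ⟨1, by simp⟩
    have h3 := BddDerivs.add hs (fun i => contDiff_const.mul ((hs i).dirDeriv v)) (ih k) h2
    convert h3 using 3 with i x
    rw [oneSubDerivs_cons]; ring

/-- Uniform decay of the Fourier transforms of a bounded family of bump functions. -/
theorem exists_norm_integral_osc_le {ι : Type*} {u : ι → Rn n → ℂ} (hu : ∀ i, Smooth (u i))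
    {R : ℝ} (h0 : ∀ i, ∀ x ∉ closedBall (0 : Rn n) R, u i x = 0)
    (h : ∀ k, BddDerivs Set.univ (fun _ => closedBall 0 R) k u) :
    ∃ C : ℝ, 0 ≤ C ∧ ∀ i ζ, ‖∫ x, u i x * osc ⟪x, ζ⟫‖ ≤ C * decay ζ := by
  obtain ⟨C, hC0, hC⟩ := (BddDerivs.oneSubDerivs hu h (decayDirs n) 0).bound
  refine ⟨C * volume.real (closedBall (0 : Rn n) R), by positivity, fun i ζ => ?_⟩
  have h1 := integral_oneSubDerivs_mul_osc (hu i) (h0 i) (decayDirs n) ζ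
  have h2 : ∫ x, u i x * osc ⟪x, ζ⟫ = (listWeight (decayDirs n) ζ)⁻¹ *
      ∫ x, oneSubDerivs (decayDirs n) (u i) x * osc ⟪x, ζ⟫ := by
    rw [h1, inv_mul_cancel_left₀ (listWeight_ne_zero _ _)]
  rw [h2, norm_mul, mul_comm (C * _)]
  refine mul_le_mul (norm_inv_listWeight_le ζ) ?_ (norm_nonneg _) (decay_pos ζ).le
  rw [← setIntegral_eq_integral_of_forall_compl_eq_zero (s := closedBall (0 : Rn n) R)]
  · refine norm_setIntegral_le_of_norm_le_const measure_closedBall_lt_top fun x hx => ?_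
    simpa using hC i x hx
  · intro x hx
    rw [oneSubDerivs_eq_zero isClosed_closedBall.isOpen_compl (h0 i) _ x hx, zero_mul]

end Oscillatory

/-! ### The `TT*` method -/

section TTStar

variable {X Z : Type*} [MeasurableSpace X] [MeasurableSpace Z] {μ : Measure X} {ν : Measure Z}

lemma ENNReal.mul_le_sq_add_sq (a b : ℝ≥0∞) : a * b ≤ a ^ 2 + b ^ 2 := by
  rcases le_total a b with h | h
  · calc a * b ≤ b * b := by gcongr
      _ = b ^ 2 := (sq b).symm
      _ ≤ _ := le_add_self
  · calc a * b ≤ a * a := by gcongr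
      _ = a ^ 2 := (sq a).symm
      _ ≤ _ := le_self_add

lemma lintegral_schur_le [SFinite ν] {k : Z → Z → ℝ≥0∞} (hk : Measurable (Function.uncurry k))
    (hsymm : ∀ z z', k z z' = k z' z) {M : ℝ≥0∞} {h : Z → ℝ≥0∞} (hh : Measurable h)
    (hM : ∀ z, ∫⁻ z', k z z' ∂ν ≤ M) :
    ∫⁻ p : Z × Z, h p.1 * h p.2 * k p.1 p.2 ∂(ν.prod ν) ≤ 2 * M * ∫⁻ z, h z ^ 2 ∂ν := by
  have hk1 : ∀ z, Measurable (k z) := fun z => hk.comp measurable_prodMk_left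
  have hk2 : ∀ z, Measurable (fun z' => k z' z) := fun z => hk.comp measurable_prodMk_right
  have hk' : Measurable (fun p : Z × Z => k p.1 p.2) := hk
  calc ∫⁻ p : Z × Z, h p.1 * h p.2 * k p.1 p.2 ∂(ν.prod ν)
      ≤ ∫⁻ p : Z × Z, (h p.1 ^ 2 * k p.1 p.2 + h p.2 ^ 2 * k p.1 p.2) ∂(ν.prod ν) := by
        refine lintegral_mono fun p => ?_
        rw [← add_mul]
        gcongr
        exact ENNReal.mul_le_sq_add_sq _ _
    _ = ∫⁻ p : Z × Z, h p.1 ^ 2 * k p.1 p.2 ∂(ν.prod ν) +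
        ∫⁻ p : Z × Z, h p.2 ^ 2 * k p.1 p.2 ∂(ν.prod ν) :=
        lintegral_add_left (by fun_prop) _
    _ ≤ M * ∫⁻ z, h z ^ 2 ∂ν + M * ∫⁻ z, h z ^ 2 ∂ν := by
        gcongr
        · rw [lintegral_prod _ (by fun_prop), ← lintegral_const_mul _ (by fun_prop)]
          refine lintegral_mono fun z => ?_
          simp only
          rw [lintegral_const_mul _ (hk1 z), mul_comm]
          gcongr
          exact hM z
        · rw [lintegral_prod_symm _ (by fun_prop), ← lintegral_const_mul _ (by fun_prop)]
          refine lintegral_mono fun z => ?_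
          simp only
          rw [lintegral_const_mul _ (hk2 z), mul_comm]
          gcongr
          simpa only [hsymm _ z] using hM z
    _ = 2 * M * ∫⁻ z, h z ^ 2 ∂ν := by ring

lemma lintegral_sq_le_of_kernel [SFinite μ] [SFinite ν] {Θ : X → Z → ℂ} {h : Z → ℂ} {κ : X → ℝ}
    {k : Z → Z → ℝ} (hκ : ∀ x, 0 ≤ κ x)
    (hker : Integrable (fun p : X × Z × Z => (κ p.1 : ℂ) *
      ((Θ p.1 p.2.1 * h p.2.1) * (starRingEnd ℂ) (Θ p.1 p.2.2 * h p.2.2))) (μ.prod (ν.prod ν)))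
    (hk : ∀ z z', ‖∫ x, (κ x : ℂ) * (Θ x z * (starRingEnd ℂ) (Θ x z')) ∂μ‖ ≤ k z z') :
    ∫⁻ x, ENNReal.ofReal (κ x) * ‖∫ z, Θ x z * h z ∂ν‖ₑ ^ 2 ∂μ ≤
      ∫⁻ p : Z × Z, ‖h p.1‖ₑ * ‖h p.2‖ₑ * ENNReal.ofReal (k p.1 p.2) ∂(ν.prod ν) := by
  set T : X → ℂ := fun x => ∫ z, Θ x z * h z ∂ν with hT
  have e1 : ∀ x, ∫ p : Z × Z, (κ x : ℂ) * ((Θ x p.1 * h p.1) *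
      (starRingEnd ℂ) (Θ x p.2 * h p.2)) ∂(ν.prod ν) = ((κ x * ‖T x‖ ^ 2 : ℝ) : ℂ) := by
    intro x
    rw [integral_const_mul, integral_prod_mul (fun z => Θ x z * h z)
      (fun z => (starRingEnd ℂ) (Θ x z * h z)), integral_conj, Complex.mul_conj,
      Complex.normSq_eq_norm_sq]
    push_cast; rfl
  have i1 : Integrable (fun x => ((κ x * ‖T x‖ ^ 2 : ℝ) : ℂ)) μ :=
    hker.integral_prod_left.congr (Filter.Eventually.of_forall e1)
  have i2 : Integrable (fun x => κ x * ‖T x‖ ^ 2) μ := by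
    simpa only [RCLike.re_eq_complex_re, Complex.ofReal_re] using i1.re
  have e2 : ∫⁻ x, ENNReal.ofReal (κ x) * ‖T x‖ₑ ^ 2 ∂μ =
      ENNReal.ofReal (∫ x, κ x * ‖T x‖ ^ 2 ∂μ) := by
    rw [ofReal_integral_eq_lintegral_ofReal i2
      (Filter.Eventually.of_forall fun x => mul_nonneg (hκ x) (sq_nonneg _))]
    refine lintegral_congr fun x => ?_
    rw [ENNReal.ofReal_mul (hκ x), ENNReal.ofReal_pow (norm_nonneg _), ofReal_norm]
  have e3 : ((∫ x, κ x * ‖T x‖ ^ 2 ∂μ : ℝ) : ℂ) = ∫ p : Z × Z, ∫ x, (κ x : ℂ) *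
      ((Θ x p.1 * h p.1) * (starRingEnd ℂ) (Θ x p.2 * h p.2)) ∂μ ∂(ν.prod ν) := by
    rw [← integral_complex_ofReal, ← integral_integral_swap hker]
    exact integral_congr_ae (Filter.Eventually.of_forall fun x => (e1 x).symm)
  rw [e2]
  calc ENNReal.ofReal (∫ x, κ x * ‖T x‖ ^ 2 ∂μ)
      ≤ ‖((∫ x, κ x * ‖T x‖ ^ 2 ∂μ : ℝ) : ℂ)‖ₑ := by
        rw [← ofReal_norm, Complex.norm_real]
        exact ENNReal.ofReal_le_ofReal (le_abs_self _)
    _ ≤ ∫⁻ p : Z × Z, ‖∫ x, (κ x : ℂ) * ((Θ x p.1 * h p.1) *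
          (starRingEnd ℂ) (Θ x p.2 * h p.2)) ∂μ‖ₑ ∂(ν.prod ν) := by
        rw [e3]; exact enorm_integral_le_lintegral_enorm _
    _ ≤ _ := by
        refine lintegral_mono fun p => ?_
        have : ∀ x, (κ x : ℂ) * ((Θ x p.1 * h p.1) * (starRingEnd ℂ) (Θ x p.2 * h p.2)) =
            (h p.1 * (starRingEnd ℂ) (h p.2)) *
              ((κ x : ℂ) * (Θ x p.1 * (starRingEnd ℂ) (Θ x p.2))) := by
          intro x; rw [map_mul]; ring
        simp only [this]
        rw [integral_const_mul, enorm_mul, enorm_mul]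
        gcongr
        · exact (RCLike.enorm_conj _).le
        · rw [← ofReal_norm]
          exact ENNReal.ofReal_le_ofReal (hk _ _)

/-- The `TT*` bound for a weighted `L²` norm. -/
theorem lintegral_sq_le_of_kernel_of_schur [SFinite μ] [SFinite ν] {Θ : X → Z → ℂ} {h : Z → ℂ}
    {κ : X → ℝ} {k : Z → Z → ℝ} (hκ : ∀ x, 0 ≤ κ x)
    (hker : Integrable (fun p : X × Z × Z => (κ p.1 : ℂ) *
      ((Θ p.1 p.2.1 * h p.2.1) * (starRingEnd ℂ) (Θ p.1 p.2.2 * h p.2.2))) (μ.prod (ν.prod ν)))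
    (hk : ∀ z z', ‖∫ x, (κ x : ℂ) * (Θ x z * (starRingEnd ℂ) (Θ x z')) ∂μ‖ ≤ k z z')
    (hkm : Measurable (Function.uncurry k)) (hsymm : ∀ z z', k z z' = k z' z)
    (hh : Measurable h) {M : ℝ≥0∞} (hM : ∀ z, ∫⁻ z', ENNReal.ofReal (k z z') ∂ν ≤ M) :
    ∫⁻ x, ENNReal.ofReal (κ x) * ‖∫ z, Θ x z * h z ∂ν‖ₑ ^ 2 ∂μ ≤
      2 * M * ∫⁻ z, ‖h z‖ₑ ^ 2 ∂ν :=
  (lintegral_sq_le_of_kernel hκ hker hk).trans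
    (lintegral_schur_le (k := fun z z' => ENNReal.ofReal (k z z')) (h := fun z => ‖h z‖ₑ)
      hkm.ennreal_ofReal (fun z z' => by rw [hsymm]) hh.enorm hM)

end TTStar

/-! ### Local `L²` bounds for Fourier transforms -/

section Bernstein

variable {n : ℕ}

lemma fourierT_eq (f : Rn n → ℂ) (ξ : Rn n) : fourierT f ξ = ∫ y, osc (-⟪ξ, y⟫) * f y := by
  unfold fourierT osc
  congr 1; funext y
  rw [mul_comm]; congr 2
  push_cast; ring

lemma enorm_fourierT_le (f : Rn n → ℂ) (ξ : Rn n) : ‖fourierT f ξ‖ₑ ≤ ∫⁻ y, ‖f y‖ₑ := by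
  rw [fourierT_eq]
  refine (enorm_integral_le_lintegral_enorm _).trans_eq ?_
  refine lintegral_congr fun y => ?_
  rw [enorm_mul, ← ofReal_norm, norm_osc]; simp

lemma integrable_osc_mul {f : Rn n → ℂ} (hf : Integrable f) (ξ : Rn n) :
    Integrable (fun y => osc (-⟪ξ, y⟫) * f y) :=
  hf.bdd_mul (c := 1) (by fun_prop) (Filter.Eventually.of_forall fun y => by simp)

lemma continuous_fourierT {f : Rn n → ℂ} (hf : Integrable f) : Continuous (fourierT f) := by
  have : fourierT f = fun ξ => ∫ y, osc (-⟪ξ, y⟫) * f y := funext (fourierT_eq f)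
  rw [this]
  refine continuous_of_dominated (bound := fun y => ‖f y‖)
    (fun ξ => (integrable_osc_mul hf ξ).aestronglyMeasurable)
    (fun ξ => Filter.Eventually.of_forall fun y => by simp) hf.norm
    (Filter.Eventually.of_forall fun y => by fun_prop)

lemma fourierT_add {f g : Rn n → ℂ} (hf : Integrable f) (hg : Integrable g) (ξ : Rn n) :
    fourierT (fun y => f y + g y) ξ = fourierT f ξ + fourierT g ξ := by
  simp only [fourierT_eq, mul_add]
  exact integral_add (integrable_osc_mul hf ξ) (integrable_osc_mul hg ξ)

lemma integral_gaussian_mul_osc {b : ℝ} (hb : 0 < b) (y : Rn n) :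
    ‖∫ ξ : Rn n, (Real.exp (-b * ‖ξ‖ ^ 2) : ℂ) * osc ⟪ξ, y⟫‖ =
      (Real.pi / b) ^ ((n : ℝ) / 2) * Real.exp (-(4 * b)⁻¹ * ‖y‖ ^ 2) := by
  have h := GaussianFourier.integral_cexp_neg_mul_sq_norm_add (V := Rn n) (b := (b : ℂ))
    (by simpa using hb) Complex.I y
  have h1 : ∀ ξ : Rn n, (Real.exp (-b * ‖ξ‖ ^ 2) : ℂ) * osc ⟪ξ, y⟫ =
      cexp (-b * ‖ξ‖ ^ 2 + Complex.I * ⟪y, ξ⟫) := by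
    intro ξ
    rw [osc, Complex.exp_add, real_inner_comm]
    push_cast; rfl
  simp only [h1]
  rw [h, norm_mul, Complex.norm_exp]
  congr 1
  · rw [finrank_euclideanSpace_fin, ← Complex.ofReal_div,
      show ((n : ℂ) / 2) = (((n : ℝ) / 2 : ℝ) : ℂ) by push_cast; rfl,
      Complex.norm_cpow_eq_rpow_re_of_pos (by positivity), Complex.ofReal_re]
  · congr 1
    have : Complex.I ^ 2 * (‖y‖ : ℂ) ^ 2 / (4 * b) = ((-(4 * b)⁻¹ * ‖y‖ ^ 2 : ℝ) : ℂ) := by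
      rw [Complex.I_sq]; push_cast; field_simp
    rw [this, Complex.ofReal_re]

lemma integrable_gaussian {b : ℝ} (hb : 0 < b) :
    Integrable (fun ξ : Rn n => Real.exp (-b * ‖ξ‖ ^ 2)) := by
  have h := (GaussianFourier.integrable_cexp_neg_mul_sq_norm_add (V := Rn n) (b := (b : ℂ))
    (by simpa using hb) 0 0).norm
  refine h.congr (Filter.Eventually.of_forall fun ξ => ?_)
  simp only [Complex.norm_exp]
  congr 1
  have : -(b : ℂ) * (‖ξ‖ : ℂ) ^ 2 + 0 * ((⟪(0 : Rn n), ξ⟫ : ℝ) : ℂ) =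
      ((-b * ‖ξ‖ ^ 2 : ℝ) : ℂ) := by push_cast; ring
  rw [this, Complex.ofReal_re]

lemma lintegral_gaussian_fourierT_le {b : ℝ} (hb : 0 < b) {f : Rn n → ℂ} (hfm : Measurable f)
    (hf : Integrable f) :
    ∫⁻ ξ, ENNReal.ofReal (Real.exp (-b * ‖ξ‖ ^ 2)) * ‖fourierT f ξ‖ₑ ^ 2 ≤
      2 * ENNReal.ofReal ((4 * Real.pi ^ 2) ^ ((n : ℝ) / 2)) * ∫⁻ y, ‖f y‖ₑ ^ 2 := by
  simp only [fourierT_eq]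
  refine lintegral_sq_le_of_kernel_of_schur (Θ := fun ξ y : Rn n => osc (-⟪ξ, y⟫))
    (κ := fun ξ => Real.exp (-b * ‖ξ‖ ^ 2)) (k := fun y y' : Rn n => (Real.pi / b) ^ ((n : ℝ) / 2) *
      Real.exp (-(4 * b)⁻¹ * ‖y' - y‖ ^ 2)) (fun ξ => (Real.exp_pos _).le) ?_ ?_ ?_ ?_ hfm ?_
  · have h1 : Integrable (fun p : Rn n × Rn n × Rn n => (Real.exp (-b * ‖p.1‖ ^ 2) : ℂ) *
        (f p.2.1 * (starRingEnd ℂ) (f p.2.2))) :=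
      (integrable_gaussian hb).ofReal.mul_prod
        (hf.mul_prod (Complex.conjLIE.integrable_comp_iff.2 hf))
    have h2 := h1.bdd_mul (c := 1)
      (f := fun p : Rn n × Rn n × Rn n => osc (-⟪p.1, p.2.1⟫) * osc ⟪p.1, p.2.2⟫)
      (by fun_prop) (Filter.Eventually.of_forall fun y => by simp)
    refine h2.congr (Filter.Eventually.of_forall fun p => ?_)
    simp only [map_mul, conj_osc, neg_neg]
    ring
  · intro y y'
    rw [← integral_gaussian_mul_osc hb]
    refine le_of_eq ?_
    congr 2; funext ξ
    rw [conj_osc, ← osc_add, inner_sub_right]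
    congr 2; ring
  · exact Continuous.measurable (by unfold Function.uncurry; fun_prop)
  · intro y y'; rw [norm_sub_rev]
  · intro y
    have hb' : 0 < (4 * b)⁻¹ := by positivity
    have h1 : Integrable fun y' : Rn n => (Real.pi / b) ^ ((n : ℝ) / 2) *
        Real.exp (-(4 * b)⁻¹ * ‖y' - y‖ ^ 2) :=
      ((integrable_gaussian hb').comp_sub_right y).const_mul _
    rw [← ofReal_integral_eq_lintegral_ofReal h1
      (Filter.Eventually.of_forall fun y' => by positivity), integral_const_mul,
      integral_sub_right_eq_self (fun y' : Rn n => Real.exp (-(4 * b)⁻¹ * ‖y'‖ ^ 2)) y,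
      GaussianFourier.integral_rexp_neg_mul_sq_norm hb', finrank_euclideanSpace_fin,
      ← Real.mul_rpow (by positivity) (by positivity)]
    refine le_of_eq ?_
    congr 2; field_simp

/-- Local Bessel inequality. -/
lemma exists_lintegral_fourierT_sq_le (n : ℕ) : ∃ C : ℝ≥0, ∀ N : ℝ, 0 < N → ∀ f : Rn n → ℂ,
    Measurable f → Integrable f →
    ∫⁻ ξ in closedBall 0 N, ‖fourierT f ξ‖ₑ ^ 2 ≤ C * ∫⁻ y, ‖f y‖ₑ ^ 2 := by
  refine ⟨Real.toNNReal (Real.exp 1) * (2 * Real.toNNReal ((4 * Real.pi ^ 2) ^ ((n : ℝ) / 2))),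
    fun N hN f hfm hf => ?_⟩
  have hb : 0 < (N ^ 2)⁻¹ := by positivity
  have h1 := lintegral_gaussian_fourierT_le hb hfm hf
  push_cast
  rw [mul_assoc]
  refine le_trans ?_ (mul_le_mul_right h1 _)
  rw [← lintegral_const_mul' _ _ (by simp)]
  refine le_trans ?_ (setLIntegral_le_lintegral (closedBall 0 N) _)
  refine setLIntegral_mono' measurableSet_closedBall fun ξ hξ => ?_
  rw [← mul_assoc]
  refine le_mul_of_one_le_left zero_le ?_
  rw [← ENNReal.ofReal, ← ENNReal.ofReal_mul (Real.exp_pos _).le, ← Real.exp_add,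
    ENNReal.one_le_ofReal]
  refine Real.one_le_exp ?_
  have h2 : ‖ξ‖ ≤ N := by simpa using hξ
  have : (N ^ 2)⁻¹ * ‖ξ‖ ^ 2 ≤ 1 := by
    rw [inv_mul_le_iff₀ (by positivity)]
    nlinarith [norm_nonneg ξ]
  linarith

lemma volume_closedBall_eq {N : ℝ} (hN : 0 < N) :
    volume (closedBall (0 : Rn n) N) = ENNReal.ofReal (N ^ n) * volume (ball (0 : Rn n) 1) := by
  rw [Measure.addHaar_closedBall _ _ hN.le, finrank_euclideanSpace_fin]

lemma lintegral_fourierT_sq_le {N : ℝ} (hN : 0 < N) (f : Rn n → ℂ) :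
    ∫⁻ ξ in closedBall 0 N, ‖fourierT f ξ‖ₑ ^ 2 ≤
      volume (ball (0 : Rn n) 1) * (ENNReal.ofReal (N ^ n) * (∫⁻ y, ‖f y‖ₑ) ^ 2) := by
  calc _ ≤ ∫⁻ ξ in closedBall (0 : Rn n) N, (∫⁻ y, ‖f y‖ₑ) ^ 2 := by
        refine lintegral_mono fun ξ => ?_
        gcongr
        exact enorm_fourierT_le f ξ
    _ = _ := by
        rw [setLIntegral_const, volume_closedBall_eq hN]; ring

end Bernstein

section LocalLp

variable {n : ℕ}

/-- The finite measure `decay y dy`. -/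
def decayMeasure (n : ℕ) : Measure (Rn n) :=
  volume.withDensity fun y => ENNReal.ofReal (decay y)

lemma measurable_ofReal_decay : Measurable fun y : Rn n => ENNReal.ofReal (decay y) :=
  continuous_decay.measurable.ennreal_ofReal

lemma lintegral_decayMeasure {f : Rn n → ℝ≥0∞} (hf : Measurable f) :
    ∫⁻ y, f y ∂decayMeasure n = ∫⁻ y, ENNReal.ofReal (decay y) * f y := by
  rw [decayMeasure, lintegral_withDensity_eq_lintegral_mul _ measurable_ofReal_decay hf]
  rfl

instance : IsFiniteMeasure (decayMeasure n) :=
  isFiniteMeasure_withDensity_ofReal integrable_decay.2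

lemma ofReal_decay_sq_le (y : Rn n) :
    ENNReal.ofReal (decay y) ^ 2 ≤ ENNReal.ofReal (decay y) := by
  rw [sq]
  exact mul_le_of_le_one_right' (ENNReal.ofReal_le_one.2 (decay_le_one y))

/-- `F` is dominated by `decay * f`, and both are measurable. -/
structure DecayDominated (F f : Rn n → ℂ) : Prop where
  measurable : Measurable F
  integrable : Integrable F
  measurable' : Measurable f
  le : ∀ y, ‖F y‖ ≤ decay y * ‖f y‖

lemma DecayDominated.enorm_le {F f : Rn n → ℂ} (h : DecayDominated F f) (y : Rn n) :
    ‖F y‖ₑ ≤ ENNReal.ofReal (decay y) * ‖f y‖ₑ := by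
  rw [← ofReal_norm, ← ofReal_norm, ← ENNReal.ofReal_mul (decay_pos y).le]
  exact ENNReal.ofReal_le_ofReal (h.le y)

lemma DecayDominated.lintegral_sq_le {F f : Rn n → ℂ} (h : DecayDominated F f) :
    ∫⁻ y, ‖F y‖ₑ ^ 2 ≤ ∫⁻ y, ‖f y‖ₑ ^ 2 ∂decayMeasure n := by
  rw [lintegral_decayMeasure (h.measurable'.enorm.pow_const 2)]
  refine lintegral_mono fun y => ?_
  calc ‖F y‖ₑ ^ 2 ≤ (ENNReal.ofReal (decay y) * ‖f y‖ₑ) ^ 2 := by gcongr; exact h.enorm_le y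
    _ = ENNReal.ofReal (decay y) ^ 2 * ‖f y‖ₑ ^ 2 := by ring
    _ ≤ _ := by gcongr; exact ofReal_decay_sq_le y

lemma DecayDominated.lintegral_le {F f : Rn n → ℂ} (h : DecayDominated F f) :
    ∫⁻ y, ‖F y‖ₑ ≤ ∫⁻ y, ‖f y‖ₑ ∂decayMeasure n := by
  rw [lintegral_decayMeasure h.measurable'.enorm]
  exact lintegral_mono fun y => h.enorm_le y

lemma DecayDominated.indicator {F f : Rn n → ℂ} (h : DecayDominated F f) {s : Set (Rn n)}
    (hs : MeasurableSet s) : DecayDominated (s.indicator F) (s.indicator f) where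
  measurable := h.measurable.indicator hs
  integrable := h.integrable.indicator hs
  measurable' := h.measurable'.indicator hs
  le y := by
    by_cases hy : y ∈ s
    · simpa [hy] using h.le y
    · simp [hy]

lemma exists_lintegral_fourierT_sq_le_eLpNorm_of_two_le (n : ℕ) {p : ℝ≥0∞} (hp : 2 ≤ p) :
    ∃ C : ℝ≥0, ∀ N : ℝ, 0 < N → ∀ F f : Rn n → ℂ, DecayDominated F f →
    ∫⁻ ξ in closedBall 0 N, ‖fourierT F ξ‖ₑ ^ 2 ≤ C * eLpNorm f p (decayMeasure n) ^ 2 := by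
  obtain ⟨C, hC⟩ := exists_lintegral_fourierT_sq_le n
  set D : ℝ≥0∞ := decayMeasure n Set.univ ^ (1 / (2 : ℝ≥0∞).toReal - 1 / p.toReal) with hD
  have hD' : D ≠ ∞ := by
    refine ENNReal.rpow_ne_top_of_nonneg ?_ (measure_ne_top _ _)
    rcases eq_or_ne p ∞ with rfl | h
    · simp
    · have : (2 : ℝ≥0∞).toReal ≤ p.toReal := ENNReal.toReal_mono h hp
      simp only [ENNReal.toReal_ofNat] at this ⊢
      have := one_div_le_one_div_of_le (by norm_num) this
      linarith
  refine ⟨C * D.toNNReal ^ 2, fun N hN F f h => (hC N hN F h.measurable h.integrable).trans ?_⟩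
  push_cast
  rw [ENNReal.coe_toNNReal hD', mul_assoc, ← mul_pow, mul_comm D]
  gcongr
  refine h.lintegral_sq_le.trans ?_
  have h1 := eLpNorm_le_eLpNorm_mul_rpow_measure_univ (μ := decayMeasure n) hp
    h.measurable'.aestronglyMeasurable
  refine le_trans (le_of_eq ?_) (pow_le_pow_left' h1 2)
  rw [eLpNorm_eq_lintegral_rpow_enorm_toReal (by norm_num) (by norm_num)]
  simp only [ENNReal.toReal_ofNat, ENNReal.rpow_ofNat]
  rw [← ENNReal.rpow_natCast, ← ENNReal.rpow_mul]
  norm_num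

lemma exists_lintegral_fourierT_sq_le_of_lt_two (n : ℕ) {p : ℝ} (hp1 : 1 ≤ p) (hp2 : p < 2) :
    ∃ C : ℝ≥0, ∀ N : ℝ, 1 ≤ N → ∀ F f : Rn n → ℂ, DecayDominated F f →
    ∫⁻ ξ in closedBall 0 N, ‖fourierT F ξ‖ₑ ^ 2 ≤ C *
      (ENNReal.ofReal (N ^ (n * (2 / p - 1))) * (∫⁻ y, ‖f y‖ₑ ^ p ∂decayMeasure n) ^ (2 / p)) := by
  obtain ⟨C, hC⟩ := exists_lintegral_fourierT_sq_le n
  have hp0 : 0 < p := by linarith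
  set V : ℝ≥0 := (volume (ball (0 : Rn n) 1)).toNNReal with hV
  have hV' : volume (ball (0 : Rn n) 1) = V := (ENNReal.coe_toNNReal measure_ball_lt_top.ne).symm
  refine ⟨2 * (C + V) + 1, fun N hN F f h => ?_⟩
  have hN0 : 0 < N := by linarith
  set S := ∫⁻ y, ‖f y‖ₑ ^ p ∂decayMeasure n with hS
  rcases eq_or_ne S 0 with hS0 | hS0
  · have h1 : ∫⁻ y, ‖F y‖ₑ ≤ 0 := by
      refine h.lintegral_le.trans (le_of_eq ?_)
      rw [hS, lintegral_eq_zero_iff (h.measurable'.enorm.pow_const p)] at hS0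
      rw [lintegral_eq_zero_iff h.measurable'.enorm]
      filter_upwards [hS0] with y hy
      simpa [hp0, hp0.not_gt] using hy
    refine (lintegral_fourierT_sq_le hN0 F).trans ?_
    rw [le_zero_iff.1 h1]; simp
  rcases eq_or_ne S ∞ with hS1 | hS1
  · rw [hS1, ENNReal.top_rpow_of_pos (by positivity), ENNReal.mul_top, ENNReal.mul_top]
    · exact le_top
    · simp
    · simpa using Real.rpow_pos_of_pos hN0 _
  set a : ℝ≥0∞ := ENNReal.ofReal N with ha
  have ha0 : a ≠ 0 := by simpa [ha] using hN0
  have ha1 : a ≠ ∞ := ENNReal.ofReal_ne_top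
  have haN : ∀ t : ℝ, ENNReal.ofReal (N ^ t) = a ^ t := fun t =>
    (ENNReal.ofReal_rpow_of_pos hN0).symm
  set lam : ℝ≥0∞ := a ^ (n / p) * S ^ (1 / p) with hlam
  have hlam0 : lam ≠ 0 := by
    simp [hlam, ha0, ha1, hS0, hS1]
  have hlam1 : lam ≠ ∞ := ENNReal.mul_ne_top (ENNReal.rpow_ne_top_of_ne_zero ha0 ha1)
    (ENNReal.rpow_ne_top_of_ne_zero hS0 hS1)
  have hlamr : ∀ t : ℝ, lam ^ t = a ^ (n / p * t) * S ^ (1 / p * t) := by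
    intro t
    rw [hlam, ENNReal.mul_rpow_of_ne_zero (by simp [ha0, ha1]) (by simp [hS0, hS1]),
      ← ENNReal.rpow_mul, ← ENNReal.rpow_mul]
  set s : Set (Rn n) := {y | ‖f y‖ₑ ≤ lam} with hs
  have hsm : MeasurableSet s := measurableSet_le h.measurable'.enorm measurable_const
  have d1 := h.indicator hsm
  have d2 := h.indicator hsm.compl
  have b1 : ∫⁻ ξ in closedBall 0 N, ‖fourierT (s.indicator F) ξ‖ₑ ^ 2 ≤
      C * (lam ^ (2 - p) * S) := by
    refine (hC N hN0 _ d1.measurable d1.integrable).trans ?_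
    gcongr
    refine d1.lintegral_sq_le.trans ?_
    rw [hS, ← lintegral_const_mul _ (h.measurable'.enorm.pow_const p)]
    refine lintegral_mono fun y => ?_
    by_cases hy : y ∈ s
    · rw [Set.indicator_of_mem hy]
      calc ‖f y‖ₑ ^ 2 = ‖f y‖ₑ ^ (2 - p) * ‖f y‖ₑ ^ p := by
            rw [← ENNReal.rpow_add_of_nonneg _ _ (by linarith) hp0.le]; norm_num
        _ ≤ _ := by gcongr; exact hy
    · simp [hy]
  have b2 : ∫⁻ ξ in closedBall 0 N, ‖fourierT (sᶜ.indicator F) ξ‖ₑ ^ 2 ≤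
      V * (ENNReal.ofReal (N ^ n) * (lam ^ (1 - p) * S) ^ 2) := by
    refine (lintegral_fourierT_sq_le hN0 _).trans ?_
    rw [hV']
    gcongr
    refine d2.lintegral_le.trans ?_
    rw [hS, ← lintegral_const_mul _ (h.measurable'.enorm.pow_const p)]
    refine lintegral_mono fun y => ?_
    by_cases hy : y ∈ s
    · simp [hy]
    · have hy' : lam < ‖f y‖ₑ := not_le.1 hy
      have hf0 : ‖f y‖ₑ ≠ 0 := (pos_of_gt hy').ne'
      rw [Set.indicator_of_mem (show y ∈ sᶜ from hy)]
      calc ‖f y‖ₑ = ‖f y‖ₑ ^ (1 - p) * ‖f y‖ₑ ^ p := by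
            rw [← ENNReal.rpow_add _ _ hf0 (by simp)]; simp
        _ ≤ _ := by
            refine mul_le_mul_left ?_ _
            rw [← neg_sub p 1, ENNReal.rpow_neg, ENNReal.rpow_neg, ENNReal.inv_le_inv]
            exact ENNReal.rpow_le_rpow hy'.le (by linarith)
  have c1 : lam ^ (2 - p) * S = a ^ (n * (2 / p - 1)) * S ^ (2 / p) := by
    rw [hlamr, mul_assoc]
    nth_rewrite 2 [← ENNReal.rpow_one S]
    rw [← ENNReal.rpow_add _ _ hS0 hS1]
    congr 2 <;> field_simp
    ring
  have c2 : ENNReal.ofReal (N ^ n) * (lam ^ (1 - p) * S) ^ 2 =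
      a ^ (n * (2 / p - 1)) * S ^ (2 / p) := by
    rw [← Real.rpow_natCast N n, haN, hlamr, mul_assoc]
    nth_rewrite 2 [← ENNReal.rpow_one S]
    rw [← ENNReal.rpow_add _ _ hS0 hS1, ← ENNReal.rpow_natCast,
      ENNReal.mul_rpow_of_ne_zero (by simp [ha0, ha1]) (by simp [hS0, hS1]), ← ENNReal.rpow_mul,
      ← ENNReal.rpow_mul, ← mul_assoc, ← ENNReal.rpow_add _ _ ha0 ha1]
    congr 2 <;> push_cast <;> field_simp <;> ring
  rw [haN, ← c1]
  rw [c2, ← c1] at b2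
  have hsum : ∀ ξ, fourierT F ξ = fourierT (s.indicator F) ξ + fourierT (sᶜ.indicator F) ξ := by
    intro ξ
    rw [← fourierT_add d1.integrable d2.integrable]
    congr 1; funext y
    exact (congrFun (Set.indicator_self_add_compl s F) y).symm
  calc ∫⁻ ξ in closedBall 0 N, ‖fourierT F ξ‖ₑ ^ 2
      ≤ ∫⁻ ξ in closedBall 0 N, (2 * ‖fourierT (s.indicator F) ξ‖ₑ ^ 2 +
          2 * ‖fourierT (sᶜ.indicator F) ξ‖ₑ ^ 2) := by
        refine lintegral_mono fun ξ => ?_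
        rw [hsum]
        calc _ ≤ (‖fourierT (s.indicator F) ξ‖ₑ + ‖fourierT (sᶜ.indicator F) ξ‖ₑ) ^ 2 := by
              gcongr; exact enorm_add_le _ _
          _ ≤ _ := by
              rw [← mul_add]
              have := ENNReal.rpow_add_le_mul_rpow_add_rpow ‖fourierT (s.indicator F) ξ‖ₑ
                ‖fourierT (sᶜ.indicator F) ξ‖ₑ (p := 2) (by norm_num)
              norm_num at this
              exact this
    _ = 2 * (∫⁻ ξ in closedBall 0 N, ‖fourierT (s.indicator F) ξ‖ₑ ^ 2) +
          2 * ∫⁻ ξ in closedBall 0 N, ‖fourierT (sᶜ.indicator F) ξ‖ₑ ^ 2 := by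
        have m1 := (continuous_fourierT d1.integrable).measurable
        rw [lintegral_add_left (by fun_prop), lintegral_const_mul' _ _ (by norm_num),
          lintegral_const_mul' _ _ (by norm_num)]
    _ ≤ 2 * (C * (lam ^ (2 - p) * S)) + 2 * (V * (lam ^ (2 - p) * S)) := by gcongr
    _ ≤ (2 * (C + V)) * (lam ^ (2 - p) * S) + 1 * (lam ^ (2 - p) * S) := by
        refine le_trans (le_of_eq ?_) le_self_add
        ring
    _ = _ := by push_cast; ring

/-- Local Bernstein inequality. -/
theorem exists_lintegral_fourierT_sq_le_eLpNorm (n : ℕ) {p : ℝ≥0∞} (hp : 1 ≤ p) :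
    ∃ C : ℝ≥0, ∀ N : ℝ, 1 ≤ N → ∀ F f : Rn n → ℂ, DecayDominated F f →
    ∫⁻ ξ in closedBall 0 N, ‖fourierT F ξ‖ₑ ^ 2 ≤
      C * (ENNReal.ofReal (N ^ (n * max (2 * (p⁻¹).toReal - 1) 0)) *
        eLpNorm f p (decayMeasure n) ^ 2) := by
  rcases le_or_gt 2 p with h2 | h2
  · obtain ⟨C, hC⟩ := exists_lintegral_fourierT_sq_le_eLpNorm_of_two_le n h2
    refine ⟨C, fun N hN F f h => (hC N (by linarith) F f h).trans ?_⟩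
    gcongr
    refine le_mul_of_one_le_left zero_le ?_
    rw [ENNReal.one_le_ofReal]
    exact Real.one_le_rpow hN (by positivity)
  · have hpt : p ≠ ∞ := h2.ne_top
    have hp1 : 1 ≤ p.toReal := by
      simpa using ENNReal.toReal_mono hpt hp
    have hp2 : p.toReal < 2 := by
      simpa using (ENNReal.toReal_lt_toReal hpt (by norm_num)).2 h2
    obtain ⟨C, hC⟩ := exists_lintegral_fourierT_sq_le_of_lt_two n hp1 hp2
    refine ⟨C, fun N hN F f h => (hC N hN F f h).trans (le_of_eq ?_)⟩
    congr 2
    · rw [ENNReal.toReal_inv, max_eq_left, div_eq_mul_inv]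
      have : p.toReal⁻¹ * p.toReal = 1 := inv_mul_cancel₀ (by linarith)
      nlinarith [inv_pos.2 (show 0 < p.toReal by linarith)]
    · rw [eLpNorm_eq_lintegral_rpow_enorm_toReal (by positivity) hpt, ← ENNReal.rpow_natCast,
        ← ENNReal.rpow_mul]
      congr 1; push_cast; ring

end LocalLp

/-! ### Spatial localization -/

section Locality

variable {n : ℕ} {ι : Type*}

/-- The bilinear operator with symbol `c`, as an integral over the product space. -/
def bilinOp (c : Rn n × Rn n × Rn n → ℂ) (f g : Rn n → ℂ) (x : Rn n) : ℂ :=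
  ∫ z : Rn n × Rn n, c (x, z) * osc ⟪x, z.1 + z.2⟫ * (fourierT f z.1 * fourierT g z.2)

/-- A family of symbols bounded with all its derivatives for `|x| ≤ 2`, the `i`-th one being
supported in frequencies at most `N i`. -/
structure TameFamily (N : ι → ℝ) (c : ι → Rn n × Rn n × Rn n → ℂ) : Prop where
  smooth : ∀ i, Smooth (c i)
  bdd : ∀ k, BddDerivs (pureDirs n) (fun _ => {p | p.1 ∈ closedBall 0 2}) k c
  support : ∀ i p, p.2 ∉ closedBall (0 : Rn n × Rn n) (N i) → c i p = 0

lemma integrable_of_support {c : Rn n × Rn n × Rn n → ℂ} (hc : Continuous c) {N : ℝ}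
    (h0 : ∀ p, p.2 ∉ closedBall (0 : Rn n × Rn n) N → c p = 0) {f g : Rn n → ℂ}
    (hf : Integrable f) (hg : Integrable g) (x : Rn n) :
    Integrable fun z : Rn n × Rn n =>
      c (x, z) * osc ⟪x, z.1 + z.2⟫ * (fourierT f z.1 * fourierT g z.2) := by
  have c1 := continuous_fourierT hf
  have c2 := continuous_fourierT hg
  refine Continuous.integrable_of_hasCompactSupport (by fun_prop) ?_
  refine hasCompactSupport_of_closedBall (R := N) fun z hz => ?_
  rw [h0 (x, z) hz]; simp

lemma bilinOp_eq_integral {c : Rn n × Rn n × Rn n → ℂ} (hc : Continuous c) {N : ℝ}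
    (h0 : ∀ p, p.2 ∉ closedBall (0 : Rn n × Rn n) N → c p = 0) {f g : Rn n → ℂ}
    (hf : Integrable f) (hg : Integrable g) (x : Rn n) :
    bilinOp c f g x = ∫ ξ, osc ⟪x, ξ⟫ * fourierT f ξ *
      ∫ η, c (x, ξ, η) * osc ⟪x, η⟫ * fourierT g η := by
  rw [bilinOp, Measure.volume_eq_prod, integral_prod _ (integrable_of_support hc h0 hf hg x)]
  congr 1; funext ξ
  rw [← integral_const_mul]
  congr 1; funext η
  rw [inner_add_right, osc_add]; ring

lemma integral_mul_fourierT {u g : Rn n → ℂ} (hu : Continuous u) (hc : HasCompactSupport u)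
    (hg : Integrable g) (x : Rn n) :
    ∫ η, u η * osc ⟪x, η⟫ * fourierT g η = ∫ y, g y * ∫ η, u η * osc ⟪η, x - y⟫ := by
  have h1 : Integrable (fun p : Rn n × Rn n => u p.1 * g p.2) :=
    (hu.integrable_of_hasCompactSupport hc).mul_prod hg
  have h2 : Integrable (fun p : Rn n × Rn n => osc ⟪p.1, x - p.2⟫ * (u p.1 * g p.2))
      (volume.prod volume) :=
    h1.bdd_mul (c := 1) (by fun_prop) (Filter.Eventually.of_forall fun p => by simp)
  have h3 := integral_integral_swap (f := fun η y => osc ⟪η, x - y⟫ * (u η * g y)) h2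
  calc _ = ∫ η, ∫ y, osc ⟪η, x - y⟫ * (u η * g y) := by
        congr 1; funext η
        rw [fourierT_eq, ← integral_const_mul]
        congr 1; funext y
        rw [inner_sub_right, sub_eq_add_neg, osc_add, real_inner_comm x η]; ring
    _ = _ := by
        rw [h3]
        congr 1; funext y
        rw [← integral_const_mul]
        congr 1; funext η; ring

lemma integral_mul_fourierT_weight {u G : Rn n → ℂ} (hu : Smooth u) (hc : HasCompactSupport u)
    (hG : Integrable G) (v : Rn n) (hg : Integrable fun y => (1 + Complex.I * (⟪v, y⟫ : ℝ)) * G y)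
    (x : Rn n) :
    ∫ η, u η * osc ⟪x, η⟫ * fourierT (fun y => (1 + Complex.I * (⟪v, y⟫ : ℝ)) * G y) η =
      ∫ η, ((1 + Complex.I * (⟪v, x⟫ : ℝ)) * u η + dirDeriv v u η) * osc ⟪x, η⟫ *
        fourierT G η := by
  have hu' := hu.continuous
  have hd := (hu.dirDeriv v).continuous
  have hcd : HasCompactSupport (dirDeriv v u) := hc.fderiv_apply ℝ v
  have hcs : HasCompactSupport fun η => (1 + Complex.I * (⟪v, x⟫ : ℝ)) * u η + dirDeriv v u η :=
    (hc.mul_left (f := fun _ => 1 + Complex.I * ((⟪v, x⟫ : ℝ) : ℂ))).add hcd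
  rw [integral_mul_fourierT hu' hc hg, integral_mul_fourierT (by fun_prop) hcs hG]
  congr 1; funext y
  have i1 : Integrable fun η => u η * osc ⟪η, x - y⟫ :=
    (Continuous.mul hu' (by fun_prop)).integrable_of_hasCompactSupport hc.mul_right
  have i2 : Integrable fun η => dirDeriv v u η * osc ⟪η, x - y⟫ :=
    (Continuous.mul hd (by fun_prop)).integrable_of_hasCompactSupport hcd.mul_right
  have e : ∫ η, ((1 + Complex.I * (⟪v, x⟫ : ℝ)) * u η + dirDeriv v u η) * osc ⟪η, x - y⟫ =
      (1 + Complex.I * (⟪v, x⟫ : ℝ)) * (∫ η, u η * osc ⟪η, x - y⟫) +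
        ∫ η, dirDeriv v u η * osc ⟪η, x - y⟫ := by
    rw [← integral_const_mul, ← integral_add (i1.const_mul _) i2]
    congr 1; funext η; ring
  rw [e, integral_dirDeriv_mul_osc hu hc, inner_sub_right]
  push_cast; ring

/-- The action on symbols of dividing the second function by `1 + i ⟨y, v⟩`. -/
def opEta (v : Rn n) (c : Rn n × Rn n × Rn n → ℂ) : Rn n × Rn n × Rn n → ℂ :=
  fun p => (1 + Complex.I * (⟪v, p.1⟫ : ℝ)) * c p + dirDeriv (inEta n v) c p

lemma smooth_one_add_inner (v : Rn n) :
    Smooth fun p : Rn n × Rn n × Rn n => 1 + Complex.I * ((⟪v, p.1⟫ : ℝ) : ℂ) := by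
  have h : ContDiff ℝ (⊤ : ℕ∞) fun p : Rn n × Rn n × Rn n => (⟪v, p.1⟫ : ℝ) :=
    contDiff_const.inner ℝ contDiff_fst
  exact contDiff_const.add (contDiff_const.mul (Complex.ofRealCLM.contDiff.comp h))

lemma TameFamily.opEta {N : ι → ℝ} {c : ι → Rn n × Rn n × Rn n → ℂ} (h : TameFamily N c)
    (v : Rn n) : TameFamily N (fun i => opEta v (c i)) where
  smooth i := ((smooth_one_add_inner v).mul (h.smooth i)).add ((h.smooth i).dirDeriv _)
  bdd k := by
    have hm : inEta n v ∈ pureDirs n := Or.inr ⟨v, rfl⟩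
    refine BddDerivs.add (fun i => (smooth_one_add_inner v).mul (h.smooth i))
      (fun i => (h.smooth i).dirDeriv _) ?_ ((h.bdd (k + 1)).2 _ hm)
    refine BddDerivs.mul (fun _ => smooth_one_add_inner v) h.smooth ?_ (h.bdd k)
    let L : Rn n × Rn n × Rn n →L[ℝ] ℂ := Complex.I • (Complex.ofRealCLM.comp
      ((innerSL ℝ v).comp (ContinuousLinearMap.fst ℝ (Rn n) (Rn n × Rn n))))
    have hL : ∀ p, L p = Complex.I * (⟪v, p.1⟫ : ℝ) := fun p => rfl
    have h2 := BddDerivs.add (V := pureDirs n) (k := k) (ι := ι)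
      (Ω := fun _ => {p : Rn n × Rn n × Rn n | p.1 ∈ closedBall 0 2})
      (fun _ => contDiff_const) (fun _ => L.contDiff) (BddDerivs.const 1)
      (BddDerivs.linear L ⟨‖v‖ * 2, fun i p hp => ?_⟩)
    · simpa only [hL] using h2
    · rw [hL, norm_mul, Complex.norm_I, one_mul, Complex.norm_real]
      refine (norm_inner_le_norm _ _).trans ?_
      have : ‖p.1‖ ≤ 2 := by simpa using hp
      gcongr
  support i p hp := by
    have hs : IsOpen {p : Rn n × Rn n × Rn n | p.2 ∉ closedBall (0 : Rn n × Rn n) (N i)} :=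
      isClosed_closedBall.isOpen_compl.preimage continuous_snd
    have := dirDeriv_eq_zero_of_eqOn hs (fun q hq => h.support i q hq) (inEta n v) p hp
    rw [_root_.opEta, this, h.support i p hp]; simp

lemma bilinOp_opEta {N : ι → ℝ} {c : ι → Rn n × Rn n × Rn n → ℂ} (h : TameFamily N c) (i : ι)
    (v : Rn n) {f G : Rn n → ℂ} (hf : Integrable f) (hG : Integrable G)
    (hg : Integrable fun y => (1 + Complex.I * (⟪v, y⟫ : ℝ)) * G y) (x : Rn n) :
    bilinOp (c i) f (fun y => (1 + Complex.I * (⟪v, y⟫ : ℝ)) * G y) x =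
      bilinOp (opEta v (c i)) f G x := by
  have h' := h.opEta v
  rw [bilinOp_eq_integral (h.smooth i).continuous (h.support i) hf hg,
    bilinOp_eq_integral (h'.smooth i).continuous (h'.support i) hf hG]
  congr 1; funext ξ
  congr 1
  have e : (fun η => c i (x, ξ, η)) = fun η => c i ((x, ξ, 0) + inEta n η) := by
    funext η; simp
  have hu : Smooth fun η => c i (x, ξ, η) := by
    rw [e]
    exact (h.smooth i).comp (contDiff_const.add (inEta n).contDiff)
  have hc : HasCompactSupport fun η => c i (x, ξ, η) := by
    refine hasCompactSupport_of_closedBall (R := N i) fun η hη => h.support i _ fun hη' => hη ?_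
    simp only [mem_closedBall, dist_zero_right, Prod.norm_def, max_le_iff] at hη' ⊢
    exact hη'.2
  rw [integral_mul_fourierT_weight hu hc hG v hg]
  congr 1; funext η
  congr 2
  simp only [opEta]
  congr 1
  rw [e, dirDeriv_comp_affine _ _ (h.smooth i)]
  simp

/-- Iterated application of `opEta`. -/
def opEtas (l : List (Rn n)) (c : Rn n × Rn n × Rn n → ℂ) : Rn n × Rn n × Rn n → ℂ :=
  l.foldr opEta c

lemma TameFamily.opEtas {N : ι → ℝ} {c : ι → Rn n × Rn n × Rn n → ℂ} (h : TameFamily N c)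
    (l : List (Rn n)) : TameFamily N (fun i => opEtas l (c i)) := by
  induction l with
  | nil => exact h
  | cons v l ih => exact ih.opEta v

lemma norm_inv_listWeight_le_one (l : List (Rn n)) (y : Rn n) : ‖(listWeight l y)⁻¹‖ ≤ 1 := by
  induction l with
  | nil => simp [listWeight]
  | cons v l ih =>
    rw [listWeight_cons, mul_inv, norm_mul]
    refine mul_le_one₀ ?_ (norm_nonneg _) ih
    rw [norm_inv]
    refine inv_le_one_of_one_le₀ ?_
    have := normSq_one_add_I_mul ⟪v, y⟫
    nlinarith [sq_nonneg (⟪v, y⟫ : ℝ), norm_nonneg (1 + Complex.I * ((⟪v, y⟫ : ℝ) : ℂ))]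

lemma integrable_inv_listWeight_mul (l : List (Rn n)) {g : Rn n → ℂ} (hg : Integrable g) :
    Integrable fun y => (listWeight l y)⁻¹ * g y :=
  hg.bdd_mul (c := 1)
    ((continuous_listWeight l).inv₀ (listWeight_ne_zero l)).aestronglyMeasurable
    (Filter.Eventually.of_forall (norm_inv_listWeight_le_one l))

lemma bilinOp_opEtas {N : ι → ℝ} {c : ι → Rn n × Rn n × Rn n → ℂ} (h : TameFamily N c) (i : ι)
    (l : List (Rn n)) {f g : Rn n → ℂ} (hf : Integrable f) (hg : Integrable g) (x : Rn n) :
    bilinOp (c i) f g x = bilinOp (opEtas l (c i)) f (fun y => (listWeight l y)⁻¹ * g y) x := by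
  induction l with
  | nil => simp [opEtas, listWeight]
  | cons v l ih =>
    have e : (fun y => (listWeight l y)⁻¹ * g y) = fun y => (1 + Complex.I * (⟪v, y⟫ : ℝ)) *
        ((listWeight (v :: l) y)⁻¹ * g y) := by
      funext y
      rw [listWeight_cons, mul_inv, ← mul_assoc, ← mul_assoc,
        mul_inv_cancel₀ (one_add_I_mul_ne_zero _), one_mul]
    rw [ih, e]
    exact bilinOp_opEta (h.opEtas l) i v hf (integrable_inv_listWeight_mul _ hg)
      (e ▸ integrable_inv_listWeight_mul l hg) x

/-- Exchange of the two frequency variables. -/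
def swapFreq (n : ℕ) : Rn n × Rn n × Rn n →L[ℝ] Rn n × Rn n × Rn n :=
  (ContinuousLinearMap.fst ℝ _ _).prod
    (((ContinuousLinearMap.snd ℝ _ _).comp (ContinuousLinearMap.snd ℝ _ _)).prod
      ((ContinuousLinearMap.fst ℝ _ _).comp (ContinuousLinearMap.snd ℝ _ _)))

@[simp] lemma swapFreq_apply (p : Rn n × Rn n × Rn n) :
    swapFreq n p = (p.1, p.2.2, p.2.1) := rfl

lemma TameFamily.swap {N : ι → ℝ} {c : ι → Rn n × Rn n × Rn n → ℂ} (h : TameFamily N c) :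
    TameFamily N (fun i p => c i (swapFreq n p)) where
  smooth i := (h.smooth i).comp (swapFreq n).contDiff
  bdd k := by
    have h1 := (h.bdd k).comp_affine (W := pureDirs n) (swapFreq n) ?_ h.smooth (fun _ => 0) id
    · simpa using h1
    · rintro v ((⟨v, rfl⟩ | ⟨v, rfl⟩) | ⟨v, rfl⟩)
      · exact Or.inl (Or.inl ⟨v, rfl⟩)
      · exact Or.inr ⟨v, rfl⟩
      · exact Or.inl (Or.inr ⟨v, rfl⟩)
  support i p hp := h.support i _ (by
    simpa [Prod.norm_def, and_comm, max_comm] using hp)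

lemma bilinOp_swap (c : Rn n × Rn n × Rn n → ℂ) (f g : Rn n → ℂ) (x : Rn n) :
    bilinOp (fun p => c (swapFreq n p)) g f x = bilinOp c f g x := by
  unfold bilinOp
  rw [Measure.volume_eq_prod, ← integral_prod_swap]
  congr 1; funext z
  simp only [swapFreq_apply, Prod.fst_swap, Prod.snd_swap, add_comm z.2]
  ring

/-- The input functions may be replaced by rapidly decaying multiples of themselves. -/
theorem TameFamily.exists_localized {N : ι → ℝ} {c : ι → Rn n × Rn n × Rn n → ℂ}
    (h : TameFamily N c) (l : List (Rn n)) : ∃ c' : ι → Rn n × Rn n × Rn n → ℂ,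
      TameFamily N c' ∧ ∀ i (f g : Rn n → ℂ), Integrable f → Integrable g → ∀ x,
        bilinOp (c i) f g x = bilinOp (c' i) (fun y => (listWeight l y)⁻¹ * f y)
          (fun y => (listWeight l y)⁻¹ * g y) x := by
  have h1 := h.opEtas l
  have h2 := h1.swap
  have h3 := h2.opEtas l
  refine ⟨_, h3.swap, fun i f g hf hg x => ?_⟩
  have hg' := integrable_inv_listWeight_mul l hg
  rw [bilinOp_opEtas h i l hf hg, ← bilinOp_swap, bilinOp_opEtas h2 i l hg' hf, ← bilinOp_swap]

end Locality

/-! ### Local bounds for tame families -/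

section LocalBound

variable {n : ℕ} {ι : Type*}

/-- A smooth function on `ℝⁿ` supported in the ball of radius `2`, equal to one on the unit ball. -/
def ballBump (n : ℕ) : ContDiffBump (0 : Rn n) := ⟨1, 2, one_pos, one_lt_two⟩

lemma ballBump_eq_zero {x : Rn n} (hx : x ∉ closedBall (0 : Rn n) 2) : ballBump n x = 0 := by
  refine (ballBump n).zero_of_le_dist ?_
  exact (not_le.1 hx).le

lemma smooth_ballBump : Smooth fun x : Rn n => ((ballBump n x : ℝ) : ℂ) :=
  Complex.ofRealCLM.contDiff.comp (ballBump n).contDiff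

lemma slice_eq (c : Rn n × Rn n × Rn n → ℂ) (z : Rn n × Rn n) :
    (fun x => c (x, z)) = fun x => c ((0, z) + inX n x) := by
  funext x; rw [inX_apply]; simp only [Prod.mk_add_mk, zero_add, ← Prod.zero_eq_mk, add_zero]

lemma TameFamily.smooth_slice {N : ι → ℝ} {c : ι → Rn n × Rn n × Rn n → ℂ} (h : TameFamily N c)
    (i : ι) (z : Rn n × Rn n) : Smooth fun x => c i (x, z) := by
  rw [slice_eq]
  exact (h.smooth i).comp (contDiff_const.add (inX n).contDiff)

lemma TameFamily.bddDerivs_slice {N : ι → ℝ} {c : ι → Rn n × Rn n × Rn n → ℂ}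
    (h : TameFamily N c) (k : ℕ) : BddDerivs Set.univ (fun _ => closedBall (0 : Rn n) 2) k
      (fun (w : ι × Rn n × Rn n) x => c w.1 (x, w.2)) := by
  have h1 := (h.bdd k).comp_affine (W := Set.univ) (inX n)
    (fun w _ => Or.inl (Or.inl ⟨w, rfl⟩)) h.smooth
    (fun w : ι × Rn n × Rn n => ((0, w.2) : Rn n × Rn n × Rn n)) Prod.fst
  have e : ∀ (w : ι × Rn n × Rn n) (x : Rn n),
      (((0, w.2) : Rn n × Rn n × Rn n) + inX n x) = (x, w.2) := by
    intro w x
    rw [inX_apply]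
    simp only [Prod.mk_add_mk, zero_add, ← Prod.zero_eq_mk, add_zero]
  simp only [e] at h1
  exact h1

/-- The kernel of the `TT*` operator decays. -/
lemma TameFamily.exists_kernel_le {N : ι → ℝ} {c : ι → Rn n × Rn n × Rn n → ℂ}
    (h : TameFamily N c) : ∃ C : ℝ, 0 ≤ C ∧ ∀ i (z z' : Rn n × Rn n),
      ‖∫ x, ((ballBump n x : ℝ) : ℂ) * ((c i (x, z) * osc ⟪x, z.1 + z.2⟫) *
        (starRingEnd ℂ) (c i (x, z') * osc ⟪x, z'.1 + z'.2⟫))‖ ≤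
      C * decay ((z.1 + z.2) - (z'.1 + z'.2)) := by
  let u : ι × (Rn n × Rn n) × (Rn n × Rn n) → Rn n → ℂ := fun w x =>
    ((ballBump n x : ℝ) : ℂ) * (c w.1 (x, w.2.1) * (starRingEnd ℂ) (c w.1 (x, w.2.2)))
  have s1 : ∀ w : ι × (Rn n × Rn n) × (Rn n × Rn n), Smooth fun x => c w.1 (x, w.2.1) :=
    fun w => h.smooth_slice _ _
  have s2 : ∀ w : ι × (Rn n × Rn n) × (Rn n × Rn n), Smooth fun x => c w.1 (x, w.2.2) :=
    fun w => h.smooth_slice _ _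
  have s3 : ∀ w : ι × (Rn n × Rn n) × (Rn n × Rn n),
      Smooth fun x => (starRingEnd ℂ) (c w.1 (x, w.2.2)) :=
    fun w => Complex.conjCLE.contDiff.comp (s2 w)
  have s4 : ∀ w : ι × (Rn n × Rn n) × (Rn n × Rn n),
      Smooth fun x => c w.1 (x, w.2.1) * (starRingEnd ℂ) (c w.1 (x, w.2.2)) :=
    fun w => (s1 w).mul (s3 w)
  obtain ⟨C, hC0, hC⟩ := exists_norm_integral_osc_le (u := u) (R := 2)
    (fun w => smooth_ballBump.mul (s4 w))
    (fun w x hx => by simp [u, ballBump_eq_zero hx]) (fun k => by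
      refine BddDerivs.mul (fun _ => smooth_ballBump) s4
        ((BddDerivs.of_compact smooth_ballBump (isCompact_closedBall 0 2)
          (fun x hx => by simp [ballBump_eq_zero hx]) k).mono_set fun _ => Set.subset_univ _) ?_
      refine BddDerivs.mul s1 s3 ?_ (BddDerivs.star s2 ?_)
      · exact (h.bddDerivs_slice k).reindex
          fun w : ι × (Rn n × Rn n) × (Rn n × Rn n) => (w.1, w.2.1)
      · exact (h.bddDerivs_slice k).reindex
          fun w : ι × (Rn n × Rn n) × (Rn n × Rn n) => (w.1, w.2.2))
  refine ⟨C, hC0, fun i z z' => ?_⟩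
  refine le_trans (le_of_eq ?_) (hC (i, z, z') ((z.1 + z.2) - (z'.1 + z'.2)))
  congr 1
  congr 1; funext x
  simp only [u, map_mul, conj_osc]
  rw [inner_sub_right, sub_eq_add_neg, osc_add]
  ring

lemma closedBall_prod_eq (N : ℝ) : closedBall (0 : Rn n × Rn n) N =
    closedBall (0 : Rn n) N ×ˢ closedBall (0 : Rn n) N :=
  (closedBall_prod_same (0 : Rn n) (0 : Rn n) N).symm

/-- The integral of `|f̂|²` over a ball. -/
def freqEnergy (N : ℝ) (f : Rn n → ℂ) : ℝ≥0∞ := ∫⁻ ξ in closedBall 0 N, ‖fourierT f ξ‖ₑ ^ 2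

lemma lintegral_ball_mul (N : ℝ) {f g : Rn n → ℂ} (hf : Integrable f) (hg : Integrable g) :
    ∫⁻ z in closedBall (0 : Rn n × Rn n) N, ‖fourierT f z.1 * fourierT g z.2‖ₑ ^ 2 =
      freqEnergy N f * freqEnergy N g := by
  have c1 := (continuous_fourierT hf).measurable
  have c2 := (continuous_fourierT hg).measurable
  rw [closedBall_prod_eq, Measure.volume_eq_prod, ← Measure.prod_restrict, freqEnergy, freqEnergy,
    ← lintegral_prod_mul (by fun_prop) (by fun_prop)]
  refine lintegral_congr fun z => ?_
  rw [enorm_mul, mul_pow]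

lemma lintegral_ball_decay_le (N : ℝ) (w : Rn n) :
    ∫⁻ z in closedBall (0 : Rn n × Rn n) N, ENNReal.ofReal (decay (w - (z.1 + z.2))) ≤
      volume (closedBall (0 : Rn n) N) * ∫⁻ y : Rn n, ENNReal.ofReal (decay y) := by
  have hm : Measurable fun z : Rn n × Rn n => ENNReal.ofReal (decay (w - (z.1 + z.2))) := by
    have : Continuous fun z : Rn n × Rn n => decay (w - (z.1 + z.2)) := by fun_prop
    exact this.measurable.ennreal_ofReal
  rw [closedBall_prod_eq, Measure.volume_eq_prod, ← Measure.prod_restrict,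
    lintegral_prod _ hm.aemeasurable, mul_comm, ← setLIntegral_const]
  refine lintegral_mono fun ξ => (setLIntegral_le_lintegral _ _).trans (le_of_eq ?_)
  have := lintegral_sub_left_eq_self (μ := (volume : Measure (Rn n)))
    (fun y : Rn n => ENNReal.ofReal (decay y)) (w - ξ)
  rw [← this]
  refine lintegral_congr fun η => ?_
  simp only [sub_sub]

/-- Local `L²` bound. -/
theorem TameFamily.exists_lintegral_bilinOp_sq_le {N : ι → ℝ} (hN : ∀ i, 1 ≤ N i)
    {c : ι → Rn n × Rn n × Rn n → ℂ} (h : TameFamily N c) : ∃ C : ℝ≥0, ∀ i (f g : Rn n → ℂ),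
      Integrable f → Integrable g →
      ∫⁻ x in closedBall 0 1, ‖bilinOp (c i) f g x‖ₑ ^ 2 ≤
        C * ENNReal.ofReal (N i ^ n) * (freqEnergy (N i) f * freqEnergy (N i) g) := by
  obtain ⟨C, hC0, hC⟩ := h.exists_kernel_le
  have hD : ∫⁻ y : Rn n, ENNReal.ofReal (decay y) ≠ ∞ :=
    (integrable_decay (n := n)).lintegral_lt_top.ne
  have hV : volume (ball (0 : Rn n) 1) ≠ ∞ := measure_ball_lt_top.ne
  refine ⟨2 * (C.toNNReal * ((volume (ball (0 : Rn n) 1)).toNNReal *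
    (∫⁻ y : Rn n, ENNReal.ofReal (decay y)).toNNReal)), fun i f g hf hg => ?_⟩
  set S : Set (Rn n × Rn n) := closedBall 0 (N i) with hS
  have hSm : MeasurableSet S := measurableSet_closedBall
  have cf := continuous_fourierT hf
  have cg := continuous_fourierT hg
  have cc := (h.smooth i).continuous
  let H : Rn n × Rn n → ℂ := S.indicator fun z => fourierT f z.1 * fourierT g z.2
  let Θ : Rn n → Rn n × Rn n → ℂ := fun x z => c i (x, z) * osc ⟪x, z.1 + z.2⟫
  let D : (Rn n × Rn n) × (Rn n × Rn n) → ℝ := fun z =>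
    C * decay ((z.1.1 + z.1.2) - (z.2.1 + z.2.2))
  have hDc : Continuous D := by fun_prop
  let k : Rn n × Rn n → Rn n × Rn n → ℝ := fun z z' => (S ×ˢ S).indicator D (z, z')
  have hΘ : ∀ x, ∀ z ∉ S, Θ x z = 0 := fun x z hz => by simp [Θ, h.support i (x, z) hz]
  have e1 : ∀ x z, Θ x z * H z = Θ x z * (fourierT f z.1 * fourierT g z.2) := by
    intro x z
    by_cases hz : z ∈ S
    · simp [H, hz]
    · simp [hΘ x z hz]
  have hop : ∀ x, bilinOp (c i) f g x = ∫ z, Θ x z * H z := fun x => by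
    simp only [e1]; rfl
  have key := lintegral_sq_le_of_kernel_of_schur (μ := (volume : Measure (Rn n)))
    (ν := (volume : Measure (Rn n × Rn n))) (Θ := Θ) (h := H) (κ := fun x => ballBump n x)
    (k := k) (M := ENNReal.ofReal C * (volume (closedBall (0 : Rn n) (N i)) *
      ∫⁻ y : Rn n, ENNReal.ofReal (decay y))) (fun x => (ballBump n).nonneg) ?_ ?_ ?_ ?_ ?_ ?_
  · calc ∫⁻ x in closedBall 0 1, ‖bilinOp (c i) f g x‖ₑ ^ 2
        ≤ ∫⁻ x in closedBall 0 1, ENNReal.ofReal (ballBump n x) * ‖∫ z, Θ x z * H z‖ₑ ^ 2 := by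
          refine setLIntegral_mono' measurableSet_closedBall fun x hx => ?_
          rw [(ballBump n).one_of_mem_closedBall hx, hop]
          simp
      _ ≤ _ := setLIntegral_le_lintegral _ _
      _ ≤ _ := key
      _ = _ := by
          have e2 : ∫⁻ z, ‖H z‖ₑ ^ 2 = freqEnergy (N i) f * freqEnergy (N i) g := by
            rw [← lintegral_ball_mul _ hf hg, ← lintegral_indicator hSm]
            refine lintegral_congr fun z => ?_
            by_cases hz : z ∈ S <;> simp [H, hz]
          rw [e2, volume_closedBall_eq (by linarith [hN i])]
          push_cast
          rw [ENNReal.coe_toNNReal hD, ENNReal.coe_toNNReal hV, ← ENNReal.ofReal]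
          ring
  · have : (fun p : Rn n × (Rn n × Rn n) × (Rn n × Rn n) => ((ballBump n p.1 : ℝ) : ℂ) *
        ((Θ p.1 p.2.1 * H p.2.1) * (starRingEnd ℂ) (Θ p.1 p.2.2 * H p.2.2))) =
        fun p => ((ballBump n p.1 : ℝ) : ℂ) *
        ((Θ p.1 p.2.1 * (fourierT f p.2.1.1 * fourierT g p.2.1.2)) *
          (starRingEnd ℂ) (Θ p.1 p.2.2 * (fourierT f p.2.2.1 * fourierT g p.2.2.2))) := by
      funext p; rw [e1, e1]
    rw [this]
    have cb : Continuous fun x : Rn n => ((ballBump n x : ℝ) : ℂ) := smooth_ballBump.continuous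
    have cconj : Continuous (starRingEnd ℂ) := Complex.continuous_conj
    refine Continuous.integrable_of_hasCompactSupport ?_ ?_
    · simp only [Θ]
      exact (cb.comp continuous_fst).mul (by fun_prop)
    · refine hasCompactSupport_of_closedBall (R := max 2 (N i)) fun p hp => ?_
      simp only [mem_closedBall, dist_zero_right] at hp
      rw [Prod.norm_def, Prod.norm_def] at hp
      by_cases h1 : p.1 ∈ closedBall (0 : Rn n) 2
      · by_cases h2 : p.2.1 ∈ S
        · by_cases h3 : p.2.2 ∈ S
          · refine absurd ?_ hp
            simp only [hS, mem_closedBall, dist_zero_right] at h1 h2 h3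
            exact max_le (h1.trans (le_max_left _ _)) (max_le (h2.trans (le_max_right _ _))
              (h3.trans (le_max_right _ _)))
          · simp [hΘ _ _ h3]
        · simp [hΘ _ _ h2]
      · simp [ballBump_eq_zero h1]
  · intro z z'
    by_cases hz : z ∈ S
    · by_cases hz' : z' ∈ S
      · have : k z z' = D (z, z') := Set.indicator_of_mem (Set.mk_mem_prod hz hz') D
        rw [this]
        exact hC i z z'
      · simp [k, hz', hΘ _ _ hz']
    · simp [k, hz, hΘ _ _ hz]
  · exact hDc.measurable.indicator (hSm.prod hSm)
  · intro z z'
    have hD : D (z, z') = D (z', z) := by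
      simp only [D]
      rw [← decay_neg, neg_sub]
    by_cases hz : z ∈ S <;> by_cases hz' : z' ∈ S <;> simp [k, hz, hz', hD]
  · exact (cf.fst'.mul cg.snd').measurable.indicator hSm
  · intro z
    calc ∫⁻ z', ENNReal.ofReal (k z z')
        ≤ ∫⁻ z', S.indicator (fun z' => ENNReal.ofReal C *
            ENNReal.ofReal (decay ((z.1 + z.2) - (z'.1 + z'.2)))) z' := by
          refine lintegral_mono fun z' => ?_
          by_cases hz' : z' ∈ S
          · by_cases hz : z ∈ S
            · simp [k, hz, hz', D, ENNReal.ofReal_mul hC0]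
            · simp [k, hz]
          · simp [k, hz']
      _ ≤ _ := by
          rw [lintegral_indicator hSm, lintegral_const_mul' _ _ ENNReal.ofReal_ne_top]
          gcongr
          exact lintegral_ball_decay_le _ _

/-- Local `L^∞` bound. -/
theorem TameFamily.exists_enorm_bilinOp_sq_le {N : ι → ℝ} (hN : ∀ i, 1 ≤ N i)
    {c : ι → Rn n × Rn n × Rn n → ℂ} (h : TameFamily N c) : ∃ C : ℝ≥0, ∀ i (f g : Rn n → ℂ),
      Integrable f → Integrable g → ∀ x ∈ closedBall (0 : Rn n) 1,
      ‖bilinOp (c i) f g x‖ₑ ^ 2 ≤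
        C * ENNReal.ofReal (N i ^ n) ^ 2 * (freqEnergy (N i) f * freqEnergy (N i) g) := by
  obtain ⟨C, hC0, hC⟩ := (h.bdd 0).bound
  have hV : volume (ball (0 : Rn n) 1) ≠ ∞ := measure_ball_lt_top.ne
  refine ⟨(C.toNNReal * (volume (ball (0 : Rn n) 1)).toNNReal) ^ 2, fun i f g hf hg x hx => ?_⟩
  set S : Set (Rn n × Rn n) := closedBall 0 (N i) with hS
  have hSm : MeasurableSet S := measurableSet_closedBall
  have cf := continuous_fourierT hf
  have cg := continuous_fourierT hg
  let K : Rn n × Rn n → ℝ≥0∞ := fun z => ‖fourierT f z.1 * fourierT g z.2‖ₑ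
  have hK : Measurable K := (cf.fst'.mul cg.snd').measurable.enorm
  have h1 : ‖bilinOp (c i) f g x‖ₑ ≤ ENNReal.ofReal C * ∫⁻ z in S, K z := by
    refine (enorm_integral_le_lintegral_enorm _).trans ?_
    rw [← lintegral_const_mul' _ _ ENNReal.ofReal_ne_top, ← lintegral_indicator hSm]
    refine lintegral_mono fun z => ?_
    by_cases hz : z ∈ S
    · simp only [hz, Set.indicator_of_mem]
      rw [enorm_mul, enorm_mul]
      gcongr
      have h2 : ‖osc ⟪x, z.1 + z.2⟫‖ₑ = 1 := by rw [← ofReal_norm]; simp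
      rw [h2, mul_one, ← ofReal_norm]
      refine ENNReal.ofReal_le_ofReal (hC i _ ?_)
      exact closedBall_subset_closedBall one_le_two hx
    · simp [h.support i (x, z) hz]
  have h2 : (∫⁻ z in S, K z) ^ 2 ≤ volume S * ∫⁻ z in S, K z ^ 2 := by
    have := ENNReal.lintegral_mul_le_Lp_mul_Lq (volume.restrict S)
      (Real.HolderConjugate.two_two) (f := fun _ => 1) (g := K) aemeasurable_const hK.aemeasurable
    simp only [Pi.mul_apply, one_mul, ENNReal.one_rpow, lintegral_const,
      Measure.restrict_apply_univ] at this
    calc (∫⁻ z in S, K z) ^ 2 ≤ (volume S ^ (1 / 2 : ℝ) *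
          (∫⁻ z in S, K z ^ (2 : ℝ)) ^ (1 / 2 : ℝ)) ^ 2 := by gcongr
      _ = _ := by
        rw [mul_pow, ← ENNReal.rpow_natCast, ← ENNReal.rpow_natCast, ← ENNReal.rpow_mul,
          ← ENNReal.rpow_mul]
        norm_num
  have h3 : volume S = volume (closedBall (0 : Rn n) (N i)) ^ 2 := by
    rw [hS, closedBall_prod_eq, Measure.volume_eq_prod, Measure.prod_prod, sq]
  calc ‖bilinOp (c i) f g x‖ₑ ^ 2 ≤ (ENNReal.ofReal C * ∫⁻ z in S, K z) ^ 2 := by gcongr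
    _ = ENNReal.ofReal C ^ 2 * (∫⁻ z in S, K z) ^ 2 := mul_pow _ _ _
    _ ≤ ENNReal.ofReal C ^ 2 * (volume S * ∫⁻ z in S, K z ^ 2) := by gcongr
    _ = _ := by
      rw [h3, lintegral_ball_mul _ hf hg, volume_closedBall_eq (by linarith [hN i])]
      push_cast
      rw [ENNReal.coe_toNNReal hV, ← ENNReal.ofReal]
      ring

end LocalBound

/-! ### Local `L^r` bounds -/

section LocalLr

variable {n : ℕ} {ι : Type*}

/-- The exponent of the loss in the bilinear estimate. -/
def lossExp (p q r : ℝ≥0∞) : ℝ :=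
  max (max (1 / 2) (2 * (p⁻¹).toReal - 1 / 2))
    (max (2 * (q⁻¹).toReal - 1 / 2) (3 / 2 - 2 * (r⁻¹).toReal))

lemma toReal_inv_le_one {p : ℝ≥0∞} (hp : 1 ≤ p) : (p⁻¹).toReal ≤ 1 :=
  ENNReal.toReal_le_of_le_ofReal zero_le_one (by simpa using hp)

lemma toReal_inv_eq_add {p q r : ℝ≥0∞} (hp : 1 ≤ p) (hq : 1 ≤ q) (hpqr : 1 / r = 1 / q + 1 / p) :
    (r⁻¹).toReal = (q⁻¹).toReal + (p⁻¹).toReal := by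
  simp only [one_div] at hpqr
  rw [hpqr, ENNReal.toReal_add]
  · exact ENNReal.inv_ne_top.2 (by positivity)
  · exact ENNReal.inv_ne_top.2 (by positivity)

lemma toReal_inv_le_half {r : ℝ≥0∞} (hr : 2 ≤ r) : (r⁻¹).toReal ≤ 1 / 2 := by
  have : (r⁻¹).toReal ≤ ((2 : ℝ≥0∞)⁻¹).toReal :=
    ENNReal.toReal_mono (by simp) (ENNReal.inv_le_inv.2 hr)
  simpa using this

lemma lossExp_of_le_two {p q r : ℝ≥0∞} (hp : 1 ≤ p) (hq : 1 ≤ q) (hr : 1 ≤ r)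
    (hpqr : 1 / r = 1 / q + 1 / p) :
    1 + max (2 * (q⁻¹).toReal - 1) 0 + max (2 * (p⁻¹).toReal - 1) 0 ≤ 2 * lossExp p q r := by
  have h1 := toReal_inv_eq_add hp hq hpqr
  have h2 := toReal_inv_le_one hr
  have m1 : 1 / 2 ≤ lossExp p q r := (le_max_left _ _).trans (le_max_left _ _)
  have m2 : 2 * (p⁻¹).toReal - 1 / 2 ≤ lossExp p q r := (le_max_right _ _).trans (le_max_left _ _)
  have m3 : 2 * (q⁻¹).toReal - 1 / 2 ≤ lossExp p q r := (le_max_left _ _).trans (le_max_right _ _)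
  rcases le_total (2 * (q⁻¹).toReal - 1) 0 with h3 | h3 <;>
  rcases le_total (2 * (p⁻¹).toReal - 1) 0 with h4 | h4 <;>
  simp only [max_eq_left, max_eq_right, h3, h4] <;> linarith

lemma eLpNorm_two_le {X : Type*} [MeasurableSpace X] {μ : Measure X} {h : X → ℂ} {S : ℝ≥0∞}
    (hS : ∫⁻ x, ‖h x‖ₑ ^ 2 ∂μ ≤ S ^ 2) : eLpNorm h 2 μ ≤ S := by
  rw [eLpNorm_eq_lintegral_rpow_enorm_toReal (by norm_num) (by norm_num), one_div,
    ENNReal.rpow_inv_le_iff (by norm_num)]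
  simpa using hS

lemma eLpNorm_le_of_two_le {X : Type*} [MeasurableSpace X] {μ : Measure X} {h : X → ℂ}
    {S t r : ℝ≥0∞} (hr : 2 ≤ r) (hh : AEStronglyMeasurable h μ) (h1 : ∀ᵐ x ∂μ, ‖h x‖ₑ ≤ S)
    (h2 : ∫⁻ x, ‖h x‖ₑ ^ 2 ∂μ ≤ S ^ 2 * t) : eLpNorm h r μ ≤ S * t ^ (r⁻¹).toReal := by
  rcases eq_or_ne r ∞ with rfl | hrt
  · simpa using eLpNormEssSup_le_of_ae_enorm_bound h1
  have hr2 : 2 ≤ r.toReal := by simpa using ENNReal.toReal_mono hrt hr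
  rw [eLpNorm_eq_lintegral_rpow_enorm_toReal (by positivity) hrt, one_div,
    ENNReal.rpow_inv_le_iff (by linarith), ENNReal.mul_rpow_of_nonneg _ _ (by linarith),
    ← ENNReal.rpow_mul, ENNReal.toReal_inv, inv_mul_cancel₀ (by linarith), ENNReal.rpow_one]
  have e : ∀ y : ℝ≥0∞, y ^ r.toReal = y ^ (r.toReal - 2) * y ^ 2 := fun y => by
    rw [← ENNReal.rpow_two, ← ENNReal.rpow_add_of_nonneg _ _ (by linarith) (by norm_num)]
    congr 1; ring
  calc ∫⁻ x, ‖h x‖ₑ ^ r.toReal ∂μ ≤ ∫⁻ x, S ^ (r.toReal - 2) * ‖h x‖ₑ ^ 2 ∂μ := by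
        refine lintegral_mono_ae (h1.mono fun x hx => ?_)
        rw [e]
        gcongr
    _ ≤ S ^ (r.toReal - 2) * ∫⁻ x, ‖h x‖ₑ ^ 2 ∂μ := by
        rw [lintegral_const_mul'' _ (hh.enorm.pow_const 2)]
    _ ≤ S ^ (r.toReal - 2) * (S ^ 2 * t) := by gcongr
    _ = _ := by rw [e S, mul_assoc]

/-- Local bound of a tame family of operators on Lebesgue spaces. -/
theorem TameFamily.exists_eLpNorm_bilinOp_le {N : ι → ℝ} (hN : ∀ i, 1 ≤ N i)
    {c : ι → Rn n × Rn n × Rn n → ℂ} (h : TameFamily N c) {p q r : ℝ≥0∞} (hp : 1 ≤ p)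
    (hq : 1 ≤ q) (hr : 1 ≤ r) (hpqr : 1 / r = 1 / q + 1 / p) :
    ∃ C : ℝ≥0, ∀ i (F f G g : Rn n → ℂ), DecayDominated F f → DecayDominated G g →
      AEStronglyMeasurable (bilinOp (c i) F G) →
      eLpNorm (bilinOp (c i) F G) r (volume.restrict (closedBall 0 1)) ≤
        C * ENNReal.ofReal (N i ^ (n * lossExp p q r)) *
          (eLpNorm f q (decayMeasure n) * eLpNorm g p (decayMeasure n)) := by
  obtain ⟨C₁, hC₁⟩ := exists_lintegral_fourierT_sq_le_eLpNorm n hq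
  obtain ⟨C₂, hC₂⟩ := exists_lintegral_fourierT_sq_le_eLpNorm n hp
  obtain ⟨C₃, hC₃⟩ := h.exists_lintegral_bilinOp_sq_le hN
  obtain ⟨C₄, hC₄⟩ := h.exists_enorm_bilinOp_sq_le hN
  have hc := toReal_inv_eq_add hp hq hpqr
  rcases le_total r 2 with h2 | h2
  · have hV : (volume (closedBall (0 : Rn n) 1)) ^ (1 / r.toReal - 1 / 2) ≠ ∞ := by
      refine ENNReal.rpow_ne_top_of_nonneg ?_ measure_closedBall_lt_top.ne
      have hrt : r ≠ ∞ := (h2.trans_lt (by norm_num)).ne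
      have : r.toReal ≤ 2 := by simpa using ENNReal.toReal_mono (by norm_num) h2
      have h0 : 0 < r.toReal := ENNReal.toReal_pos (by positivity) hrt
      rw [sub_nonneg]
      gcongr
    refine ⟨NNReal.sqrt (C₃ * (C₁ * C₂)) *
      ((volume (closedBall (0 : Rn n) 1)) ^ (1 / r.toReal - 1 / 2)).toNNReal,
      fun i F f G g hF hG hm => ?_⟩
    have hN0 : 0 < N i := by linarith [hN i]
    have key : eLpNorm (bilinOp (c i) F G) 2 (volume.restrict (closedBall 0 1)) ≤
        NNReal.sqrt (C₃ * (C₁ * C₂)) * ENNReal.ofReal (N i ^ (n * lossExp p q r)) *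
          (eLpNorm f q (decayMeasure n) * eLpNorm g p (decayMeasure n)) := by
      refine eLpNorm_two_le ((hC₃ i F G hF.integrable hG.integrable).trans ?_)
      have e1 : ENNReal.ofReal (N i ^ n) *
          (ENNReal.ofReal (N i ^ (n * max (2 * (q⁻¹).toReal - 1) 0)) *
            ENNReal.ofReal (N i ^ (n * max (2 * (p⁻¹).toReal - 1) 0))) ≤
          ENNReal.ofReal (N i ^ (n * lossExp p q r)) ^ 2 := by
        rw [← ENNReal.ofReal_mul (by positivity), ← ENNReal.ofReal_mul (by positivity),
          ← ENNReal.ofReal_pow (by positivity)]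
        refine ENNReal.ofReal_le_ofReal ?_
        rw [← Real.rpow_natCast, ← Real.rpow_add hN0, ← Real.rpow_add hN0, ← Real.rpow_natCast,
          ← Real.rpow_mul hN0.le]
        refine Real.rpow_le_rpow_of_exponent_le (hN i) ?_
        have := mul_le_mul_of_nonneg_left (lossExp_of_le_two hp hq hr hpqr) (Nat.cast_nonneg n)
        push_cast; linarith
      have e2 : (NNReal.sqrt (C₃ * (C₁ * C₂)) : ℝ≥0∞) ^ 2 = C₃ * (C₁ * C₂) := by
        rw [← ENNReal.coe_pow, NNReal.sq_sqrt]; push_cast; rfl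
      calc C₃ * ENNReal.ofReal (N i ^ n) * (freqEnergy (N i) F * freqEnergy (N i) G)
          ≤ C₃ * ENNReal.ofReal (N i ^ n) *
            ((C₁ * (ENNReal.ofReal (N i ^ (n * max (2 * (q⁻¹).toReal - 1) 0)) *
              eLpNorm f q (decayMeasure n) ^ 2)) *
            (C₂ * (ENNReal.ofReal (N i ^ (n * max (2 * (p⁻¹).toReal - 1) 0)) *
              eLpNorm g p (decayMeasure n) ^ 2))) := by
            gcongr
            · exact hC₁ _ (hN i) F f hF
            · exact hC₂ _ (hN i) G g hG
        _ = C₃ * (C₁ * C₂) * (ENNReal.ofReal (N i ^ n) *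
          (ENNReal.ofReal (N i ^ (n * max (2 * (q⁻¹).toReal - 1) 0)) *
            ENNReal.ofReal (N i ^ (n * max (2 * (p⁻¹).toReal - 1) 0)))) *
            (eLpNorm f q (decayMeasure n) * eLpNorm g p (decayMeasure n)) ^ 2 := by ring
        _ ≤ C₃ * (C₁ * C₂) * ENNReal.ofReal (N i ^ (n * lossExp p q r)) ^ 2 *
            (eLpNorm f q (decayMeasure n) * eLpNorm g p (decayMeasure n)) ^ 2 := by gcongr
        _ = _ := by rw [← e2]; ring
    refine (eLpNorm_le_eLpNorm_mul_rpow_measure_univ h2 hm.restrict).trans ?_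
    rw [Measure.restrict_apply_univ, ENNReal.toReal_ofNat]
    push_cast
    rw [ENNReal.coe_toNNReal hV]
    calc _ ≤ _ := mul_le_mul_left key _
      _ = _ := by ring
  · have hr2 := toReal_inv_le_half h2
    have hq0 : max (2 * (q⁻¹).toReal - 1) 0 = 0 :=
      max_eq_right (by linarith [ENNReal.toReal_nonneg (a := p⁻¹)])
    have hp0 : max (2 * (p⁻¹).toReal - 1) 0 = 0 :=
      max_eq_right (by linarith [ENNReal.toReal_nonneg (a := q⁻¹)])
    refine ⟨NNReal.sqrt (max C₃ C₄ * (C₁ * C₂)), fun i F f G g hF hG hm => ?_⟩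
    have hN0 : 0 < N i := by linarith [hN i]
    set W := eLpNorm f q (decayMeasure n) * eLpNorm g p (decayMeasure n) with hW
    set K := NNReal.sqrt (max C₃ C₄ * (C₁ * C₂)) with hK
    have e2 : (K : ℝ≥0∞) ^ 2 = max C₃ C₄ * (C₁ * C₂) := by
      rw [← ENNReal.coe_pow, NNReal.sq_sqrt]; push_cast; rfl
    have hE : freqEnergy (N i) F * freqEnergy (N i) G ≤ C₁ * C₂ * W ^ 2 := by
      have h3 := hC₁ _ (hN i) F f hF
      have h4 := hC₂ _ (hN i) G g hG
      rw [hq0] at h3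
      rw [hp0] at h4
      simp only [mul_zero, Real.rpow_zero, ENNReal.ofReal_one, one_mul] at h3 h4
      calc _ ≤ (C₁ * eLpNorm f q (decayMeasure n) ^ 2) * (C₂ * eLpNorm g p (decayMeasure n) ^ 2) :=
            mul_le_mul' h3 h4
        _ = _ := by rw [hW]; ring
    have ht : ENNReal.ofReal (N i ^ n) ^ 2 * ENNReal.ofReal ((N i ^ n)⁻¹) =
        ENNReal.ofReal (N i ^ n) := by
      rw [← ENNReal.ofReal_pow (by positivity), ← ENNReal.ofReal_mul (by positivity)]
      congr 1; field_simp
    have key := eLpNorm_le_of_two_le (μ := volume.restrict (closedBall (0 : Rn n) 1))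
      (h := bilinOp (c i) F G) (S := K * ENNReal.ofReal (N i ^ n) * W)
      (t := ENNReal.ofReal ((N i ^ n)⁻¹)) h2 hm.restrict ?_ ?_
    · refine key.trans ?_
      have e3 : ENNReal.ofReal (N i ^ n) * ENNReal.ofReal ((N i ^ n)⁻¹) ^ (r⁻¹).toReal ≤
          ENNReal.ofReal (N i ^ (n * lossExp p q r)) := by
        rw [ENNReal.ofReal_rpow_of_pos (by positivity), ← ENNReal.ofReal_mul (by positivity)]
        refine ENNReal.ofReal_le_ofReal ?_
        rw [← Real.rpow_natCast, ← Real.rpow_neg hN0.le, ← Real.rpow_mul hN0.le,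
          ← Real.rpow_add hN0]
        refine Real.rpow_le_rpow_of_exponent_le (hN i) ?_
        have m4 : 3 / 2 - 2 * (r⁻¹).toReal ≤ lossExp p q r :=
          (le_max_right _ _).trans (le_max_right _ _)
        have := mul_le_mul_of_nonneg_left (show 1 - (r⁻¹).toReal ≤ lossExp p q r by linarith)
          (Nat.cast_nonneg (α := ℝ) n)
        linarith
      calc _ = K * (ENNReal.ofReal (N i ^ n) * ENNReal.ofReal ((N i ^ n)⁻¹) ^ (r⁻¹).toReal) * W := by
            ring
        _ ≤ _ := by gcongr
    · refine (ae_restrict_iff' measurableSet_closedBall).2 (Filter.Eventually.of_forall fun x hx => ?_)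
      rw [← ENNReal.pow_le_pow_left_iff two_ne_zero]
      calc _ ≤ _ := hC₄ i F G hF.integrable hG.integrable x hx
        _ ≤ (max C₃ C₄ : ℝ≥0) * ENNReal.ofReal (N i ^ n) ^ 2 * (C₁ * C₂ * W ^ 2) := by
          gcongr
          exact le_max_right _ _
        _ = (K : ℝ≥0∞) ^ 2 * ENNReal.ofReal (N i ^ n) ^ 2 * W ^ 2 := by rw [e2]; push_cast; ring
        _ = _ := by ring
    · calc _ ≤ _ := hC₃ i F G hF.integrable hG.integrable
        _ ≤ (max C₃ C₄ : ℝ≥0) * ENNReal.ofReal (N i ^ n) * (C₁ * C₂ * W ^ 2) := by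
          gcongr
          exact le_max_left _ _
        _ = (K : ℝ≥0∞) ^ 2 * (ENNReal.ofReal (N i ^ n) ^ 2 * ENNReal.ofReal ((N i ^ n)⁻¹)) *
            W ^ 2 := by rw [e2, ht]; push_cast; ring
        _ = _ := by ring

end LocalLr

/-! ### Global bounds by averaging over translations -/

section Global

variable {n : ℕ} {ι : Type*}

lemma fourierT_translate (f : Rn n → ℂ) (x₀ ξ : Rn n) :
    fourierT (fun y => f (x₀ + y)) ξ = osc ⟪ξ, x₀⟫ * fourierT f ξ := by
  rw [fourierT_eq, fourierT_eq, ← integral_const_mul,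
    ← integral_add_left_eq_self (fun y => osc ⟪ξ, x₀⟫ * (osc (-⟪ξ, y⟫) * f y)) x₀]
  congr 1; funext y
  rw [← mul_assoc, ← osc_add, inner_add_right]
  congr 2; ring

lemma bilinOp_translate (b : Rn n × Rn n × Rn n → ℂ) (f g : Rn n → ℂ) (x₀ x : Rn n) :
    bilinOp b f g (x₀ + x) = bilinOp (fun p => b ((x₀, 0) + p)) (fun y => f (x₀ + y))
      (fun y => g (x₀ + y)) x := by
  unfold bilinOp
  congr 1; funext z
  show b (x₀ + x, z) * _ * _ = b ((x₀, 0) + (x, z)) * _ * _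
  rw [fourierT_translate, fourierT_translate, Prod.mk_add_mk, zero_add, inner_add_left, osc_add,
    inner_add_right x₀, osc_add, real_inner_comm x₀ z.1, real_inner_comm x₀ z.2]
  ring

lemma tameFamily_translates {N : ι → ℝ} {b : ι → Rn n × Rn n × Rn n → ℂ}
    (hb : ∀ i, Smooth (b i)) (hd : ∀ k, BddDerivs (pureDirs n) (fun _ => Set.univ) k b)
    (h0 : ∀ i p, p.2 ∉ closedBall (0 : Rn n × Rn n) (N i) → b i p = 0) :
    TameFamily (fun w : ι × Rn n => N w.1) fun w p => b w.1 ((w.2, 0) + p) where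
  smooth w := (hb w.1).comp (contDiff_const.add contDiff_id)
  bdd k := ((hd k).comp_affine (W := pureDirs n)
    (ContinuousLinearMap.id ℝ (Rn n × Rn n × Rn n)) (fun _ h => h) hb
    (fun w : ι × Rn n => (w.2, 0)) Prod.fst).mono_set fun _ _ _ => Set.mem_univ _
  support w p hp := h0 _ _ (by simpa using hp)

lemma lintegral_lintegral_add (ν : Measure (Rn n)) [SFinite ν] {w : Rn n → ℝ≥0∞}
    (hw : Measurable w) : ∫⁻ x, ∫⁻ y, w (x + y) ∂ν = ν Set.univ * ∫⁻ x, w x := by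
  rw [lintegral_lintegral_swap (by fun_prop)]
  simp only [lintegral_add_right_eq_self, lintegral_const]
  rw [mul_comm]

/-- A bound of the `L^q` norm of an extended nonnegative function, pointwise for `q = ∞`. -/
structure NormLe {X : Type*} [MeasurableSpace X] (μ : Measure X) (φ : X → ℝ≥0∞) (q Φ : ℝ≥0∞) :
    Prop where
  top : q = ∞ → ∀ x, φ x ≤ Φ
  measurable : q ≠ ∞ → Measurable φ
  finite : q ≠ ∞ → ∫⁻ x, φ x ^ q.toReal ∂μ ≤ Φ ^ q.toReal

lemma NormLe.lintegral_mul_le {X : Type*} [MeasurableSpace X] {μ : Measure X} {φ ψ : X → ℝ≥0∞}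
    {p q r Φ Ψ : ℝ≥0∞} (hp : 1 ≤ p) (hq : 1 ≤ q) (hr : r ≠ ∞)
    (hpqr : 1 / r = 1 / q + 1 / p) (h : NormLe μ φ q Φ) (h' : NormLe μ ψ p Ψ) :
    ∫⁻ x, (φ x * ψ x) ^ r.toReal ∂μ ≤ (Φ * Ψ) ^ r.toReal := by
  rcases eq_or_ne q ∞ with hqt | hqt
  · rcases eq_or_ne p ∞ with hpt | hpt
    · exact absurd (by simpa [hqt, hpt] using hpqr) hr
    · have : r = p := by simpa [hqt] using hpqr
      subst this
      have hr0 : 0 ≤ r.toReal := ENNReal.toReal_nonneg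
      calc _ ≤ ∫⁻ x, Φ ^ r.toReal * ψ x ^ r.toReal ∂μ := by
            refine lintegral_mono fun x => ?_
            rw [ENNReal.mul_rpow_of_nonneg _ _ hr0]
            gcongr
            exact h.top hqt x
        _ = Φ ^ r.toReal * ∫⁻ x, ψ x ^ r.toReal ∂μ :=
            lintegral_const_mul _ ((h'.measurable hpt).pow_const _)
        _ ≤ Φ ^ r.toReal * Ψ ^ r.toReal := by gcongr; exact h'.finite hpt
        _ = _ := (ENNReal.mul_rpow_of_nonneg _ _ hr0).symm
  · rcases eq_or_ne p ∞ with hpt | hpt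
    · have : r = q := by simpa [hpt] using hpqr
      subst this
      have hr0 : 0 ≤ r.toReal := ENNReal.toReal_nonneg
      calc _ ≤ ∫⁻ x, φ x ^ r.toReal * Ψ ^ r.toReal ∂μ := by
            refine lintegral_mono fun x => ?_
            rw [ENNReal.mul_rpow_of_nonneg _ _ hr0]
            gcongr
            exact h'.top hpt x
        _ = (∫⁻ x, φ x ^ r.toReal ∂μ) * Ψ ^ r.toReal :=
            lintegral_mul_const _ ((h.measurable hqt).pow_const _)
        _ ≤ Φ ^ r.toReal * Ψ ^ r.toReal := by gcongr; exact h.finite hqt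
        _ = _ := (ENNReal.mul_rpow_of_nonneg _ _ hr0).symm
    · have e := toReal_inv_eq_add hp hq hpqr
      simp only [ENNReal.toReal_inv] at e
      have hp0 : 0 < p.toReal := ENNReal.toReal_pos (by positivity) hpt
      have hq0 : 0 < q.toReal := ENNReal.toReal_pos (by positivity) hqt
      have hp1 : 0 < p.toReal⁻¹ := by positivity
      have hq1 : 0 < q.toReal⁻¹ := by positivity
      have hr0 : 0 < r.toReal := by
        rw [← inv_pos, e]; positivity
      have hrq : r.toReal < q.toReal := by
        rw [← inv_lt_inv₀ hq0 hr0]; linarith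
      have key := ENNReal.lintegral_Lp_mul_le_Lq_mul_Lr hr0 hrq
        (r := p.toReal) (by simpa only [one_div] using e) μ (h.measurable hqt).aemeasurable
        (h'.measurable hpt).aemeasurable
      rw [one_div, ENNReal.rpow_inv_le_iff hr0] at key
      refine key.trans ?_
      gcongr
      · rw [one_div, ENNReal.rpow_inv_le_iff hq0]
        exact h.finite hqt
      · rw [one_div, ENNReal.rpow_inv_le_iff hp0]
        exact h'.finite hpt

lemma normLe_eLpNorm_translates {f : Rn n → ℂ} (hf : Continuous f) {q : ℝ≥0∞} (hq : 1 ≤ q) :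
    NormLe volume (fun x => eLpNorm (fun y => f (x + y)) q (decayMeasure n)) q
      (decayMeasure n Set.univ ^ (q⁻¹).toReal * eLpNorm f q volume) := by
  have hm : Measurable fun z : Rn n × Rn n => ‖f (z.1 + z.2)‖ₑ ^ q.toReal := by
    have : Continuous fun z : Rn n × Rn n => f (z.1 + z.2) := by fun_prop
    exact this.measurable.enorm.pow_const _
  have hq0 : q ≠ 0 := by positivity
  refine ⟨fun hqt x => ?_, fun hqt => ?_, fun hqt => ?_⟩
  · subst hqt
    simp only [ENNReal.inv_top, ENNReal.toReal_zero, ENNReal.rpow_zero, one_mul,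
      eLpNorm_exponent_top]
    refine (eLpNormEssSup_mono_measure _ (withDensity_absolutelyContinuous _ _)).trans
      (le_of_eq ?_)
    have := eLpNorm_comp_measurePreserving (p := ∞) (g := f) hf.aestronglyMeasurable
      (measurePreserving_add_left volume x)
    rw [eLpNorm_exponent_top, eLpNorm_exponent_top] at this
    exact this
  · simp only [eLpNorm_eq_lintegral_rpow_enorm_toReal hq0 hqt]
    exact (hm.lintegral_prod_right').pow_const _
  · have hq1 : 0 < q.toReal := ENNReal.toReal_pos hq0 hqt
    have e : ∀ y : ℝ≥0∞, (y ^ (1 / q.toReal)) ^ q.toReal = y := fun y => by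
      rw [← ENNReal.rpow_mul, one_div, inv_mul_cancel₀ hq1.ne', ENNReal.rpow_one]
    simp only [eLpNorm_eq_lintegral_rpow_enorm_toReal hq0 hqt, e]
    rw [ENNReal.mul_rpow_of_nonneg _ _ hq1.le, e, ENNReal.toReal_inv, ← one_div q.toReal, e,
      ← lintegral_lintegral_add (decayMeasure n) (hf.measurable.enorm.pow_const _)]

lemma stronglyMeasurable_bilinOp {b : Rn n × Rn n × Rn n → ℂ} (hb : Continuous b)
    {f g : Rn n → ℂ} (hf : Integrable f) (hg : Integrable g) :
    StronglyMeasurable (bilinOp b f g) := by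
  have cf := continuous_fourierT hf
  have cg := continuous_fourierT hg
  have : Continuous (Function.uncurry fun (x : Rn n) (z : Rn n × Rn n) =>
      b (x, z) * osc ⟪x, z.1 + z.2⟫ * (fourierT f z.1 * fourierT g z.2)) := by
    unfold Function.uncurry
    fun_prop
  exact this.stronglyMeasurable.integral_prod_right

lemma eLpNorm_le_of_local {T : Rn n → ℂ} (hT : Measurable T) {φ ψ : Rn n → ℝ≥0∞}
    {p q r K Φ Ψ : ℝ≥0∞} (hp : 1 ≤ p) (hq : 1 ≤ q) (hr : 1 ≤ r) (hK : K ≠ ∞)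
    (hpqr : 1 / r = 1 / q + 1 / p) (hφ : NormLe volume φ q Φ) (hψ : NormLe volume ψ p Ψ)
    (h : ∀ x, eLpNorm (fun y => T (x + y)) r (volume.restrict (closedBall 0 1)) ≤
      K * (φ x * ψ x)) :
    eLpNorm T r volume ≤
      (volume (closedBall (0 : Rn n) 1))⁻¹ ^ (r⁻¹).toReal * (K * (Φ * Ψ)) := by
  rcases eq_or_ne r ∞ with hrt | hrt
  · have hs : 1 / q + 1 / p = 0 := by rw [← hpqr, hrt]; simp
    have hqt : q = ∞ := by simpa using (add_eq_zero.1 hs).1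
    have hpt : p = ∞ := by simpa using (add_eq_zero.1 hs).2
    subst hrt
    simp only [ENNReal.inv_top, ENNReal.toReal_zero, ENNReal.rpow_zero, one_mul,
      eLpNorm_exponent_top] at h ⊢
    refine eLpNormEssSup_le_of_ae_enorm_bound ?_
    have hx : ∀ x, ∀ᵐ y ∂(volume.restrict (closedBall (0 : Rn n) 1)),
        ‖T (x + y)‖ₑ ≤ K * (Φ * Ψ) := fun x => by
      filter_upwards [enorm_ae_le_eLpNormEssSup (fun y => T (x + y))
        (volume.restrict (closedBall (0 : Rn n) 1))] with y hy
      refine hy.trans ((h x).trans ?_)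
      gcongr
      · exact hφ.top hqt x
      · exact hψ.top hpt x
    refine measure_null_of_locally_null _ fun x _ => ⟨closedBall x 1 ∩
      {y | ¬ ‖T y‖ₑ ≤ K * (Φ * Ψ)}, ?_, ?_⟩
    · exact Filter.inter_mem (mem_nhdsWithin_of_mem_nhds (closedBall_mem_nhds x one_pos))
        self_mem_nhdsWithin
    · have h1 := (ae_restrict_iff' measurableSet_closedBall).1 (hx x)
      have h2 : ∀ᵐ y, -x + y ∈ closedBall (0 : Rn n) 1 → ‖T (x + (-x + y))‖ₑ ≤ K * (Φ * Ψ) :=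
        (measurePreserving_add_left (volume : Measure (Rn n)) (-x)).quasiMeasurePreserving.ae h1
      refine measure_mono_null ?_ h2
      rintro y ⟨hy, hy'⟩ hc
      change -x + y ∈ closedBall (0 : Rn n) 1 → ‖T (x + (-x + y))‖ₑ ≤ K * (Φ * Ψ) at hc
      rw [add_neg_cancel_left] at hc
      exact hy' (hc (by
        rw [mem_closedBall, dist_zero_right, neg_add_eq_sub, ← dist_eq_norm]; exact hy))
  · have hr0 : r ≠ 0 := by positivity
    have hr1 : 0 < r.toReal := ENNReal.toReal_pos hr0 hrt
    have hV0 : volume (closedBall (0 : Rn n) 1) ≠ 0 := (measure_closedBall_pos _ _ one_pos).ne'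
    have hV1 : volume (closedBall (0 : Rn n) 1) ≠ ∞ := measure_closedBall_lt_top.ne
    have e : ∀ y : ℝ≥0∞, (y ^ (1 / r.toReal)) ^ r.toReal = y := fun y => by
      rw [← ENNReal.rpow_mul, one_div, inv_mul_cancel₀ hr1.ne', ENNReal.rpow_one]
    have key : volume (closedBall (0 : Rn n) 1) * ∫⁻ x, ‖T x‖ₑ ^ r.toReal ≤
        (K * (Φ * Ψ)) ^ r.toReal := by
      have h1 := lintegral_lintegral_add (volume.restrict (closedBall (0 : Rn n) 1))
        (hT.enorm.pow_const r.toReal)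
      rw [Measure.restrict_apply_univ] at h1
      rw [← h1]
      calc ∫⁻ x, ∫⁻ y in closedBall 0 1, ‖T (x + y)‖ₑ ^ r.toReal
          ≤ ∫⁻ x, K ^ r.toReal * (φ x * ψ x) ^ r.toReal := by
            refine lintegral_mono fun x => ?_
            have h2 := h x
            rw [eLpNorm_eq_lintegral_rpow_enorm_toReal hr0 hrt] at h2
            calc _ = _ := (e _).symm
              _ ≤ (K * (φ x * ψ x)) ^ r.toReal := by gcongr
              _ = _ := ENNReal.mul_rpow_of_nonneg _ _ hr1.le
        _ = K ^ r.toReal * ∫⁻ x, (φ x * ψ x) ^ r.toReal :=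
            lintegral_const_mul' _ _ (ENNReal.rpow_ne_top_of_nonneg hr1.le hK)
        _ ≤ K ^ r.toReal * (Φ * Ψ) ^ r.toReal := by
            gcongr
            exact hφ.lintegral_mul_le hp hq hrt hpqr hψ
        _ = _ := (ENNReal.mul_rpow_of_nonneg _ _ hr1.le).symm
    rw [eLpNorm_eq_lintegral_rpow_enorm_toReal hr0 hrt, one_div, ENNReal.rpow_inv_le_iff hr1,
      ENNReal.mul_rpow_of_nonneg _ _ hr1.le, ENNReal.toReal_inv, ← one_div r.toReal, e]
    calc _ = (volume (closedBall (0 : Rn n) 1))⁻¹ *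
          (volume (closedBall (0 : Rn n) 1) * ∫⁻ x, ‖T x‖ₑ ^ r.toReal) := by
          rw [← mul_assoc, ENNReal.inv_mul_cancel hV0 hV1, one_mul]
      _ ≤ _ := by gcongr

/-- Global bound for symbols with bounded derivatives and compact frequency support. -/
theorem exists_eLpNorm_bilinOp_le {N : ι → ℝ} (hN : ∀ i, 1 ≤ N i)
    {b : ι → Rn n × Rn n × Rn n → ℂ} (hb : ∀ i, Smooth (b i))
    (hd : ∀ k, BddDerivs (pureDirs n) (fun _ => Set.univ) k b)
    (h0 : ∀ i p, p.2 ∉ closedBall (0 : Rn n × Rn n) (N i) → b i p = 0) {p q r : ℝ≥0∞}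
    (hp : 1 ≤ p) (hq : 1 ≤ q) (hr : 1 ≤ r) (hpqr : 1 / r = 1 / q + 1 / p) :
    ∃ C : ℝ≥0, ∀ i (f g : Rn n → ℂ), Continuous f → Integrable f → Continuous g → Integrable g →
      eLpNorm (bilinOp (b i) f g) r volume ≤
        C * ENNReal.ofReal (N i ^ (n * lossExp p q r)) *
          (eLpNorm f q volume * eLpNorm g p volume) := by
  obtain ⟨c, hc, hbc⟩ := (tameFamily_translates hb hd h0).exists_localized (decayDirs n)
  obtain ⟨C, hC⟩ := hc.exists_eLpNorm_bilinOp_le (fun w : ι × Rn n => hN w.1) hp hq hr hpqr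
  have hdom : ∀ (f : Rn n → ℂ), Continuous f → Integrable f → ∀ x₀ : Rn n, DecayDominated
      (fun y => (listWeight (decayDirs n) y)⁻¹ * f (x₀ + y)) (fun y => f (x₀ + y)) := by
    intro f hf hf' x₀
    refine ⟨?_, integrable_inv_listWeight_mul _ (hf'.comp_add_left x₀), ?_, fun y => ?_⟩
    · have h1 := (continuous_listWeight (decayDirs n)).inv₀ (listWeight_ne_zero _)
      exact (h1.mul (by fun_prop : Continuous fun y => f (x₀ + y))).measurable
    · exact (by fun_prop : Continuous fun y => f (x₀ + y)).measurable
    · rw [norm_mul]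
      gcongr
      exact norm_inv_listWeight_le y
  have hV : (volume (closedBall (0 : Rn n) 1))⁻¹ ^ (r⁻¹).toReal ≠ ∞ :=
    ENNReal.rpow_ne_top_of_nonneg ENNReal.toReal_nonneg
      (ENNReal.inv_ne_top.2 (measure_closedBall_pos _ _ one_pos).ne')
  have hD : ∀ s : ℝ≥0∞, decayMeasure n Set.univ ^ (s⁻¹).toReal ≠ ∞ := fun s =>
    ENNReal.rpow_ne_top_of_nonneg ENNReal.toReal_nonneg (measure_ne_top _ _)
  refine ⟨((volume (closedBall (0 : Rn n) 1))⁻¹ ^ (r⁻¹).toReal).toNNReal * C *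
    ((decayMeasure n Set.univ ^ (q⁻¹).toReal).toNNReal *
      (decayMeasure n Set.univ ^ (p⁻¹).toReal).toNNReal), fun i f g hf hf' hg hg' => ?_⟩
  have key := eLpNorm_le_of_local
    (stronglyMeasurable_bilinOp (hb i).continuous hf' hg').measurable hp hq hr
    (K := C * ENNReal.ofReal (N i ^ (n * lossExp p q r)))
    (ENNReal.mul_ne_top ENNReal.coe_ne_top ENNReal.ofReal_ne_top) hpqr
    (normLe_eLpNorm_translates hf hq) (normLe_eLpNorm_translates hg hp) fun x₀ => ?_
  · refine key.trans (le_of_eq ?_)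
    push_cast
    rw [ENNReal.coe_toNNReal hV, ENNReal.coe_toNNReal (hD _), ENNReal.coe_toNNReal (hD _)]
    ring
  · have e : (fun y => bilinOp (b i) f g (x₀ + y)) = bilinOp (c (i, x₀))
        (fun y => (listWeight (decayDirs n) y)⁻¹ * f (x₀ + y))
        (fun y => (listWeight (decayDirs n) y)⁻¹ * g (x₀ + y)) := by
      funext x
      rw [bilinOp_translate]
      exact hbc (i, x₀) _ _ (hf'.comp_add_left x₀) (hg'.comp_add_left x₀) x
    rw [e]
    have h1 := hdom f hf hf' x₀
    have h2 := hdom g hg hg' x₀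
    exact hC (i, x₀) _ _ _ _ h1 h2 (stronglyMeasurable_bilinOp (hc.smooth _).continuous
      h1.integrable h2.integrable).aestronglyMeasurable

end Global

/-! ### Dilations and the bound for a dyadic piece -/

section Dilation

variable {n : ℕ}

lemma eLpNorm_comp_smul {A : ℝ} (hA : A ≠ 0) (f : Rn n → ℂ) (q : ℝ≥0∞) :
    eLpNorm (fun y => f (A • y)) q volume =
      ENNReal.ofReal |(A ^ n)⁻¹| ^ (q⁻¹).toReal * eLpNorm f q volume := by
  have h1 := (Homeomorph.smulOfNeZero A hA).measurableEmbedding.eLpNorm_map_measure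
    (μ := (volume : Measure (Rn n))) (g := f) (p := q)
  have h2 : Measure.map (Homeomorph.smulOfNeZero A hA) (volume : Measure (Rn n)) =
      ENNReal.ofReal |(A ^ n)⁻¹| • volume := by
    have := Measure.map_addHaar_smul (volume : Measure (Rn n)) hA
    rwa [finrank_euclideanSpace_fin] at this
  have h3 : ENNReal.ofReal |(A ^ n)⁻¹| ≠ 0 := by
    rw [Ne, ENNReal.ofReal_eq_zero, not_le, abs_pos]
    exact inv_ne_zero (pow_ne_zero _ hA)
  rw [h2, eLpNorm_smul_measure_of_ne_zero h3, one_div, smul_eq_mul] at h1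
  exact h1.symm

lemma fourierT_comp_inv_smul {A : ℝ} (hA : 0 < A) (f : Rn n → ℂ) (ξ : Rn n) :
    fourierT (fun y => f (A⁻¹ • y)) ξ = (A : ℂ) ^ n * fourierT f (A • ξ) := by
  have h := Measure.integral_comp_inv_smul (volume : Measure (Rn n))
    (fun y => osc (-⟪A • ξ, y⟫) * f y) A
  rw [finrank_euclideanSpace_fin, abs_of_pos (by positivity), Complex.real_smul,
    ← fourierT_eq] at h
  push_cast at h
  rw [← h, fourierT_eq]
  congr 1; funext y
  rw [real_inner_smul_left, real_inner_smul_right, mul_inv_cancel_left₀ hA.ne']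

lemma bilinOp_dilate {A : ℝ} (hA : 0 < A) (c : Rn n × Rn n × Rn n → ℂ) (f g : Rn n → ℂ)
    (x : Rn n) : bilinOp c f g x = bilinOp (fun p => c (A⁻¹ • p.1, A • p.2))
      (fun y => f (A⁻¹ • y)) (fun y => g (A⁻¹ • y)) (A • x) := by
  have h := Measure.integral_comp_smul ((volume : Measure (Rn n)).prod (volume : Measure (Rn n)))
    (fun z => c (x, z) * osc ⟪x, z.1 + z.2⟫ * (fourierT f z.1 * fourierT g z.2)) A
  rw [Module.finrank_prod, finrank_euclideanSpace_fin, abs_of_pos (by positivity),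
    Complex.real_smul, ← Measure.volume_eq_prod] at h
  have h1 : bilinOp c f g x = (A : ℂ) ^ (n + n) * ((((A ^ (n + n))⁻¹ : ℝ) : ℂ) *
      bilinOp c f g x) := by
    push_cast
    rw [mul_inv_cancel_left₀]
    exact pow_ne_zero _ (by exact_mod_cast hA.ne')
  rw [h1]
  unfold bilinOp
  rw [← h, ← integral_const_mul]
  congr 1; funext z
  simp only [fourierT_comp_inv_smul hA, Prod.smul_fst, Prod.smul_snd, ← smul_add,
    real_inner_smul_left, real_inner_smul_right, inv_smul_smul₀ hA.ne']
  ring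

lemma bilinOp_const_mul (k : ℂ) (c : Rn n × Rn n × Rn n → ℂ) (f g : Rn n → ℂ) (x : Rn n) :
    bilinOp (fun p => k * c p) f g x = k * bilinOp c f g x := by
  unfold bilinOp
  rw [← integral_const_mul]
  congr 1; funext z
  ring

lemma eLpNorm_bilinOp_le_of_dilate {A : ℝ} (hA : 0 < A) {p q r K : ℝ≥0∞}
    (hp : 1 ≤ p) (hq : 1 ≤ q) (hpqr : 1 / r = 1 / q + 1 / p)
    (c : Rn n × Rn n × Rn n → ℂ) (f g : Rn n → ℂ)
    (h : eLpNorm (bilinOp (fun p => c (A⁻¹ • p.1, A • p.2)) (fun y => f (A⁻¹ • y))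
      (fun y => g (A⁻¹ • y))) r volume ≤ K * (eLpNorm (fun y => f (A⁻¹ • y)) q volume *
        eLpNorm (fun y => g (A⁻¹ • y)) p volume)) :
    eLpNorm (bilinOp c f g) r volume ≤ K * (eLpNorm f q volume * eLpNorm g p volume) := by
  have e : bilinOp c f g = fun x => bilinOp (fun p => c (A⁻¹ • p.1, A • p.2))
      (fun y => f (A⁻¹ • y)) (fun y => g (A⁻¹ • y)) (A • x) :=
    funext fun x => bilinOp_dilate hA c f g x
  rw [eLpNorm_comp_smul (inv_ne_zero hA.ne'), eLpNorm_comp_smul (inv_ne_zero hA.ne')] at h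
  rw [e, eLpNorm_comp_smul hA.ne']
  set D := ENNReal.ofReal |(A ^ n)⁻¹| with hD
  set D' := ENNReal.ofReal |(A⁻¹ ^ n)⁻¹| with hD'
  have hDD : D * D' = 1 := by
    rw [hD, hD', ← ENNReal.ofReal_mul (abs_nonneg _), ← abs_mul, ← mul_inv, ← mul_pow,
      mul_inv_cancel₀ hA.ne']
    simp
  have hr : D ^ (r⁻¹).toReal * (D' ^ (q⁻¹).toReal * D' ^ (p⁻¹).toReal) = 1 := by
    rw [← ENNReal.rpow_add_of_nonneg _ _ ENNReal.toReal_nonneg ENNReal.toReal_nonneg,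
      ← toReal_inv_eq_add hp hq hpqr, ← ENNReal.mul_rpow_of_nonneg _ _ ENNReal.toReal_nonneg, hDD,
      ENNReal.one_rpow]
  calc _ ≤ D ^ (r⁻¹).toReal * (K * (D' ^ (q⁻¹).toReal * eLpNorm f q volume *
        (D' ^ (p⁻¹).toReal * eLpNorm g p volume))) := by gcongr
    _ = D ^ (r⁻¹).toReal * (D' ^ (q⁻¹).toReal * D' ^ (p⁻¹).toReal) *
        (K * (eLpNorm f q volume * eLpNorm g p volume)) := by ring
    _ = _ := by rw [hr, one_mul]

/-- The dyadic piece of a symbol at frequencies of size `2^j`. -/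
def dyadicPiece (a : Rn n → Rn n → Rn n → ℂ) (j : ℕ) (p : Rn n × Rn n × Rn n) : ℂ :=
  a p.1 p.2.1 p.2.2 * (annular j p.2 : ℂ)

lemma dyadicPiece_eq (m ρ : ℝ) (a : Rn n → Rn n → Rn n → ℂ) (j : ℕ)
    (p : Rn n × Rn n × Rn n) : dyadicPiece a j ((freq j ^ ρ)⁻¹ • p.1, freq j ^ ρ • p.2) =
      ((freq j ^ m : ℝ) : ℂ) * rescaledPiece m ρ a j p := by
  have h : ((freq j ^ m : ℝ) : ℂ) * ((freq j ^ (-m) : ℝ) : ℂ) = 1 := by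
    rw [← Complex.ofReal_mul, ← Real.rpow_add (freq_pos j)]; simp
  rw [rescaledPiece, ← mul_assoc, h, one_mul]
  rfl

lemma rescaledPiece_support {m ρ : ℝ} {a : Rn n → Rn n → Rn n → ℂ} (j : ℕ)
    (p : Rn n × Rn n × Rn n)
    (hp : p.2 ∉ closedBall (0 : Rn n × Rn n) (2 * freq j ^ (1 - ρ))) :
    rescaledPiece m ρ a j p = 0 := by
  by_contra h
  have h1 : annular j (freq j ^ ρ • p.2) ≠ 0 := fun h0 => h (by simp [rescaledPiece, h0])
  have h2 := (annular_support h1).2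
  have hA : 0 < freq j ^ ρ := Real.rpow_pos_of_pos (freq_pos j) _
  have hR := freq_pos j
  have e : freq j ^ ρ * freq j ^ (1 - ρ) = freq j := by
    rw [← Real.rpow_add hR]; simp
  rw [four_pow_eq] at h2
  have key : ∀ v : Rn n, ‖freq j ^ ρ • v‖ ^ 2 ≤ 2 * freq j ^ 2 → ‖v‖ ≤ 2 * freq j ^ (1 - ρ) := by
    intro v hv
    rw [norm_smul, Real.norm_of_nonneg hA.le] at hv
    refine le_of_mul_le_mul_left ?_ hA
    rw [mul_left_comm, e]
    refine abs_le_of_sq_le_sq' ?_ (by positivity) |>.2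
    nlinarith
  refine hp ?_
  rw [mem_closedBall, dist_zero_right, Prod.norm_def]
  simp only [Prod.smul_fst, Prod.smul_snd] at h2
  exact max_le (key _ (by nlinarith [sq_nonneg ‖freq j ^ ρ • p.2.2‖]))
    (key _ (by nlinarith [sq_nonneg ‖freq j ^ ρ • p.2.1‖]))

theorem exists_eLpNorm_dyadicPiece_le {m ρ δ : ℝ} (hδρ : δ ≤ ρ) (hρ1 : ρ ≤ 1)
    {a : Rn n → Rn n → Rn n → ℂ} (ha : BilinSmRhoDelta n m ρ δ a) {p q r : ℝ≥0∞}
    (hp : 1 ≤ p) (hq : 1 ≤ q) (hr : 1 ≤ r) (hpqr : 1 / r = 1 / q + 1 / p) :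
    ∃ C : ℝ≥0, ∀ j (f g : Rn n → ℂ), Continuous f → Integrable f → Continuous g → Integrable g →
      eLpNorm (bilinOp (dyadicPiece a j) f g) r volume ≤
        C * ENNReal.ofReal (2 ^ (m + (1 - ρ) * (n * lossExp p q r))) ^ j *
          (eLpNorm f q volume * eLpNorm g p volume) := by
  set M := n * lossExp p q r with hM
  have hN : ∀ j, 1 ≤ 2 * freq j ^ (1 - ρ) := fun j => by
    have := Real.one_le_rpow (one_le_freq j) (sub_nonneg.2 hρ1)
    linarith
  obtain ⟨C, hC⟩ := exists_eLpNorm_bilinOp_le hN (smooth_rescaledPiece (m := m) (ρ := ρ) ha.1)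
    (bddDerivs_rescaledPiece hδρ hρ1 ha) (fun j p => rescaledPiece_support j p) hp hq hr hpqr
  refine ⟨C * Real.toNNReal (2 ^ M), fun j f g hf hf' hg hg' => ?_⟩
  have hA : 0 < freq j ^ ρ := Real.rpow_pos_of_pos (freq_pos j) _
  refine eLpNorm_bilinOp_le_of_dilate hA hp hq hpqr _ _ _ ?_
  have e : bilinOp (fun p : Rn n × Rn n × Rn n =>
      dyadicPiece a j ((freq j ^ ρ)⁻¹ • p.1, freq j ^ ρ • p.2)) (fun y => f ((freq j ^ ρ)⁻¹ • y))
      (fun y => g ((freq j ^ ρ)⁻¹ • y)) = ((freq j ^ m : ℝ) : ℂ) • bilinOp (rescaledPiece m ρ a j)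
      (fun y => f ((freq j ^ ρ)⁻¹ • y)) (fun y => g ((freq j ^ ρ)⁻¹ • y)) := by
    funext x
    simp only [dyadicPiece_eq m, bilinOp_const_mul, Pi.smul_apply, smul_eq_mul]
  rw [e, eLpNorm_const_smul]
  have h := hC j (fun y => f ((freq j ^ ρ)⁻¹ • y)) (fun y => g ((freq j ^ ρ)⁻¹ • y))
    (by fun_prop) ((integrable_comp_smul_iff _ _ (inv_ne_zero hA.ne')).2 hf') (by fun_prop)
    ((integrable_comp_smul_iff _ _ (inv_ne_zero hA.ne')).2 hg')
  refine (mul_le_mul_right h _).trans (le_of_eq ?_)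
  rw [← mul_assoc]
  congr 1
  have e1 : ‖((freq j ^ m : ℝ) : ℂ)‖ₑ = ENNReal.ofReal (freq j ^ m) := by
    rw [← ofReal_norm, Complex.norm_real,
      Real.norm_of_nonneg (Real.rpow_nonneg (freq_pos j).le _)]
  have e2 : freq j ^ m * (2 * freq j ^ (1 - ρ)) ^ M =
      2 ^ M * (2 ^ (m + (1 - ρ) * M)) ^ j := by
    have h0 := freq_pos j
    rw [Real.mul_rpow (by norm_num) (by positivity), ← Real.rpow_mul h0.le, mul_left_comm,
      ← Real.rpow_add h0, show freq j = (2 : ℝ) ^ j from rfl, ← Real.rpow_natCast,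
      ← Real.rpow_natCast, ← Real.rpow_mul (by norm_num),
      ← Real.rpow_mul (by norm_num), mul_comm (j : ℝ)]
  rw [e1, mul_left_comm, ← ENNReal.ofReal_mul (by positivity), e2, ENNReal.ofReal_mul (by positivity),
    ENNReal.ofReal_pow (by positivity), ENNReal.coe_mul, mul_assoc]
  rfl

end Dilation

/-! ### Summation of the dyadic pieces -/

section Summation

variable {n : ℕ}

lemma integrable_fourierT (f : SchwartzMap (Rn n) ℂ) : Integrable (fourierT (f : Rn n → ℂ)) := by
  have h : fourierT (f : Rn n → ℂ) =
      fun ξ => (FourierTransform.fourier f : SchwartzMap (Rn n) ℂ) ((2 * Real.pi)⁻¹ • ξ) := by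
    funext ξ
    rw [SchwartzMap.fourier_coe, Real.fourier_eq', fourierT_eq]
    congr 1; funext y
    rw [smul_eq_mul, real_inner_smul_right, osc, mul_comm Complex.I, real_inner_comm]
    congr 4
    field_simp
  rw [h]
  exact (integrable_comp_smul_iff volume _ (by positivity)).2 (SchwartzMap.integrable _)

lemma BilinSmRhoDelta.exists_norm_le {m ρ δ : ℝ} (hm : m ≤ 0) {a : Rn n → Rn n → Rn n → ℂ}
    (ha : BilinSmRhoDelta n m ρ δ a) : ∃ C : ℝ, 0 ≤ C ∧ ∀ x ξ η, ‖a x ξ η‖ ≤ C := by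
  obtain ⟨C, hC⟩ := ha.2 0 0 0
  have h : ∀ x ξ η, ‖a x ξ η‖ ≤ C * (1 + ‖ξ‖ ^ 2 + ‖η‖ ^ 2) ^ (m / 2) := by
    intro x ξ η
    simpa using hC x ξ η
  have hC0 : 0 ≤ C := by simpa using (norm_nonneg _).trans (h 0 0 0)
  refine ⟨C, hC0, fun x ξ η => (h x ξ η).trans (mul_le_of_le_one_right hC0 ?_)⟩
  exact Real.rpow_le_one_of_one_le_of_nonpos (by nlinarith [sq_nonneg ‖ξ‖, sq_nonneg ‖η‖])
    (by linarith)

lemma integrable_of_norm_le {c : Rn n × Rn n × Rn n → ℂ} (hc : Continuous c) {C : ℝ}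
    (h : ∀ p, ‖c p‖ ≤ C) (f g : SchwartzMap (Rn n) ℂ) (x : Rn n) :
    Integrable fun z : Rn n × Rn n =>
      c (x, z) * osc ⟪x, z.1 + z.2⟫ * (fourierT f z.1 * fourierT g z.2) := by
  refine ((integrable_fourierT f).mul_prod (integrable_fourierT g)).bdd_mul
    (c := C) ?_ (Filter.Eventually.of_forall fun z => ?_)
  · exact (by fun_prop : Continuous fun z : Rn n × Rn n =>
      c (x, z) * osc ⟪x, z.1 + z.2⟫).aestronglyMeasurable
  · rw [norm_mul, norm_osc, mul_one]
    exact h _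

lemma Tbilin_eq_bilinOp {a : Rn n → Rn n → Rn n → ℂ}
    (hc : Continuous fun p : Rn n × Rn n × Rn n => a p.1 p.2.1 p.2.2) {C : ℝ}
    (h : ∀ x ξ η, ‖a x ξ η‖ ≤ C) (f g : SchwartzMap (Rn n) ℂ) (x : Rn n) :
    Tbilin a f g x = bilinOp (fun p => a p.1 p.2.1 p.2.2) f g x := by
  rw [bilinOp, Measure.volume_eq_prod, integral_prod _
    (integrable_of_norm_le hc (fun p => h _ _ _) f g x)]
  unfold Tbilin osc
  congr 1; funext ξ
  congr 1; funext η
  ring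

lemma abs_annular_le (j : ℕ) (z : Rn n × Rn n) : |annular j z| ≤ 2 := by
  cases j with
  | zero => exact (abs_cutoff_le 1 z).trans one_le_two
  | succ j =>
    refine (abs_sub _ _).trans ?_
    linarith [abs_cutoff_le ((4 ^ (j + 1))⁻¹) z, abs_cutoff_le ((4 ^ j)⁻¹) z]

lemma tendsto_cutoff (z : Rn n × Rn n) :
    Filter.Tendsto (fun J : ℕ => (cutoff ((4 ^ J)⁻¹) z : ℂ)) Filter.atTop (nhds 1) := by
  have h : Filter.Tendsto (fun J : ℕ => ((4 : ℝ) ^ J)⁻¹ * (‖z.1‖ ^ 2 + ‖z.2‖ ^ 2)) Filter.atTop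
      (nhds (0 * (‖z.1‖ ^ 2 + ‖z.2‖ ^ 2))) :=
    ((tendsto_pow_atTop_atTop_of_one_lt (by norm_num)).inv_tendsto_atTop).mul_const _
  rw [zero_mul] at h
  refine tendsto_const_nhds.congr' ?_
  filter_upwards [h.eventually_le_const one_pos] with J hJ
  rw [cutoff_of_le hJ, Complex.ofReal_one]

lemma tendsto_sum_bilinOp_dyadicPiece {a : Rn n → Rn n → Rn n → ℂ}
    (hs : Smooth fun p : Rn n × Rn n × Rn n => a p.1 p.2.1 p.2.2) {C : ℝ} (hC : 0 ≤ C)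
    (h : ∀ x ξ η, ‖a x ξ η‖ ≤ C) (f g : SchwartzMap (Rn n) ℂ) (x : Rn n) :
    Filter.Tendsto (fun J : ℕ => ∑ j ∈ Finset.range (J + 1), bilinOp (dyadicPiece a j) f g x)
      Filter.atTop (nhds (Tbilin a f g x)) := by
  have hc := hs.continuous
  have cD : ∀ j, Continuous (dyadicPiece a j) := fun j =>
    hc.mul ((smooth_annular j).continuous.comp continuous_snd)
  have hD : ∀ j p, ‖dyadicPiece a j p‖ ≤ C * 2 := by
    intro j p
    rw [dyadicPiece, norm_mul, Complex.norm_real]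
    exact mul_le_mul (h _ _ _) (abs_annular_le _ _) (norm_nonneg _) hC
  have e : ∀ J : ℕ, ∑ j ∈ Finset.range (J + 1), bilinOp (dyadicPiece a j) f g x =
      ∫ z : Rn n × Rn n, (cutoff ((4 ^ J)⁻¹) z : ℂ) *
        (a x z.1 z.2 * osc ⟪x, z.1 + z.2⟫ * (fourierT f z.1 * fourierT g z.2)) := by
    intro J
    unfold bilinOp
    rw [← integral_finsetSum _ fun j _ => integrable_of_norm_le (cD j) (hD j) f g x]
    congr 1; funext z
    rw [← sum_annular, Complex.ofReal_sum, Finset.sum_mul]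
    refine Finset.sum_congr rfl fun j _ => ?_
    rw [dyadicPiece]
    ring
  simp only [e, Tbilin_eq_bilinOp hc h]
  have hI := integrable_of_norm_le hc (fun p => h p.1 p.2.1 p.2.2) f g x
  refine tendsto_integral_of_dominated_convergence _ (fun J => ?_) hI.norm (fun J => ?_) ?_
  · exact (smooth_cutoff _).continuous.aestronglyMeasurable.mul hI.aestronglyMeasurable
  · refine Filter.Eventually.of_forall fun z => ?_
    rw [norm_mul, Complex.norm_real]
    exact mul_le_of_le_one_left (norm_nonneg _) (abs_cutoff_le _ _)
  · refine Filter.Eventually.of_forall fun z => ?_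
    simpa using (tendsto_cutoff z).mul_const
      (a x z.1 z.2 * osc ⟪x, z.1 + z.2⟫ * (fourierT f z.1 * fourierT g z.2))

end Summation

theorem statement13 (n : ℕ) (m ρ δ : ℝ)
    (hδ0 : 0 ≤ δ) (hδρ : δ ≤ ρ) (hρ1 : ρ ≤ 1) (hδ1 : δ < 1)
    (a : Rn n → Rn n → Rn n → ℂ) (ha : BilinSmRhoDelta n m ρ δ a)
    (p q r : ℝ≥0∞) (hp : 1 ≤ p) (hq : 1 ≤ q) (hr : 1 ≤ r)
    (hpqr : 1 / r = 1 / q + 1 / p)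
    (hm : m < (n : ℝ) * (ρ - 1) *
      max (max (1 / 2) (2 * (p⁻¹).toReal - 1 / 2))
          (max (2 * (q⁻¹).toReal - 1 / 2) (3 / 2 - 2 * (r⁻¹).toReal))) :
    ∃ Cst : ℝ≥0, 0 < Cst ∧ ∀ (f g : SchwartzMap (Rn n) ℂ),
      eLpNorm (fun x => Tbilin a (⇑f) (⇑g) x) r volume ≤
        Cst * eLpNorm (⇑f) q volume * eLpNorm (⇑g) p volume := by
  have hM : 1 / 2 ≤ lossExp p q r := (le_max_left _ _).trans (le_max_left _ _)
  have hm' : m < n * (ρ - 1) * lossExp p q r := hm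
  have hexp : m + (1 - ρ) * (n * lossExp p q r) < 0 := by linarith
  have hm0 : m ≤ 0 := by
    have : 0 ≤ (1 - ρ) * (n * lossExp p q r) :=
      mul_nonneg (by linarith) (mul_nonneg n.cast_nonneg (by linarith))
    linarith
  obtain ⟨C₀, hC₀, hb⟩ := ha.exists_norm_le hm0
  obtain ⟨C, hC⟩ := exists_eLpNorm_dyadicPiece_le hδρ hρ1 ha hp hq hr hpqr
  set θ := ENNReal.ofReal (2 ^ (m + (1 - ρ) * (n * lossExp p q r))) with hθ
  have hθ1 : θ < 1 := by
    rw [hθ, ENNReal.ofReal_lt_one]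
    exact Real.rpow_lt_one_of_one_lt_of_neg one_lt_two hexp
  have hS : C * (1 - θ)⁻¹ ≠ ∞ :=
    ENNReal.mul_ne_top ENNReal.coe_ne_top (ENNReal.inv_ne_top.2 (tsub_pos_of_lt hθ1).ne')
  refine ⟨(C * (1 - θ)⁻¹).toNNReal + 1, by positivity, fun f g => ?_⟩
  set X := eLpNorm f q volume * eLpNorm g p volume with hX
  have cD : ∀ j, Continuous (dyadicPiece a j) := fun j =>
    ha.1.continuous.mul ((smooth_annular j).continuous.comp continuous_snd)
  have hmeas : ∀ j, AEStronglyMeasurable (bilinOp (dyadicPiece a j) f g) volume := fun j =>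
    (stronglyMeasurable_bilinOp (cD j) f.integrable g.integrable).aestronglyMeasurable
  have hsum : ∀ J : ℕ, eLpNorm (∑ j ∈ Finset.range (J + 1), bilinOp (dyadicPiece a j) f g) r
      volume ≤ C * (1 - θ)⁻¹ * X := by
    intro J
    calc _ ≤ ∑ j ∈ Finset.range (J + 1), eLpNorm (bilinOp (dyadicPiece a j) f g) r volume :=
          eLpNorm_sum_le (fun j _ => hmeas j) hr
      _ ≤ ∑ j ∈ Finset.range (J + 1), C * θ ^ j * X := Finset.sum_le_sum fun j _ =>
          hC j f g f.continuous f.integrable g.continuous g.integrable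
      _ = C * (∑ j ∈ Finset.range (J + 1), θ ^ j) * X := by
          rw [Finset.mul_sum, Finset.sum_mul]
      _ ≤ C * (1 - θ)⁻¹ * X := by
          gcongr
          rw [← ENNReal.tsum_geometric]
          exact ENNReal.sum_le_tsum _
  have hlim := Lp.eLpNorm_lim_le_liminf_eLpNorm (p := r)
    (fun J => Finset.aestronglyMeasurable_sum (Finset.range (J + 1)) fun j _ => hmeas j)
    (fun x => Tbilin a f g x) (Filter.Eventually.of_forall fun x => by
      simpa only [Finset.sum_apply] using tendsto_sum_bilinOp_dyadicPiece ha.1 hC₀ hb f g x)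
  calc _ ≤ C * (1 - θ)⁻¹ * X := hlim.trans
        (Filter.liminf_le_of_frequently_le' (Filter.Frequently.of_forall hsum))
    _ ≤ ((C * (1 - θ)⁻¹).toNNReal + 1 : ℝ≥0) * X := by
        gcongr
        rw [ENNReal.coe_add, ENNReal.coe_toNNReal hS]
        exact le_self_add
    _ = _ := by rw [hX, mul_assoc]
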